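/- arXiv:2305.03543 — 2 statements merged into one kernel-verified Lean document; each statement's English description precedes it below -/
import Mathlib

section
/- Fix η > 0. For every k > 0 there is n_0 such that for all n ≥ n_0, all γ ∈ [−1,1], and every partition [2n] = A_1 ∪ A_2 with |A_1| = |A_2| = n: for G ∼ G(2n,1/2), letting E_irreg be the event that there exist a vertex v ∈ [2n] and i ∈ {1,2} with |deg(v, A_i) − n/2| ≥ n^{1/2+η}, one has P[E_irreg | E_1] ≤ n^{−k}. -/
/-- The probability, under the uniform measure on labeled graphs on `Fin n`
(equivalently under `G(n,1/2)`), of a graph property `P`. -/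
noncomputable def graphProb (n : ℕ) (P : SimpleGraph (Fin n) → Prop) : ℝ :=
  (Nat.card {G : SimpleGraph (Fin n) // P G} : ℝ) / 2 ^ n.choose 2

/-- `deg(v,S)`: the number of neighbors of `v` inside the vertex set `S`. -/
noncomputable def degIn {n : ℕ} (G : SimpleGraph (Fin n)) (v : Fin n)
    (S : Finset (Fin n)) : ℕ :=
  Nat.card {w : Fin n // w ∈ S ∧ G.Adj v w}

/-- The friendliness event for the partition `A ∪ Aᶜ` with margin `t`: every vertex has
at least `t` more neighbours in its own part than in the other part. -/
def FriendlyPair {m : ℕ} (G : SimpleGraph (Fin m)) (A : Finset (Fin m)) (t : ℝ) : Prop :=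
  (∀ v ∈ A, (degIn G v Aᶜ : ℝ) + t ≤ (degIn G v A : ℝ)) ∧
  (∀ v ∈ (Aᶜ : Finset (Fin m)), (degIn G v A : ℝ) + t ≤ (degIn G v Aᶜ : ℝ))

open Finset

namespace SimpleGraph

variable {V : Type*}

open Classical in
/-- The neighbours of `w`, with classical decidability. -/
noncomputable def nbrs [Fintype V] (G : SimpleGraph V) (w : V) : Finset V := {x | G.Adj w x}

lemma mem_nbrs [Fintype V] {G : SimpleGraph V} {w x : V} : x ∈ G.nbrs w ↔ G.Adj w x := by
  simp [nbrs]

open Classical in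
/-- A graph is the same as the graph induced on the complement of a vertex `v` together with
the neighbourhood of `v`. -/
noncomputable def splitEquiv [Fintype V] (v : V) :
    SimpleGraph V ≃ SimpleGraph {w : V // w ≠ v} × Finset {w : V // w ≠ v} where
  toFun G := (G.comap Subtype.val, Finset.univ.filter fun w => G.Adj v w)
  invFun p :=
    { Adj := fun a b =>
        (∃ (ha : a ≠ v) (hb : b ≠ v), p.1.Adj ⟨a, ha⟩ ⟨b, hb⟩) ∨
        (a = v ∧ ∃ hb : b ≠ v, ⟨b, hb⟩ ∈ p.2) ∨ (b = v ∧ ∃ ha : a ≠ v, ⟨a, ha⟩ ∈ p.2)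
      symm := ⟨by
        rintro a b (⟨ha, hb, h⟩ | h | h)
        · exact Or.inl ⟨hb, ha, h.symm⟩
        · exact Or.inr (Or.inr h)
        · exact Or.inr (Or.inl h)⟩
      loopless := ⟨by
        rintro a (⟨ha, hb, h⟩ | ⟨h, hb, -⟩ | ⟨h, hb, -⟩)
        · exact p.1.loopless.irrefl _ h
        · exact hb h
        · exact hb h⟩ }
  left_inv G := by
    ext a b
    by_cases ha : a = v <;> by_cases hb : b = v <;> simp [ha, hb, G.adj_comm]
  right_inv p := by
    ext a b
    · simp [a.2, b.2]
    · simp [a.2]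

variable [Fintype V]

lemma card_nbrs_self (v : V) (G : SimpleGraph V) :
    #(G.nbrs v) = #(splitEquiv v G).2 := by
  classical
  rw [← Finset.card_map (Function.Embedding.subtype _)]
  congr 1
  ext x
  simp only [mem_nbrs, splitEquiv, Equiv.coe_fn_mk, mem_map, mem_filter, mem_univ, true_and,
    Function.Embedding.coe_subtype, Subtype.exists, exists_and_right, exists_eq_right]
  exact ⟨fun h => ⟨h.ne', h⟩, fun h => h.2⟩

lemma card_nbrs_inter [DecidableEq V] (v : V) (G : SimpleGraph V) (S : Finset V) :
    #(G.nbrs v ∩ S) = #((splitEquiv v G).2 ∩ S.subtype (· ≠ v)) := by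
  classical
  rw [← Finset.card_map (Function.Embedding.subtype _)]
  congr 1
  ext x
  simp only [mem_nbrs, splitEquiv, Equiv.coe_fn_mk, mem_map, mem_filter, mem_univ, true_and,
    Function.Embedding.coe_subtype, Subtype.exists, exists_and_right, exists_eq_right, mem_inter,
    mem_subtype]
  exact ⟨fun h => ⟨⟨h.1.ne', h.1⟩, h.2⟩, fun h => ⟨h.1.2, h.2⟩⟩

open Classical in
lemma card_nbrs_of_ne (v : V) (G : SimpleGraph V) (w : {w : V // w ≠ v}) :
    #(G.nbrs w) = #((splitEquiv v G).1.nbrs w) + if w ∈ (splitEquiv v G).2 then 1 else 0 := by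
  have hv : w ∈ (splitEquiv v G).2 ↔ G.Adj w v := by simp [splitEquiv, G.adj_comm]
  have h : G.nbrs w = ((splitEquiv v G).1.nbrs w).map (Function.Embedding.subtype _) ∪
      if G.Adj w v then {v} else ∅ := by
    ext x
    by_cases hx : x = v
    · subst hx
      by_cases h : G.Adj w x <;> simp [mem_nbrs, h]
    · by_cases h : G.Adj w v <;> simp [mem_nbrs, h, hx, splitEquiv]
  simp only [hv]
  rw [h, card_union_of_disjoint, card_map]
  · split_ifs <;> simp
  · split_ifs <;> simp

open Classical in
lemma nbrs_eq_neighborFinset (G : SimpleGraph V) (w : V) : G.nbrs w = G.neighborFinset w := by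
  ext x; simp [mem_nbrs]

lemma nbrs_mono {G H : SimpleGraph V} (h : G ≤ H) (w : V) : G.nbrs w ⊆ H.nbrs w := fun x hx => by
  rw [mem_nbrs] at *; exact h hx

open Classical in
lemma sum_apply_card_edgeFinset {M : Type*} [AddCommMonoid M] (φ : ℕ → M) :
    ∑ G : SimpleGraph V, φ #G.edgeFinset =
      ∑ T ∈ (⊤ : SimpleGraph V).edgeFinset.powerset, φ #T := by
  refine Finset.sum_bij (fun G _ => G.edgeFinset) ?_ ?_ ?_ ?_
  · intro G _
    exact mem_powerset.2 (edgeFinset_mono le_top)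
  · intro G _ H _ h
    exact edgeFinset_inj.1 h
  · intro T hT
    refine ⟨fromEdgeSet (T : Set (Sym2 V)), mem_univ _, ?_⟩
    ext e
    simp only [mem_edgeFinset, edgeSet_fromEdgeSet, Set.mem_sdiff, mem_coe,
      and_iff_left_iff_imp]
    intro he
    have := Finset.mem_powerset.1 hT he
    simpa using this
  · intro G _
    rfl

open Classical in
lemma card_simpleGraph_eq : Fintype.card (SimpleGraph V) = 2 ^ (Fintype.card V).choose 2 := by
  have h := sum_apply_card_edgeFinset (V := V) (fun _ => 1)
  simp only [sum_const, card_univ, card_powerset, card_edgeFinset_top_eq_card_choose_two,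
    smul_eq_mul, mul_one] at h
  exact h

open Classical in
/-- Chernoff bound for the number of edges, in terms of degrees. -/
lemma sum_exp_degree_le (l : ℝ) :
    ∑ G : SimpleGraph V,
      Real.exp (l * ((∑ a, (2 * (#(G.nbrs a) : ℝ) - (Fintype.card V - 1))) / 2)) ≤
      Fintype.card (SimpleGraph V) * Real.exp (l ^ 2 / 2 * (Fintype.card V).choose 2) := by
  set N := (Fintype.card V).choose 2 with hN
  have key : ∀ G : SimpleGraph V,
      Real.exp (l * ((∑ a, (2 * (#(G.nbrs a) : ℝ) - (Fintype.card V - 1))) / 2)) =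
      Real.exp l ^ #G.edgeFinset * Real.exp (-l) ^ (N - #G.edgeFinset) := by
    intro G
    have h1 : #G.edgeFinset ≤ N := by
      rw [hN, ← card_edgeFinset_top_eq_card_choose_two]
      exact card_le_card (edgeFinset_mono le_top)
    have h2 : ∑ a, (#(G.nbrs a) : ℝ) = 2 * #G.edgeFinset := by
      have := G.sum_degrees_eq_twice_card_edges
      simp only [← card_neighborFinset_eq_degree, ← nbrs_eq_neighborFinset] at this
      exact_mod_cast this
    have h3 : (Fintype.card V : ℝ) * (Fintype.card V - 1) = 2 * N := by
      rw [hN, Nat.cast_choose_two]; ring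
    rw [← Real.exp_nat_mul, ← Real.exp_nat_mul, ← Real.exp_add, Nat.cast_sub h1,
      sum_sub_distrib, ← mul_sum, h2]
    congr 1
    simp only [sum_const, card_univ, nsmul_eq_mul, h3]
    ring
  simp_rw [key]
  rw [sum_apply_card_edgeFinset
    (fun k => Real.exp l ^ k * Real.exp (-l) ^ (N - k))]
  have := Finset.sum_pow_mul_eq_add_pow (Real.exp l) (Real.exp (-l))
    (⊤ : SimpleGraph V).edgeFinset
  rw [card_edgeFinset_top_eq_card_choose_two] at this
  rw [this, card_simpleGraph_eq, mul_comm (l ^ 2 / 2), Real.exp_nat_mul]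
  push_cast
  rw [← mul_pow]
  refine pow_le_pow_left₀ (by positivity) ?_ _
  have := Real.cosh_le_exp_half_sq l
  rw [Real.cosh_eq] at this
  linarith

open Classical in
lemma card_degree_ge (w : V) (d : ℕ) :
    #{G : SimpleGraph V | d ≤ #(G.nbrs w)} =
      Fintype.card (SimpleGraph {x : V // x ≠ w}) *
        #{N : Finset {x : V // x ≠ w} | d ≤ #N} := by
  rw [← card_univ, ← card_product]
  refine Finset.card_bij (fun G _ => splitEquiv w G) ?_ ?_ ?_
  · intro G hG
    simpa [card_nbrs_self] using hG
  · intro G _ H _ h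
    exact (splitEquiv w).injective h
  · intro p hp
    refine ⟨(splitEquiv w).symm p, ?_, by simp⟩
    simpa [card_nbrs_self] using hp

open Classical in
lemma choose_le_card_ge {α : Type*} [Fintype α] {d e : ℕ} (h : d ≤ e) :
    (Fintype.card α).choose e ≤ #{N : Finset α | d ≤ #N} := by
  rw [← card_univ, ← card_powersetCard]
  refine card_le_card fun N hN => ?_
  have := (mem_powersetCard.1 hN).2
  simp [this, h]

open Classical in
/-- The graphs of minimum degree at least `d`. -/
noncomputable def minDegGraphs (V : Type*) [Fintype V] (d : ℕ) : Finset (SimpleGraph V) :=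
  {G | ∀ w, d ≤ #(G.nbrs w)}

open Classical in
lemma mem_minDegGraphs {G : SimpleGraph V} {d : ℕ} :
    G ∈ minDegGraphs V d ↔ ∀ w, d ≤ #(G.nbrs w) := by simp [minDegGraphs]

open Classical in
/-- By Harris' inequality, the minimum degree is large with probability at least the product of
the probabilities for the individual vertices. -/
lemma pow_mul_card_le_card_minDegGraphs {m d e : ℕ} {q : ℝ} (hq : 0 ≤ q)
    (hV : Fintype.card V = m + 1) (hde : d ≤ e) (h : q * 2 ^ m ≤ m.choose e) :
    q ^ (m + 1) * Fintype.card (SimpleGraph V) ≤ #(minDegGraphs V d) := by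
  have hone : ∀ w : V, q * Fintype.card (SimpleGraph V) ≤
      #{G : SimpleGraph V | d ≤ #(G.nbrs w)} := by
    intro w
    have hW : Fintype.card {x : V // x ≠ w} = m := by
      rw [Fintype.card_subtype_compl, hV]; simp
    have h1 := Fintype.card_congr (splitEquiv w)
    rw [Fintype.card_prod, Fintype.card_finset, hW] at h1
    rw [card_degree_ge, h1]
    have h2 := choose_le_card_ge (α := {x : V // x ≠ w}) hde
    rw [hW] at h2
    have h3 : q * 2 ^ m ≤ #{N : Finset {x : V // x ≠ w} | d ≤ #N} :=
      h.trans (by exact_mod_cast h2)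
    push_cast
    calc _ = (Fintype.card (SimpleGraph {x : V // x ≠ w}) : ℝ) * (q * 2 ^ m) := by ring
      _ ≤ _ := by gcongr
  have hs : ∀ s : Finset V, q ^ #s * Fintype.card (SimpleGraph V) ≤
      #{G : SimpleGraph V | ∀ w ∈ s, d ≤ #(G.nbrs w)} := by
    intro s
    induction s using Finset.induction with
    | empty => simp
    | insert w s hw ih =>
      have hf := fkg (α := SimpleGraph V) (β := ℝ) (μ := fun _ => 1)
        (f := fun G => if ∀ w ∈ s, d ≤ #(G.nbrs w) then 1 else 0)
        (g := fun G => if d ≤ #(G.nbrs w) then 1 else 0)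
        (by intro G; simp) (by intro G; dsimp; split_ifs <;> simp)
        (by intro G; dsimp; split_ifs <;> simp)
        (by
          intro G H hGH
          dsimp only
          split_ifs with h1 h2 <;> norm_num
          exact h2 fun w hw => (h1 w hw).trans (card_le_card (nbrs_mono hGH w)))
        (by
          intro G H hGH
          dsimp only
          split_ifs with h1 h2 <;> norm_num
          exact h2 (h1.trans (card_le_card (nbrs_mono hGH w))))
        (by simp)
      simp only [← ite_and, mul_ite, mul_one, mul_zero, sum_boole, sum_const, card_univ,
        nsmul_eq_mul] at hf
      have hset : #{G : SimpleGraph V | ∀ x ∈ insert w s, d ≤ #(G.nbrs x)} =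
          #{G : SimpleGraph V | d ≤ #(G.nbrs w) ∧ ∀ x ∈ s, d ≤ #(G.nbrs x)} := by
        simp
      have hpos : (0 : ℝ) < Fintype.card (SimpleGraph V) := by
        exact_mod_cast Fintype.card_pos
      rw [hset, card_insert_of_notMem hw]
      refine le_of_mul_le_mul_left ?_ hpos
      refine le_trans ?_ hf
      calc _ = (q ^ #s * Fintype.card (SimpleGraph V)) * (q * Fintype.card (SimpleGraph V)) := by
            ring
        _ ≤ _ := mul_le_mul ih (hone w) (by positivity) (by positivity)
  have := hs univ
  rw [card_univ, hV] at this
  simpa [minDegGraphs] using this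

open Classical in
/-- The vertices of degree exactly `d`. -/
noncomputable def tight (d : ℕ) (G : SimpleGraph V) : Finset V := {w | #(G.nbrs w) = d}

open Classical in
lemma card_not_adj_add_card_tight_le (d : ℕ) {a b : V} (hab : a ≠ b) :
    #{G ∈ minDegGraphs V d | ¬ G.Adj a b} + #{G ∈ minDegGraphs V d | G.Adj a b ∧ a ∈ tight d G} ≤
      #{G ∈ minDegGraphs V d | G.Adj a b} := by
  have h1 : #{G ∈ minDegGraphs V d | ¬ G.Adj a b} ≤
      #{G ∈ minDegGraphs V d | G.Adj a b ∧ a ∉ tight d G} := by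
    refine Finset.card_le_card_of_injOn (fun G => G ⊔ edge a b) ?_ ?_
    · intro G hG
      simp only [coe_filter, Set.mem_ofPred_eq, mem_minDegGraphs] at hG ⊢
      obtain ⟨hG, hadj⟩ := hG
      refine ⟨fun w => (hG w).trans (card_le_card (nbrs_mono le_sup_left w)), ?_, ?_⟩
      · simp [edge_adj, hab]
      · have : insert b (G.nbrs a) ⊆ (G ⊔ edge a b).nbrs a := by
          intro x hx
          rw [mem_insert, mem_nbrs] at hx
          rw [mem_nbrs]
          rcases hx with rfl | hx
          · simp [edge_adj, hab]
          · exact Or.inl hx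
        have h := card_le_card this
        rw [card_insert_of_notMem (by rwa [mem_nbrs])] at h
        simp only [tight, mem_filter, mem_univ, true_and]
        have := hG a
        omega
    · intro G hG H hH h
      simp only [coe_filter, Set.mem_ofPred_eq] at hG hH
      have hG' := hG.2
      have hH' := hH.2
      have h' : ∀ x y, (G ⊔ edge a b).Adj x y ↔ (H ⊔ edge a b).Adj x y := by
        intro x y; exact iff_of_eq (congrArg (fun K : SimpleGraph V => K.Adj x y) h)
      ext x y
      have := h' x y
      simp only [sup_adj, edge_adj] at this
      by_cases hxy : (a = x ∧ b = y ∨ a = y ∧ b = x)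
      · rcases hxy with ⟨rfl, rfl⟩ | ⟨rfl, rfl⟩
        · simp [hG', hH']
        · rw [G.adj_comm, H.adj_comm]; simp [hG', hH']
      · grind
  have h2 := Finset.card_filter_add_card_filter_not (s := {G ∈ minDegGraphs V d | G.Adj a b})
    (fun G => a ∈ tight d G)
  simp only [filter_filter] at h2
  omega

open Classical in
lemma sum_card_tight_le (d : ℕ) :
    (d : ℝ) * ∑ G ∈ minDegGraphs V d, (#(tight d G) : ℝ) ≤
      ∑ G ∈ minDegGraphs V d, ∑ a, (2 * (#(G.nbrs a) : ℝ) - (Fintype.card V - 1)) := by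
  have h0 : ∀ a b : V, a ≠ b → 0 ≤ ∑ G ∈ minDegGraphs V d,
      ((if G.Adj a b then (1 : ℝ) else 0) - (if ¬ G.Adj a b then 1 else 0) -
        (if G.Adj a b ∧ a ∈ tight d G then 1 else 0)) := by
    intro a b hab
    rw [sum_sub_distrib, sum_sub_distrib, sum_boole, sum_boole, sum_boole]
    have := card_not_adj_add_card_tight_le d hab
    have : ((#{G ∈ minDegGraphs V d | ¬ G.Adj a b} : ℝ) +
      #{G ∈ minDegGraphs V d | G.Adj a b ∧ a ∈ tight d G} ≤
      #{G ∈ minDegGraphs V d | G.Adj a b}) := by exact_mod_cast this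
    linarith
  have h1 : 0 ≤ ∑ a : V, ∑ b ∈ univ.erase a, ∑ G ∈ minDegGraphs V d,
      ((if G.Adj a b then (1 : ℝ) else 0) - (if ¬ G.Adj a b then 1 else 0) -
        (if G.Adj a b ∧ a ∈ tight d G then 1 else 0)) :=
    sum_nonneg fun a _ => sum_nonneg fun b hb => h0 a b (ne_of_mem_erase hb).symm
  have h2 : ∀ a : V, ∀ G : SimpleGraph V, ∑ b ∈ univ.erase a,
      ((if G.Adj a b then (1 : ℝ) else 0) - (if ¬ G.Adj a b then 1 else 0) -
        (if G.Adj a b ∧ a ∈ tight d G then 1 else 0)) =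
      2 * (#(G.nbrs a) : ℝ) - (Fintype.card V - 1) - if a ∈ tight d G then (d : ℝ) else 0 := by
    intro a G
    have e1 : #{b ∈ univ.erase a | G.Adj a b} = #(G.nbrs a) := by
      congr 1; ext x; simp only [mem_filter, mem_erase, mem_univ, mem_nbrs]
      exact ⟨fun h => h.2, fun h => ⟨⟨h.ne', trivial⟩, h⟩⟩
    have e2 := Finset.card_filter_add_card_filter_not (s := univ.erase a) (fun b => G.Adj a b)
    have e3 : #((univ : Finset V).erase a) + 1 = Fintype.card V := by
      rw [card_erase_add_one (mem_univ a), card_univ]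
    rw [e1] at e2
    have e2' : (#(G.nbrs a) : ℝ) + #{b ∈ univ.erase a | ¬ G.Adj a b} + 1 = Fintype.card V := by
      rw [← e3, ← e2]; push_cast; ring
    rw [sum_sub_distrib, sum_sub_distrib, sum_boole, sum_boole, e1]
    have e4 : ∑ b ∈ univ.erase a, (if G.Adj a b ∧ a ∈ tight d G then (1 : ℝ) else 0) =
        if a ∈ tight d G then (d : ℝ) else 0 := by
      by_cases ht : a ∈ tight d G
      · have : #(G.nbrs a) = d := by simpa [tight] using ht
        simp only [ht, and_true, if_true]
        rw [sum_boole, e1, this]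
      · simp [ht]
    rw [e4]
    linarith
  have h3 : ∑ a : V, ∑ b ∈ univ.erase a, ∑ G ∈ minDegGraphs V d,
      ((if G.Adj a b then (1 : ℝ) else 0) - (if ¬ G.Adj a b then 1 else 0) -
        (if G.Adj a b ∧ a ∈ tight d G then 1 else 0)) =
      ∑ G ∈ minDegGraphs V d, (∑ a, (2 * (#(G.nbrs a) : ℝ) - (Fintype.card V - 1)) -
        d * #(tight d G)) := by
    calc _ = ∑ a : V, ∑ G ∈ minDegGraphs V d, (2 * (#(G.nbrs a) : ℝ) - (Fintype.card V - 1) -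
          if a ∈ tight d G then (d : ℝ) else 0) := by
          refine sum_congr rfl fun a _ => ?_
          rw [sum_comm]
          exact sum_congr rfl fun G _ => h2 a G
      _ = _ := by
          rw [sum_comm]
          refine sum_congr rfl fun G _ => ?_
          rw [sum_sub_distrib]
          congr 1
          rw [← sum_filter]
          simp [mul_comm]
  rw [h3, sum_sub_distrib, ← mul_sum] at h1
  linarith

lemma card_mul_exp_le_sum_exp {ι : Type*} {s : Finset ι} (hs : s.Nonempty) (x : ι → ℝ) :
    #s * Real.exp ((∑ i ∈ s, x i) / #s) ≤ ∑ i ∈ s, Real.exp (x i) := by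
  have hc : (0 : ℝ) < #s := by exact_mod_cast hs.card_pos
  set a := (∑ i ∈ s, x i) / #s with ha
  have h : ∀ i ∈ s, Real.exp a * (x i - a + 1) ≤ Real.exp (x i) := by
    intro i _
    calc _ ≤ Real.exp a * Real.exp (x i - a) := by gcongr; exact Real.add_one_le_exp _
      _ = _ := by rw [← Real.exp_add]; ring_nf
  refine le_trans (le_of_eq ?_) (sum_le_sum h)
  rw [← mul_sum, sum_add_distrib, sum_sub_distrib]
  have : ∑ i ∈ s, x i = #s * a := by rw [ha]; field_simp
  rw [this]
  simp
  ring

open Classical in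
/-- The mean number of vertices of degree exactly `d` in a random graph conditioned on having
minimum degree at least `d`. -/
lemma mean_card_tight_le {m d e : ℕ} {q l : ℝ} (hq : 0 < q) (hl : 0 < l)
    (hV : Fintype.card V = m + 1) (hde : d ≤ e) (h : q * 2 ^ m ≤ m.choose e) :
    (d : ℝ) * ((∑ G ∈ minDegGraphs V d, (#(tight d G) : ℝ)) / #(minDegGraphs V d)) ≤
      2 * ((m + 1) * (-Real.log q) / l + l / 2 * (m + 1).choose 2) := by
  have hcard := pow_mul_card_le_card_minDegGraphs hq.le hV hde h
  have hpos : (0 : ℝ) < Fintype.card (SimpleGraph V) := by exact_mod_cast Fintype.card_pos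
  have hM : (0 : ℝ) < #(minDegGraphs V d) := lt_of_lt_of_le (by positivity) hcard
  have hne : (minDegGraphs V d).Nonempty := by
    rw [← card_pos]; exact_mod_cast hM
  have h1 := card_mul_exp_le_sum_exp hne
    (fun G => l * ((∑ a, (2 * (#(G.nbrs a) : ℝ) - (Fintype.card V - 1))) / 2))
  have h2 := h1.trans (sum_le_univ_sum_of_nonneg fun G => (Real.exp_pos _).le)
  have h3 := h2.trans (sum_exp_degree_le l)
  rw [← mul_sum, ← sum_div] at h3
  set X := ∑ G ∈ minDegGraphs V d, ∑ a, (2 * (#(G.nbrs a) : ℝ) - (Fintype.card V - 1)) with hX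
  set M : ℝ := ((#(minDegGraphs V d) : ℕ) : ℝ) with hMdef
  have h4 : q ^ (m + 1) * Real.exp (l * (X / 2) / M) ≤
      Real.exp (l ^ 2 / 2 * (Fintype.card V).choose 2) := by
    refine le_of_mul_le_mul_left ?_ hpos
    calc _ = (q ^ (m + 1) * Fintype.card (SimpleGraph V)) * Real.exp (l * (X / 2) / M) := by ring
      _ ≤ M * Real.exp (l * (X / 2) / M) := by gcongr
      _ ≤ _ := h3
  have h5 : q ^ (m + 1) = Real.exp ((m + 1) * Real.log q) := by
    rw [← Real.exp_log hq, ← Real.exp_nat_mul, Real.log_exp]; push_cast; rfl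
  rw [h5, ← Real.exp_add, Real.exp_le_exp, hV] at h4
  have h6 := sum_card_tight_le (V := V) d
  rw [← hX] at h6
  have h7 : (d : ℝ) * ((∑ G ∈ minDegGraphs V d, (#(tight d G) : ℝ)) / M) ≤ X / M := by
    rw [← mul_div_assoc]; gcongr
  refine h7.trans ?_
  have h8 : X / M = 2 * ((l * (X / 2) / M) / l) := by field_simp
  rw [h8]
  gcongr
  rw [div_le_iff₀ hl]
  have : ((m + 1) * (-Real.log q) / l + l / 2 * (m + 1).choose 2) * l =
    (m + 1) * (-Real.log q) + l ^ 2 / 2 * (m + 1).choose 2 := by field_simp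
  rw [this]
  linarith

open Classical in
lemma sum_exp_card_inter_le {α : Type*} (U S : Finset α) (l : ℝ) :
    ∑ T ∈ U.powerset, Real.exp (l * (2 * #(T ∩ S) - #(U ∩ S))) ≤
      2 ^ #U * Real.exp (l ^ 2 / 2 * #(U ∩ S)) := by
  have h1 := Finset.prod_add (fun i : α => Real.exp (if i ∈ S then l else 0))
    (fun i => Real.exp (-if i ∈ S then l else 0)) U
  have h2 : ∀ T ∈ U.powerset, Real.exp (l * (2 * #(T ∩ S) - #(U ∩ S))) =
      (∏ i ∈ T, Real.exp (if i ∈ S then l else 0)) *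
        ∏ i ∈ U \ T, Real.exp (-if i ∈ S then l else 0) := by
    intro T hT
    rw [mem_powerset] at hT
    have hc : #(U ∩ S) = #(T ∩ S) + #((U \ T) ∩ S) := by
      rw [← card_union_of_disjoint]
      · congr 1; ext x; simp only [mem_inter, mem_union, mem_sdiff]
        have := @hT x
        tauto
      · rw [Finset.disjoint_left]; simp; tauto
    rw [← Real.exp_sum, ← Real.exp_sum, ← Real.exp_add, sum_neg_distrib, ← sum_filter,
      ← sum_filter, filter_mem_eq_inter, filter_mem_eq_inter, hc]
    congr 1
    simp
    ring
  rw [sum_congr rfl h2, ← h1]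
  have h3 : (2 : ℝ) ^ #U * Real.exp (l ^ 2 / 2 * #(U ∩ S)) =
      ∏ i ∈ U, (2 * Real.exp (if i ∈ S then l ^ 2 / 2 else 0)) := by
    rw [prod_mul_distrib, prod_const, ← Real.exp_sum, ← sum_filter, filter_mem_eq_inter]
    simp [mul_comm]
  rw [h3]
  refine prod_le_prod (fun i _ => by positivity) fun i _ => ?_
  split_ifs
  · have := Real.cosh_le_exp_half_sq l
    rw [Real.cosh_eq] at this
    linarith
  · norm_num

open Classical in
/-- Hoeffding's inequality for the intersection of a random subset of `U` with `S`. -/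
lemma card_deviation_le {α : Type*} (U S : Finset α) {a n : ℝ} (ha : 0 ≤ a) (hn : 0 < n)
    (hS : (#(U ∩ S) : ℝ) ≤ n) :
    (#{T ∈ U.powerset | a ≤ |2 * (#(T ∩ S) : ℝ) - #(U ∩ S)|} : ℝ) ≤
      2 ^ #U * (2 * Real.exp (-(a ^ 2 / (2 * n)))) := by
  have h : ∀ T ∈ {T ∈ U.powerset | a ≤ |2 * (#(T ∩ S) : ℝ) - #(U ∩ S)|},
      Real.exp (a ^ 2 / n) ≤ Real.exp (a / n * (2 * #(T ∩ S) - #(U ∩ S))) +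
        Real.exp (-(a / n) * (2 * #(T ∩ S) - #(U ∩ S))) := by
    intro T hT
    have hT := (mem_filter.1 hT).2
    rcases le_abs.1 hT with h | h
    · refine le_trans (Real.exp_le_exp.2 ?_) (le_add_of_nonneg_right (Real.exp_pos _).le)
      calc a ^ 2 / n = a / n * a := by ring
        _ ≤ _ := by gcongr
    · refine le_trans (Real.exp_le_exp.2 ?_) (le_add_of_nonneg_left (Real.exp_pos _).le)
      calc a ^ 2 / n = a / n * a := by ring
        _ ≤ a / n * -(2 * #(T ∩ S) - #(U ∩ S)) := by gcongr
        _ = _ := by ring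
  have h1 := sum_le_sum h
  rw [sum_const, nsmul_eq_mul] at h1
  have h2 := h1.trans (sum_le_sum_of_subset_of_nonneg (filter_subset _ _)
    fun T _ _ => by positivity)
  rw [sum_add_distrib] at h2
  have h3 := sum_exp_card_inter_le U S (a / n)
  have h4 := sum_exp_card_inter_le U S (-(a / n))
  have h5 : Real.exp ((a / n) ^ 2 / 2 * #(U ∩ S)) ≤ Real.exp (a ^ 2 / (2 * n)) := by
    rw [Real.exp_le_exp]
    calc _ ≤ (a / n) ^ 2 / 2 * n := by gcongr
      _ = _ := by field_simp
  rw [neg_sq] at h4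
  have h6 := mul_le_mul_of_nonneg_left h5 (show (0 : ℝ) ≤ 2 ^ #U by positivity)
  have h7 : (#{T ∈ U.powerset | a ≤ |2 * (#(T ∩ S) : ℝ) - #(U ∩ S)|} : ℝ) * Real.exp (a ^ 2 / n) ≤
      2 ^ #U * (2 * Real.exp (a ^ 2 / (2 * n))) := by linarith
  have h8 : Real.exp (a ^ 2 / (2 * n)) = Real.exp (-(a ^ 2 / (2 * n))) * Real.exp (a ^ 2 / n) := by
    rw [← Real.exp_add]; congr 1; field_simp; ring
  rw [h8] at h7
  refine le_of_mul_le_mul_right (h7.trans (le_of_eq (by ring))) (Real.exp_pos (a ^ 2 / n))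

open Classical in
lemma card_superset {α : Type*} [Fintype α] (F : Finset α) :
    (#{N : Finset α | F ⊆ N} : ℝ) = 2 ^ Fintype.card α * Real.exp (-Real.log 2 * #F) := by
  have h1 : ({N : Finset α | F ⊆ N} : Finset (Finset α)) = Icc F univ := by
    ext N; simp
  rw [h1, card_Icc_finset (subset_univ F), card_univ]
  have h2 : Real.exp (-Real.log 2 * #F) = ((2 : ℝ) ^ #F)⁻¹ := by
    rw [neg_mul, Real.exp_neg, mul_comm, Real.exp_nat_mul, Real.exp_log two_pos]
  rw [h2]
  push_cast
  rw [pow_sub₀ _ two_ne_zero (by rw [← card_univ]; exact card_le_card (subset_univ F))]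

open Classical in
lemma card_superset_card_ge {α : Type*} [Fintype α] (F : Finset α) {d e : ℕ} {q : ℝ}
    (hde : d ≤ e) (h : q * 2 ^ Fintype.card α ≤ (Fintype.card α).choose e) :
    q * 2 ^ Fintype.card α * Real.exp (-Real.log 2 * #F) ≤
      #{N : Finset α | F ⊆ N ∧ d ≤ #N} := by
  have h1 := IsUpperSet.le_card_inter_finset (α := α) (𝒜 := {N : Finset α | F ⊆ N})
    (ℬ := {N : Finset α | d ≤ #N})
    (by intro A B hAB hA; simp at *; exact hA.trans hAB)
    (by intro A B hAB hA; simp at *; exact hA.trans (card_le_card hAB))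
  rw [← filter_and] at h1
  have h2 : ((#{N : Finset α | F ⊆ N} : ℝ) * #{N : Finset α | d ≤ #N}) ≤
    2 ^ Fintype.card α * #{N : Finset α | F ⊆ N ∧ d ≤ #N} := by exact_mod_cast h1
  rw [card_superset] at h2
  have h3 : q * 2 ^ Fintype.card α ≤ #{N : Finset α | d ≤ #N} :=
    h.trans (by exact_mod_cast choose_le_card_ge hde)
  refine le_of_mul_le_mul_left (le_trans ?_ h2) (show (0 : ℝ) < 2 ^ Fintype.card α by positivity)
  calc _ = 2 ^ Fintype.card α * Real.exp (-Real.log 2 * #F) * (q * 2 ^ Fintype.card α) := by ring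
    _ ≤ _ := by gcongr

open Classical in
lemma card_superset_deviation_le {α : Type*} [Fintype α] (F S : Finset α) {n : ℕ} {K : ℝ}
    (hn : 0 < n) (hS : #S ≤ n) (hS' : n ≤ #S + 1) (hK : 0 ≤ K) :
    (#{N : Finset α | F ⊆ N ∧ K ≤ |(#(N ∩ S) : ℝ) - n / 2|} : ℝ) ≤
      2 ^ Fintype.card α * (Real.exp (-Real.log 2 * #F) * (2 * Real.exp (-(K ^ 2 / (2 * n)))) +
        2 * Real.exp (-Real.log 2 * K)) := by
  have hlog : 0 < Real.log 2 := Real.log_pos one_lt_two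
  rw [mul_add]
  by_cases hF : (#F : ℝ) ≤ K - 1
  · refine le_trans ?_ (le_add_of_nonneg_right (by positivity))
    have hU : (#(Fᶜ ∩ S) : ℝ) ≤ n := by
      exact_mod_cast (card_le_card inter_subset_right).trans hS
    have h1 := card_deviation_le Fᶜ S (a := K) (n := n) hK (by exact_mod_cast hn) hU
    have h2 : (2 : ℝ) ^ #Fᶜ = 2 ^ Fintype.card α * Real.exp (-Real.log 2 * #F) := by
      rw [← card_superset]
      have : ({N : Finset α | F ⊆ N} : Finset (Finset α)) = Icc F univ := by
        ext N; simp
      rw [this, card_Icc_finset (subset_univ F), card_compl, card_univ]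
      push_cast; rfl
    rw [h2, mul_assoc] at h1
    refine le_trans ?_ h1
    rw [Nat.cast_le]
    refine Finset.card_le_card_of_injOn (fun N => N \ F) ?_ ?_
    · intro N hN
      simp only [coe_filter, mem_univ, true_and, Set.mem_ofPred_eq, mem_powerset] at hN ⊢
      obtain ⟨hFN, hN⟩ := hN
      refine ⟨fun x hx => by simp at hx ⊢; exact hx.2, ?_⟩
      have e1 : #(N ∩ S) = #((N \ F) ∩ S) + #(F ∩ S) := by
        rw [← card_union_of_disjoint]
        · congr 1; ext x; simp only [mem_inter, mem_union, mem_sdiff]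
          have := @hFN x
          tauto
        · rw [Finset.disjoint_left]; simp; tauto
      have e2 : #S = #(Fᶜ ∩ S) + #(F ∩ S) := by
        rw [← card_union_of_disjoint]
        · congr 1; ext x; simp only [mem_inter, mem_union, mem_compl]
          tauto
        · rw [Finset.disjoint_left]; simp; tauto
      have e3 : #(F ∩ S) ≤ #F := card_le_card inter_subset_left
      have e1' : (#(N ∩ S) : ℝ) = #((N \ F) ∩ S) + #(F ∩ S) := by exact_mod_cast e1
      have e2' : (#S : ℝ) = #(Fᶜ ∩ S) + #(F ∩ S) := by exact_mod_cast e2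
      have e3' : (#(F ∩ S) : ℝ) ≤ #F := by exact_mod_cast e3
      have hS1 : (#S : ℝ) ≤ n := by exact_mod_cast hS
      have hS2 : (n : ℝ) ≤ #S + 1 := by exact_mod_cast hS'
      have e4 : (0 : ℝ) ≤ #(F ∩ S) := by positivity
      rcases le_abs.1 hN with h | h
      · exact le_abs.2 (Or.inl (by linarith))
      · exact le_abs.2 (Or.inr (by linarith))
    · intro N hN N' hN' h
      simp only [coe_filter, mem_univ, true_and, Set.mem_ofPred_eq] at hN hN'
      rw [← sdiff_union_of_subset hN.1, ← sdiff_union_of_subset hN'.1]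
      exact congrArg (· ∪ F) h
  · refine le_trans ?_ (le_add_of_nonneg_left (by positivity))
    have h1 : (#{N : Finset α | F ⊆ N ∧ K ≤ |(#(N ∩ S) : ℝ) - n / 2|} : ℝ) ≤
        #{N : Finset α | F ⊆ N} := by
      rw [Nat.cast_le]
      refine card_le_card fun N hN => ?_
      simp only [mem_filter, mem_univ, true_and] at hN ⊢
      exact hN.1
    refine h1.trans ?_
    rw [card_superset]
    gcongr
    calc Real.exp (-Real.log 2 * #F) ≤ Real.exp (Real.log 2 + -Real.log 2 * K) := by
          rw [Real.exp_le_exp]; push Not at hF; nlinarith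
      _ = _ := by rw [Real.exp_add, Real.exp_log two_pos]

open Classical in
lemma card_minDegGraphs_filter (v : V) (d : ℕ) (P : Finset {w : V // w ≠ v} → Prop) :
    #{G ∈ minDegGraphs V (d + 1) | P (splitEquiv v G).2} =
      ∑ R ∈ minDegGraphs {w : V // w ≠ v} d,
        #{N : Finset {w : V // w ≠ v} | tight d R ⊆ N ∧ d + 1 ≤ #N ∧ P N} := by
  rw [← card_sigma]
  have key : ∀ G : SimpleGraph V, G ∈ minDegGraphs V (d + 1) ↔
      (splitEquiv v G).1 ∈ minDegGraphs _ d ∧ tight d (splitEquiv v G).1 ⊆ (splitEquiv v G).2 ∧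
        d + 1 ≤ #(splitEquiv v G).2 := by
    intro G
    simp only [mem_minDegGraphs]
    constructor
    · intro h
      refine ⟨fun w => ?_, fun w hw => ?_, by rw [← card_nbrs_self]; exact h v⟩
      · have := h w
        rw [card_nbrs_of_ne] at this
        split_ifs at this <;> omega
      · have := h w
        rw [card_nbrs_of_ne] at this
        simp only [tight, mem_filter, mem_univ, true_and] at hw
        by_contra hn
        rw [if_neg hn] at this
        omega
    · rintro ⟨h1, h2, h3⟩ w
      by_cases hw : w = v
      · rw [hw, card_nbrs_self]; exact h3
      · have h4 := card_nbrs_of_ne v G ⟨w, hw⟩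
        dsimp only at h4
        rw [h4]
        have h5 := h1 ⟨w, hw⟩
        split_ifs with h6
        · omega
        · have : ¬ #((splitEquiv v G).1.nbrs ⟨w, hw⟩) = d := fun h => h6 (h2 (by simp [tight, h]))
          omega
  refine Finset.card_bij (fun G _ => ⟨(splitEquiv v G).1, (splitEquiv v G).2⟩) ?_ ?_ ?_
  · intro G hG
    rw [mem_filter, key] at hG
    simp only [mem_sigma, mem_filter, mem_univ, true_and]
    tauto
  · intro G _ H _ h
    simp only [Sigma.mk.injEq, heq_eq_eq] at h
    exact (splitEquiv v).injective (Prod.ext h.1 h.2)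
  · rintro ⟨R, N⟩ h
    simp only [mem_sigma, mem_filter, mem_univ, true_and] at h
    refine ⟨(splitEquiv v).symm (R, N), ?_, by simp⟩
    rw [mem_filter, key]
    simp only [Equiv.apply_symm_apply]
    tauto

open Classical in
/-- In a random graph conditioned on having minimum degree at least `d + 1`, the number of
neighbours of `v` in `S` is concentrated. -/
lemma card_irregular_le (v : V) (S : Finset V) {m n d e : ℕ} {q l K : ℝ} (hq : 0 < q)
    (hl : 0 < l) (hV : Fintype.card V = m + 2) (hS : #S = n) (hn : 0 < n) (hd : 0 < d)
    (hde : d ≤ e) (h1 : q * 2 ^ m ≤ m.choose e) (h2 : q * 2 ^ (m + 1) ≤ (m + 1).choose (e + 1))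
    (hK : 0 ≤ K)
    (hKd : 2 * ((m + 1) * (-Real.log q) / l + l / 2 * (m + 1).choose 2) ≤ d * (K / 2)) :
    (#{G ∈ minDegGraphs V (d + 1) | K ≤ |(#(G.nbrs v ∩ S) : ℝ) - n / 2|} : ℝ) ≤
      (2 * Real.exp (-(K ^ 2 / (2 * n))) + 2 * Real.exp (-Real.log 2 * (K / 2))) / q *
        #(minDegGraphs V (d + 1)) := by
  have hW : Fintype.card {x : V // x ≠ v} = m + 1 := by
    rw [Fintype.card_subtype_compl, hV]; simp
  set S' := S.subtype (· ≠ v) with hS'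
  have hS1 : #S' = #(S.erase v) := by
    rw [hS', card_subtype, filter_ne']
  have hS2 : #S' ≤ n := by rw [hS1, ← hS]; exact card_le_card (erase_subset _ _)
  have hS3 : n ≤ #S' + 1 := by
    rw [hS1, ← hS]; have := pred_card_le_card_erase (s := S) (a := v); omega
  have hlog : 0 < Real.log 2 := Real.log_pos one_lt_two
  set MD := minDegGraphs {w : V // w ≠ v} d with hMD
  set Z := ∑ R ∈ MD, Real.exp (-Real.log 2 * #(tight d R)) with hZ
  have hgood : q * 2 ^ (m + 1) * Z ≤ #(minDegGraphs V (d + 1)) := by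
    have := card_minDegGraphs_filter v d (fun _ => True)
    simp only [filter_true, and_true] at this
    rw [this, hZ, mul_sum]
    push_cast
    refine sum_le_sum fun R _ => ?_
    have := card_superset_card_ge (tight d R) (d := d + 1) (e := e + 1) (q := q) (by omega)
      (by rw [hW]; exact h2)
    rw [hW] at this
    refine this.trans (le_of_eq ?_)
    congr!
  have hbad : (#{G ∈ minDegGraphs V (d + 1) | K ≤ |(#(G.nbrs v ∩ S) : ℝ) - n / 2|} : ℝ) ≤
      2 ^ (m + 1) * (Z * (2 * Real.exp (-(K ^ 2 / (2 * n)))) +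
        #MD * (2 * Real.exp (-Real.log 2 * K))) := by
    simp only [card_nbrs_inter v]
    rw [card_minDegGraphs_filter v d (fun N => K ≤ |(#(N ∩ S') : ℝ) - n / 2|), ← nsmul_eq_mul #MD,
      ← sum_const, hZ, sum_mul, ← sum_add_distrib, mul_sum]
    push_cast
    refine sum_le_sum fun R _ => ?_
    have h3 := card_superset_deviation_le (tight d R) S' hn hS2 hS3 hK
    rw [hW] at h3
    refine le_trans ?_ h3
    rw [Nat.cast_le]
    refine card_le_card fun N hN => ?_
    simp only [mem_filter, mem_univ, true_and] at hN ⊢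
    refine ⟨hN.1, ?_⟩
    convert hN.2.2
  have hM : (0 : ℝ) < #MD := by
    have hpos : (0 : ℝ) < Fintype.card (SimpleGraph {x : V // x ≠ v}) := by
      exact_mod_cast Fintype.card_pos
    exact lt_of_lt_of_le (by positivity) (pow_mul_card_le_card_minDegGraphs hq.le hW hde h1)
  have hmean : (∑ R ∈ MD, (#(tight d R) : ℝ)) / #MD ≤ K / 2 := by
    have h3 := (mean_card_tight_le hq hl hW hde h1).trans hKd
    exact le_of_mul_le_mul_left h3 (by exact_mod_cast hd)
  have hMZ : #MD * Real.exp (-Real.log 2 * (K / 2)) ≤ Z := by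
    have hne : MD.Nonempty := by
      rw [← card_pos]; exact_mod_cast hM
    refine le_trans ?_ (card_mul_exp_le_sum_exp hne _)
    rw [← mul_sum, mul_div_assoc, neg_mul, neg_mul]
    gcongr
  have hsplit : Real.exp (-Real.log 2 * K) =
      Real.exp (-Real.log 2 * (K / 2)) * Real.exp (-Real.log 2 * (K / 2)) := by
    rw [← Real.exp_add]; ring_nf
  rw [hsplit] at hbad
  set x := Real.exp (-Real.log 2 * (K / 2))
  have hx : 0 < x := Real.exp_pos _
  calc _ ≤ _ := hbad
    _ = 2 ^ (m + 1) * (Z * (2 * Real.exp (-(K ^ 2 / (2 * n)))) + (#MD * x) * (2 * x)) := by ring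
    _ ≤ 2 ^ (m + 1) * (Z * (2 * Real.exp (-(K ^ 2 / (2 * n)))) + Z * (2 * x)) := by gcongr
    _ = (2 * Real.exp (-(K ^ 2 / (2 * n))) + 2 * x) / q * (q * 2 ^ (m + 1) * Z) := by
        field_simp
    _ ≤ _ := by gcongr

end SimpleGraph

lemma centralBinom_le_choose_mul_exp {p : ℕ} (j : ℕ) (hj : 2 * j ≤ p) :
    (p.centralBinom : ℝ) ≤ (2 * p).choose (p + j) * Real.exp (2 * j ^ 2 / p) := by
  induction j with
  | zero => simp [Nat.centralBinom]
  | succ j ih =>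
    refine (ih (by omega)).trans ?_
    have hp : (0 : ℝ) < p := by exact_mod_cast (by omega : 0 < p)
    have hjp : 2 * (j : ℝ) + 2 ≤ p := by exact_mod_cast (by omega : 2 * j + 2 ≤ p)
    have h1 := Nat.choose_succ_right_eq (2 * p) (p + j)
    have h2 : ((2 * p).choose (p + j + 1) : ℝ) * (p + j + 1) =
        (2 * p).choose (p + j) * (p - j) := by
      have h3 : 2 * p - (p + j) = p - j := by omega
      rw [h3] at h1
      rw [← Nat.cast_sub (by omega : j ≤ p)]
      exact_mod_cast h1
    have hpj : (0 : ℝ) < p - j := by linarith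
    have h4 : (p + j + 1 : ℝ) / (p - j) ≤ Real.exp (2 * (2 * j + 1) / p) := by
      have h5 : (p + j + 1 : ℝ) / (p - j) = (2 * j + 1) / (p - j) + 1 := by field_simp; ring
      rw [h5]
      refine (Real.add_one_le_exp _).trans (Real.exp_le_exp.2 ?_)
      rw [div_le_div_iff₀ hpj hp]
      nlinarith
    have h6 : ((2 * p).choose (p + j) : ℝ) =
        (2 * p).choose (p + j + 1) * ((p + j + 1 : ℝ) / (p - j)) := by
      rw [← mul_div_assoc, h2]; field_simp
    rw [h6, mul_assoc]
    refine mul_le_mul_of_nonneg_left ?_ (by positivity)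
    calc _ ≤ Real.exp (2 * (2 * j + 1) / p) * Real.exp (2 * j ^ 2 / p) := by gcongr
      _ = _ := by
        rw [← Real.exp_add]; congr 1; push_cast; ring

lemma le_choose_near_middle {n : ℕ} (hn : 100 ≤ n) :
    Real.exp (-36) / (4 * n) * 2 ^ (2 * (n - 1)) ≤ (2 * (n - 1)).choose (n - 1 + (n.sqrt + 2)) ∧
    Real.exp (-36) / (4 * n) * 2 ^ (2 * (n - 1) + 1) ≤
      (2 * (n - 1) + 1).choose (n - 1 + (n.sqrt + 2) + 1) := by
  obtain ⟨p, rfl⟩ : ∃ p, n = p + 1 := ⟨n - 1, by omega⟩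
  simp only [Nat.add_sub_cancel]
  set s := (p + 1).sqrt with hs
  have hs1 : s * s ≤ p + 1 := Nat.sqrt_le _
  have hs2 : 10 ≤ s := Nat.le_sqrt.2 (by omega)
  have hj : 2 * (s + 2) ≤ p := by nlinarith
  have hj2 : (s + 2) ^ 2 ≤ 18 * p := by nlinarith
  have hp : (0 : ℝ) < p := by exact_mod_cast (by omega : 0 < p)
  have h1 := centralBinom_le_choose_mul_exp (p := p) (s + 2) hj
  have h2 : Real.exp (2 * ((s + 2 : ℕ) : ℝ) ^ 2 / p) ≤ Real.exp 36 := by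
    rw [Real.exp_le_exp, div_le_iff₀ hp]
    have : (((s + 2 : ℕ) : ℝ)) ^ 2 ≤ 18 * p := by exact_mod_cast hj2
    linarith
  have h3 : (4 : ℝ) ^ p ≤ 2 * p * p.centralBinom := by
    exact_mod_cast Nat.four_pow_le_two_mul_self_mul_centralBinom p (by omega)
  set c : ℝ := (((2 * p).choose (p + (s + 2)) : ℕ) : ℝ) with hc
  have hc0 : 0 ≤ c := by positivity
  have h4 : (4 : ℝ) ^ p ≤ 2 * p * (c * Real.exp 36) := by
    refine h3.trans ?_
    gcongr
    exact h1.trans (by gcongr)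
  have h5 : Real.exp (-36) * 4 ^ p ≤ 2 * p * c := by
    have : Real.exp (-36) * Real.exp 36 = 1 := by rw [← Real.exp_add]; simp
    calc _ ≤ Real.exp (-36) * (2 * p * (c * Real.exp 36)) := by gcongr
      _ = 2 * p * c * (Real.exp (-36) * Real.exp 36) := by ring
      _ = _ := by rw [this, mul_one]
  have hpow : (2 : ℝ) ^ (2 * p) = 4 ^ p := by rw [pow_mul]; norm_num
  have h6 : Real.exp (-36) / (4 * ((p + 1 : ℕ) : ℝ)) * (2 * 4 ^ p) ≤ c := by
    rw [div_mul_eq_mul_div, div_le_iff₀ (by positivity)]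
    push_cast
    nlinarith
  constructor
  · rw [hpow]
    refine le_trans ?_ h6
    have : (0 : ℝ) < 4 ^ p := by positivity
    gcongr
    linarith
  · rw [pow_succ, hpow, mul_comm _ (2 : ℝ)]
    refine h6.trans ?_
    rw [hc, Nat.cast_le, Nat.choose_succ_succ]
    exact Nat.le_add_right _ _

open Filter Topology in
lemma eventually_rpow_mul_exp_le {c b : ℝ} (hc : 0 < c) (hb : 0 < b) (s ε : ℝ) (hε : 0 < ε) :
    ∀ᶠ n : ℕ in atTop, (n : ℝ) ^ s * Real.exp (-c * (n : ℝ) ^ b) ≤ ε := by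
  have h1 := (tendsto_rpow_mul_exp_neg_mul_atTop_nhds_zero (s / b) c hc).comp
    ((tendsto_rpow_atTop hb).comp tendsto_natCast_atTop_atTop)
  filter_upwards [h1.eventually_le_const hε] with n hn
  simp only [Function.comp_apply] at hn
  rwa [← Real.rpow_mul (Nat.cast_nonneg n), mul_div_cancel₀ _ hb.ne'] at hn

open Filter Topology in
lemma eventually_log_le_rpow {η : ℝ} (hη : 0 < η) :
    ∀ᶠ n : ℕ in atTop, 8 * (2 * (-Real.log (Real.exp (-36) / (4 * n))) + 1) ≤ (n : ℝ) ^ η := by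
  have h1 := ((isLittleO_log_rpow_atTop hη).comp_tendsto tendsto_natCast_atTop_atTop).bound
    (show (0 : ℝ) < 1 / 32 by norm_num)
  have h2 := ((tendsto_rpow_atTop hη).comp
    (tendsto_natCast_atTop_atTop (R := ℝ))).eventually_ge_atTop
    (2 * (8 * (2 * (36 + Real.log 4) + 1)))
  filter_upwards [h1, h2, eventually_gt_atTop 0] with n h1 h2 hn
  have hn' : (0 : ℝ) < n := by exact_mod_cast hn
  simp only [Function.comp_apply, Real.norm_eq_abs] at h1 h2
  rw [abs_of_nonneg (show (0 : ℝ) ≤ (n : ℝ) ^ η by positivity)] at h1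
  have h3 := (le_abs_self _).trans h1
  rw [Real.log_div (Real.exp_ne_zero _) (by positivity), Real.log_exp,
    Real.log_mul (by norm_num) hn'.ne']
  linarith

lemma degIn_eq_card {n : ℕ} (G : SimpleGraph (Fin n)) (v : Fin n) (S : Finset (Fin n)) :
    degIn G v S = #(G.nbrs v ∩ S) := by
  classical
  rw [degIn, Nat.card_eq_fintype_card, Fintype.card_subtype]
  congr 1
  ext x
  simp [SimpleGraph.mem_nbrs, and_comm]

/-- Complementing the edges between `A` and `Aᶜ`. -/
def toggleEquiv {V : Type*} (A : Finset V) : SimpleGraph V ≃ SimpleGraph V :=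
  Function.Involutive.toPerm
    (fun G =>
      { Adj := fun x y => ((x ∈ A ↔ y ∈ A) ∧ G.Adj x y) ∨ (¬(x ∈ A ↔ y ∈ A) ∧ ¬ G.Adj x y)
        symm := ⟨fun x y h => by rw [G.adj_comm]; tauto⟩
        loopless := ⟨fun x h => by simp at h⟩ })
    (fun G => by ext x y; simp only; tauto)

lemma toggleEquiv_adj {V : Type*} (A : Finset V) (G : SimpleGraph V) (x y : V) :
    (toggleEquiv A G).Adj x y ↔
      ((x ∈ A ↔ y ∈ A) ∧ G.Adj x y) ∨ (¬(x ∈ A ↔ y ∈ A) ∧ ¬ G.Adj x y) := Iff.rfl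

section toggle
variable {V : Type*} [Fintype V] [DecidableEq V]

lemma card_nbrs_toggle_inter_same (A : Finset V) (G : SimpleGraph V) {v : V} {S : Finset V}
    (h : ∀ x ∈ S, (v ∈ A ↔ x ∈ A)) :
    #((toggleEquiv A G).nbrs v ∩ S) = #(G.nbrs v ∩ S) := by
  congr 1
  ext x
  simp only [mem_inter, SimpleGraph.mem_nbrs, toggleEquiv_adj]
  have := h x
  tauto

lemma card_nbrs_toggle_inter_other (A : Finset V) (G : SimpleGraph V) {v : V} {S : Finset V}
    (h : ∀ x ∈ S, ¬(v ∈ A ↔ x ∈ A)) :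
    #((toggleEquiv A G).nbrs v ∩ S) + #(G.nbrs v ∩ S) = #S := by
  rw [← card_union_of_disjoint]
  · congr 1
    ext x
    simp only [mem_inter, mem_union, SimpleGraph.mem_nbrs, toggleEquiv_adj]
    have := h x
    tauto
  · rw [Finset.disjoint_left]
    intro x
    simp only [mem_inter, SimpleGraph.mem_nbrs, toggleEquiv_adj]
    have := h x
    tauto

lemma card_nbrs_eq_add (A : Finset V) (G : SimpleGraph V) (v : V) :
    #(G.nbrs v) = #(G.nbrs v ∩ A) + #(G.nbrs v ∩ Aᶜ) := by
  rw [← card_union_of_disjoint]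
  · rw [← inter_union_distrib_left, union_compl, inter_univ]
  · rw [Finset.disjoint_left]
    intro x
    simp only [mem_inter, mem_compl]
    tauto

end toggle

/-- Friendliness of `A ∪ Aᶜ` is a minimum degree condition on the toggled graph. -/
lemma friendlyPair_iff {n : ℕ} {A : Finset (Fin (2 * n))} (hA : #A = n)
    (G : SimpleGraph (Fin (2 * n))) (t : ℝ) :
    FriendlyPair G A t ↔
      toggleEquiv A G ∈ SimpleGraph.minDegGraphs (Fin (2 * n)) ⌈(n : ℝ) + t⌉₊ := by
  have hAc : #Aᶜ = n := by rw [card_compl, hA, Fintype.card_fin]; omega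
  rw [SimpleGraph.mem_minDegGraphs]
  simp only [FriendlyPair, degIn_eq_card, Nat.ceil_le]
  have hin : ∀ v ∈ A, ((#(G.nbrs v ∩ Aᶜ) : ℝ) + t ≤ #(G.nbrs v ∩ A) ↔
      (n : ℝ) + t ≤ #((toggleEquiv A G).nbrs v)) := by
    intro v hv
    have h1 := card_nbrs_toggle_inter_same A G (v := v) (S := A) (by simp [hv])
    have h2 := card_nbrs_toggle_inter_other A G (v := v) (S := Aᶜ) (by simp [hv])
    rw [hAc] at h2
    have h2' : (#((toggleEquiv A G).nbrs v ∩ Aᶜ) : ℝ) + #(G.nbrs v ∩ Aᶜ) = n := by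
      exact_mod_cast h2
    rw [card_nbrs_eq_add A, h1]
    push_cast
    constructor <;> intro h <;> linarith
  have hout : ∀ v ∈ Aᶜ, ((#(G.nbrs v ∩ A) : ℝ) + t ≤ #(G.nbrs v ∩ Aᶜ) ↔
      (n : ℝ) + t ≤ #((toggleEquiv A G).nbrs v)) := by
    intro v hv
    rw [mem_compl] at hv
    have h1 := card_nbrs_toggle_inter_same A G (v := v) (S := Aᶜ) (by simp [hv])
    have h2 := card_nbrs_toggle_inter_other A G (v := v) (S := A) (by simp [hv])
    rw [hA] at h2
    have h2' : (#((toggleEquiv A G).nbrs v ∩ A) : ℝ) + #(G.nbrs v ∩ A) = n := by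
      exact_mod_cast h2
    rw [card_nbrs_eq_add A, h1]
    push_cast
    constructor <;> intro h <;> linarith
  constructor
  · rintro ⟨h1, h2⟩ v
    by_cases hv : v ∈ A
    · exact (hin v hv).1 (h1 v hv)
    · exact (hout v (mem_compl.2 hv)).1 (h2 v (mem_compl.2 hv))
  · exact fun h => ⟨fun v hv => (hin v hv).2 (h v), fun v hv => (hout v hv).2 (h v)⟩

lemma abs_degIn_sub_half {n : ℕ} {A : Finset (Fin (2 * n))} {S : Finset (Fin (2 * n))}
    (hS : S = A ∨ S = Aᶜ) (hcard : #S = n) (G : SimpleGraph (Fin (2 * n))) (v : Fin (2 * n)) :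
    |(degIn G v S : ℝ) - n / 2| = |(#((toggleEquiv A G).nbrs v ∩ S) : ℝ) - n / 2| := by
  rw [degIn_eq_card]
  have h : (∀ x ∈ S, (v ∈ A ↔ x ∈ A)) ∨ (∀ x ∈ S, ¬(v ∈ A ↔ x ∈ A)) := by
    rcases hS with hS | hS <;> by_cases hv : v ∈ A <;> simp [hv, hS]
  rcases h with h | h
  · rw [card_nbrs_toggle_inter_same A G h]
  · have h2 := card_nbrs_toggle_inter_other A G h
    rw [hcard] at h2
    have h2' : (#((toggleEquiv A G).nbrs v ∩ S) : ℝ) + #(G.nbrs v ∩ S) = n := by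
      exact_mod_cast h2
    rw [← abs_neg]
    congr 1
    linarith

lemma card_irregular_near_middle_le {n d : ℕ} (hn : 100 ≤ n) {η : ℝ}
    (hlog : 8 * (2 * (-Real.log (Real.exp (-36) / (4 * n))) + 1) ≤ (n : ℝ) ^ η)
    (hd : (n : ℝ) / 2 ≤ d) (hd' : d ≤ n - 1 + (n.sqrt + 2)) {S : Finset (Fin (2 * n))}
    (hS : #S = n) (v : Fin (2 * n)) :
    (#{G ∈ SimpleGraph.minDegGraphs (Fin (2 * n)) (d + 1) |
        (n : ℝ) ^ ((1 : ℝ) / 2 + η) ≤ |(#(G.nbrs v ∩ S) : ℝ) - n / 2|} : ℝ) ≤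
      8 * Real.exp 36 * n * (Real.exp (-(1 / 2) * (n : ℝ) ^ (2 * η)) +
        Real.exp (-(Real.log 2 / 2) * (n : ℝ) ^ ((1 : ℝ) / 2 + η))) *
        #(SimpleGraph.minDegGraphs (Fin (2 * n)) (d + 1)) := by
  have hn0 : (0 : ℝ) < n := by exact_mod_cast (by omega : 0 < n)
  have hn1 : (1 : ℝ) ≤ n := by exact_mod_cast (by omega : 1 ≤ n)
  obtain ⟨h1, h2⟩ := le_choose_near_middle hn
  set q := Real.exp (-36) / (4 * n) with hq
  set L := -Real.log q with hL
  have hq0 : 0 < q := by positivity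
  have hsq : (0 : ℝ) < √n := Real.sqrt_pos.2 hn0
  have hsq2 : √(n : ℝ) * √n = n := Real.mul_self_sqrt hn0.le
  have hL0 : 0 ≤ L := by
    rw [hL, hq, ← Real.log_inv]
    refine Real.log_nonneg ?_
    rw [inv_div, Real.exp_neg, div_inv_eq_mul]
    have := Real.add_one_le_exp (36 : ℝ)
    nlinarith
  set K := (n : ℝ) ^ ((1 : ℝ) / 2 + η) with hK
  have hK1 : K = √n * (n : ℝ) ^ η := by rw [hK, Real.rpow_add hn0, Real.sqrt_eq_rpow]
  have hm : (((2 * (n - 1) : ℕ) : ℝ) + 1) ≤ 2 * n := by exact_mod_cast (by omega)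
  have hchoose : (((2 * (n - 1) + 1).choose 2 : ℕ) : ℝ) ≤ 2 * n ^ 2 := by
    rw [Nat.cast_choose_two]
    push_cast at hm ⊢
    have : (0 : ℝ) ≤ 2 * ((n - 1 : ℕ) : ℝ) := by positivity
    nlinarith
  have hd0 : 0 < d := by
    have : (0 : ℝ) < d := by linarith
    exact_mod_cast this
  have h := SimpleGraph.card_irregular_le v S (m := 2 * (n - 1)) (n := n) (d := d)
    (e := n - 1 + (n.sqrt + 2)) (q := q) (l := 1 / √n) (K := K) hq0 (by positivity)
    (by rw [Fintype.card_fin]; omega) hS (by omega) hd0 hd' h1 h2 (by positivity) (by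
      calc _ ≤ 2 * (2 * n * L / (1 / √n) + (1 / √n) / 2 * (2 * n ^ 2)) := by gcongr
        _ = 2 * (n * √n * (2 * L + 1)) := by
          field_simp
          rw [pow_two, hsq2]
          ring
        _ = (n / 2) * ((√n * (8 * (2 * L + 1))) / 2) := by ring
        _ ≤ d * ((√n * (n : ℝ) ^ η) / 2) := by gcongr
        _ = _ := by rw [hK1])
  have hexp : K ^ 2 / (2 * n) = 1 / 2 * (n : ℝ) ^ (2 * η) := by
    rw [hK1, mul_pow, pow_two √(n : ℝ), hsq2, ← Real.rpow_natCast ((n : ℝ) ^ η),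
      ← Real.rpow_mul hn0.le, Nat.cast_ofNat, mul_comm η]
    field_simp
  rw [hexp] at h
  have e1 : -(1 / 2 * (n : ℝ) ^ (2 * η)) = -(1 / 2) * (n : ℝ) ^ (2 * η) := by ring
  have e2 : -Real.log 2 * (K / 2) = -(Real.log 2 / 2) * K := by ring
  rw [e1, e2] at h
  convert h using 2
  · congr!
  · rw [hq, Real.exp_neg 36]
    field_simp
    ring

/-- Fix `η > 0`. For every `k > 0` there is `n₀` such that for all
`n ≥ n₀`, `γ ∈ [−1,1]`, and every bisection `A ∪ Aᶜ` of `[2n]` with `|A| = n`: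
for `G ∼ G(2n,1/2)`, `P[E_irreg | E₁] ≤ n^{−k}`, stated as
`P[E_irreg ∧ E₁] ≤ n^{−k} · P[E₁]`, where `E_irreg` is the event that some vertex `v` and
some part `P ∈ {A, Aᶜ}` satisfy `|deg(v,P) − n/2| ≥ n^{1/2+η}`. -/
theorem irregular_degree_conditional_one_partition
    (η : ℝ) (hη : 0 < η) :
    ∀ k : ℝ, 0 < k → ∃ n₀ : ℕ, ∀ n : ℕ, n₀ ≤ n →
      ∀ γ : ℝ, |γ| ≤ 1 →
      ∀ A : Finset (Fin (2 * n)), A.card = n →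
        graphProb (2 * n) (fun G =>
            FriendlyPair G A (γ * Real.sqrt n) ∧
            ∃ v : Fin (2 * n),
              (n : ℝ) ^ ((1 : ℝ) / 2 + η) ≤ |(degIn G v A : ℝ) - (n : ℝ) / 2| ∨
              (n : ℝ) ^ ((1 : ℝ) / 2 + η) ≤ |(degIn G v Aᶜ : ℝ) - (n : ℝ) / 2|)
          ≤ (n : ℝ) ^ (-k) *
            graphProb (2 * n) (fun G => FriendlyPair G A (γ * Real.sqrt n)) := by
  intro k hk
  have hlog2 : 0 < Real.log 2 := Real.log_pos one_lt_two
  have hε : 0 < 1 / (2 * (32 * Real.exp 36)) := by positivity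
  have hev := (eventually_rpow_mul_exp_le (c := 1 / 2) (b := 2 * η) (by norm_num) (by positivity)
    (k + 2) _ hε).and ((eventually_rpow_mul_exp_le (c := Real.log 2 / 2) (b := (1 : ℝ) / 2 + η)
    (by positivity) (by positivity) (k + 2) _ hε).and ((eventually_log_le_rpow hη).and
    (Filter.eventually_ge_atTop 100)))
  obtain ⟨n₀, hn₀⟩ := Filter.eventually_atTop.1 hev
  refine ⟨n₀, fun n hn γ hγ A hA => ?_⟩
  obtain ⟨hexp1, hexp2, hlog, hn100⟩ := hn₀ n hn
  classical
  have hn0 : (0 : ℝ) < n := by exact_mod_cast (by omega : 0 < n)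
  have hAc : #Aᶜ = n := by rw [card_compl, hA, Fintype.card_fin]; omega
  set K := (n : ℝ) ^ ((1 : ℝ) / 2 + η) with hK
  have hsq : (0 : ℝ) < √n := Real.sqrt_pos.2 hn0
  have hsq2 : √(n : ℝ) * √n = n := Real.mul_self_sqrt hn0.le
  have hsq10 : 10 ≤ √(n : ℝ) := by
    rw [Real.le_sqrt (by norm_num) hn0.le]
    have : (100 : ℝ) ≤ n := by exact_mod_cast hn100
    linarith
  obtain ⟨hγ1, hγ2⟩ := abs_le.1 hγ
  have ht1 : γ * √n ≤ √n := by nlinarith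
  have ht2 : -√n ≤ γ * √n := by nlinarith
  obtain ⟨d, hd⟩ : ∃ d, ⌈(n : ℝ) + γ * √n⌉₊ = d + 1 :=
    Nat.exists_eq_succ_of_ne_zero (Nat.ceil_pos.2 (by nlinarith)).ne'
  have hd1 : (n : ℝ) / 2 ≤ d := by
    have h1 := Nat.le_ceil ((n : ℝ) + γ * √n)
    rw [hd] at h1
    push_cast at h1
    nlinarith
  have hd2 : d ≤ n - 1 + (n.sqrt + 2) := by
    have h1 : ⌈(n : ℝ) + γ * √n⌉₊ ≤ n + (n.sqrt + 1) := by
      rw [Nat.ceil_le]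
      push_cast
      have := Real.real_sqrt_lt_nat_sqrt_succ (a := n)
      linarith
    omega
  set MD := SimpleGraph.minDegGraphs (Fin (2 * n)) (d + 1) with hMD
  set I : Fin (2 * n) → Finset (Fin (2 * n)) → Finset (SimpleGraph (Fin (2 * n))) :=
    fun v S => {G ∈ MD | K ≤ |(#(G.nbrs v ∩ S) : ℝ) - n / 2|} with hI
  have hiff : ∀ G : SimpleGraph (Fin (2 * n)),
      FriendlyPair G A (γ * √n) ↔ toggleEquiv A G ∈ MD := by
    intro G
    rw [friendlyPair_iff hA, hd]
  have hcount : Nat.card {G : SimpleGraph (Fin (2 * n)) // FriendlyPair G A (γ * √n)} = #MD := by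
    rw [Nat.card_congr (Equiv.subtypeEquiv (toggleEquiv A) hiff), Nat.card_eq_fintype_card,
      Fintype.card_coe]
  have hirr : Nat.card {G : SimpleGraph (Fin (2 * n)) // FriendlyPair G A (γ * √n) ∧
      ∃ v, K ≤ |(degIn G v A : ℝ) - n / 2| ∨ K ≤ |(degIn G v Aᶜ : ℝ) - n / 2|} ≤
      ∑ v, (#(I v A) + #(I v Aᶜ)) := by
    rw [Nat.card_eq_fintype_card, Fintype.card_subtype]
    calc _ ≤ #(univ.biUnion fun v => I v A ∪ I v Aᶜ) := by
          refine card_le_card_of_injOn (toggleEquiv A) ?_ (toggleEquiv A).injective.injOn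
          intro G hG
          simp only [coe_filter, mem_univ, true_and, Set.mem_ofPred_eq] at hG
          obtain ⟨h1, v, h2⟩ := hG
          rw [abs_degIn_sub_half (Or.inl rfl) hA, abs_degIn_sub_half (Or.inr rfl) hAc] at h2
          rw [hiff] at h1
          simp only [mem_coe, mem_biUnion, mem_univ, true_and, mem_union, hI, mem_filter]
          exact ⟨v, h2.imp (fun h => ⟨h1, h⟩) (fun h => ⟨h1, h⟩)⟩
      _ ≤ ∑ v, #(I v A ∪ I v Aᶜ) := card_biUnion_le
      _ ≤ _ := sum_le_sum fun v _ => card_union_le _ _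
  set B := 8 * Real.exp 36 * n * (Real.exp (-(1 / 2) * (n : ℝ) ^ (2 * η)) +
    Real.exp (-(Real.log 2 / 2) * K)) * #MD with hB
  have hone : ∀ v S, #S = n → (#(I v S) : ℝ) ≤ B := by
    intro v S hS
    have := card_irregular_near_middle_le hn100 hlog hd1 hd2 hS v
    convert this
  have hsum : ((∑ v : Fin (2 * n), (#(I v A) + #(I v Aᶜ)) : ℕ) : ℝ) ≤ 4 * n * B := by
    push_cast
    calc _ ≤ ∑ v : Fin (2 * n), (B + B) :=
          sum_le_sum fun v _ => add_le_add (hone v A hA) (hone v Aᶜ hAc)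
      _ = _ := by simp; ring
  have hfinal : 4 * n * B ≤ (n : ℝ) ^ (-k) * #MD := by
    have hpow : (n : ℝ) ^ (k + 2) = (n : ℝ) ^ k * n ^ 2 := by
      rw [Real.rpow_add hn0]; norm_num
    have hnk : 0 < (n : ℝ) ^ k := by positivity
    rw [hpow] at hexp1 hexp2
    rw [le_div_iff₀ (by positivity)] at hexp1 hexp2
    rw [hB, ← mul_assoc]
    gcongr
    rw [Real.rpow_neg hn0.le, ← one_div, le_div_iff₀ hnk]
    linarith
  have hmain := ((Nat.cast_le (α := ℝ)).2 hirr).trans (hsum.trans hfinal)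
  rw [graphProb, graphProb, hcount, ← mul_div_assoc]
  gcongr
end

section
/- Fix c > 0 and η > 0. For every k > 0 there is n_0 such that for all n ≥ n_0, all γ ∈ [−1,1], and every pair of partitions [2n] = A_1 ∪ A_2 = B_1 ∪ B_2 with |A_1| = |A_2| = |B_1| = |B_2| = n and c·n ≤ |A_1 ∩ B_1| ≤ (1−c)·n: for G ∼ G(2n,1/2), letting E_irreg,2 be the event that there exist a vertex v ∈ [2n] and i,j ∈ {1,2} with |deg(v, A_i ∩ B_j) − |A_i ∩ B_j|/2| ≥ n^{1/2+η}, one has P[E_irreg,2 | E_2] ≤ n^{−k}. -/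
namespace BisectionPair

open Finset BigOperators

/-! ### The uniform measure on a Boolean cube -/

open Classical in
/-- The real-valued indicator of a proposition. -/
noncomputable def ind (p : Prop) : ℝ := if p then 1 else 0

lemma ind_true {p : Prop} (h : p) : ind p = 1 := by simp [ind, h]

lemma ind_false {p : Prop} (h : ¬p) : ind p = 0 := by simp [ind, h]

lemma ind_nonneg (p : Prop) : 0 ≤ ind p := by unfold ind; split_ifs <;> norm_num

lemma ind_le_one (p : Prop) : ind p ≤ 1 := by unfold ind; split_ifs <;> norm_num

lemma ind_mono {p q : Prop} (h : p → q) : ind p ≤ ind q := by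
  by_cases hp : p
  · rw [ind_true hp, ind_true (h hp)]
  · rw [ind_false hp]; exact ind_nonneg q

lemma ind_and (p q : Prop) : ind (p ∧ q) = ind p * ind q := by
  by_cases hp : p <;> by_cases hq : q <;> simp [ind, hp, hq]

lemma ind_or_le (p q : Prop) : ind (p ∨ q) ≤ ind p + ind q := by
  by_cases hp : p <;> by_cases hq : q <;> simp [ind, hp, hq]

lemma sum_ind {α : Type*} (s : Finset α) (p : α → Prop) [DecidablePred p] :
    ∑ a ∈ s, ind (p a) = ((s.filter p).card : ℝ) := by
  rw [← Finset.sum_boole]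
  refine Finset.sum_congr rfl fun a _ => ?_
  by_cases h : p a <;> simp [ind, h]

/-- The probability of an event under uniform independent bits. -/
noncomputable def pr {ι : Type*} [Fintype ι] [DecidableEq ι] (p : (ι → Bool) → Prop) : ℝ :=
  𝔼 x, ind (p x)

section Cube

variable {ι κ : Type*} [Fintype ι] [DecidableEq ι] [Fintype κ] [DecidableEq κ]

lemma pr_nonneg (p : (ι → Bool) → Prop) : 0 ≤ pr p :=
  Finset.expect_nonneg fun _ _ => ind_nonneg _

lemma pr_mono {p q : (ι → Bool) → Prop} (h : ∀ x, p x → q x) : pr p ≤ pr q :=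
  Finset.expect_le_expect fun x _ => ind_mono (h x)

lemma pr_or_le (p q : (ι → Bool) → Prop) : pr (fun x => p x ∨ q x) ≤ pr p + pr q := by
  unfold pr
  rw [← Finset.expect_add_distrib]
  exact Finset.expect_le_expect fun x _ => ind_or_le _ _

lemma pr_exists_le {α : Type*} [Fintype α] (p : α → (ι → Bool) → Prop) :
    pr (fun x => ∃ a, p a x) ≤ ∑ a, pr (p a) := by
  unfold pr
  rw [← Finset.expect_sum_comm]
  refine Finset.expect_le_expect fun x _ => ?_
  by_cases h : ∃ a, p a x
  · obtain ⟨a, ha⟩ := h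
    rw [ind_true ⟨a, ha⟩, ← ind_true ha]
    exact Finset.single_le_sum (f := fun a => ind (p a x)) (fun _ _ => ind_nonneg _)
      (Finset.mem_univ a)
  · rw [ind_false h]
    exact Finset.sum_nonneg fun _ _ => ind_nonneg _

lemma pr_not (p : (ι → Bool) → Prop) : pr (fun x => ¬p x) = 1 - pr p := by
  have h : pr (fun x => ¬p x) + pr p = 1 := by
    unfold pr
    rw [← Finset.expect_add_distrib]
    have : ∀ x : ι → Bool, ind (¬p x) + ind (p x) = 1 := fun x => by
      by_cases h : p x <;> simp [ind, h]
    rw [Finset.expect_congr rfl fun x _ => this x]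
    exact Fintype.expect_const (ι := ι → Bool) (1 : ℝ)
  linarith

lemma expect_extend {φ : κ → ι} (hφ : Function.Injective φ) (f : (ι → Bool) → ℝ) :
    𝔼 x : ι → Bool, 𝔼 y : κ → Bool, f (Function.extend φ y x) = 𝔼 x, f x := by
  have hinv : Function.Involutive (fun q : (ι → Bool) × (κ → Bool) =>
      (Function.extend φ q.2 q.1, q.1 ∘ φ)) := by
    rintro ⟨x, y⟩
    refine Prod.ext ?_ ?_
    · funext i
      by_cases hi : ∃ k, φ k = i
      · obtain ⟨k, rfl⟩ := hi
        simp [hφ.extend_apply]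
      · simp [Function.extend_apply' _ _ _ hi]
    · exact Function.extend_comp hφ _ _
  have h1 := Fintype.expect_equiv hinv.toPerm
    (fun q : (ι → Bool) × (κ → Bool) => f (Function.extend φ q.2 q.1)) (fun q => f q.1)
    (fun q => rfl)
  rw [← Finset.univ_product_univ, Finset.expect_product, Finset.expect_product] at h1
  rw [h1]
  refine Finset.expect_congr rfl fun x _ => ?_
  exact Fintype.expect_const (ι := κ → Bool) (f x)

lemma expect_le_of_extend {φ : κ → ι} (hφ : Function.Injective φ) (f g : (ι → Bool) → ℝ)
    (h : ∀ x, 𝔼 y : κ → Bool, f (Function.extend φ y x) ≤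
      𝔼 y : κ → Bool, g (Function.extend φ y x)) :
    𝔼 x, f x ≤ 𝔼 x, g x := by
  rw [← expect_extend hφ f, ← expect_extend hφ g]
  exact Finset.expect_le_expect fun x _ => h x

lemma pr_comp {φ : κ → ι} (hφ : Function.Injective φ) (p : (κ → Bool) → Prop) :
    pr (fun x : ι → Bool => p (x ∘ φ)) = pr p := by
  unfold pr
  rw [← expect_extend hφ]
  simp_rw [Function.extend_comp hφ]
  exact Fintype.expect_const _

/-- Conditioning on the bits in `B` is the same as overwriting them. -/
lemma pr_fixed (B : Finset ι) (b : ι → Bool) (p : (ι → Bool) → Prop) :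
    (2 : ℝ) ^ B.card * pr (fun x => (∀ i ∈ B, x i = b i) ∧ p x) =
      pr (fun x => p (B.piecewise b x)) := by
  unfold pr
  rw [← expect_extend (κ := B) (φ := Subtype.val) Subtype.val_injective, Finset.mul_expect]
  refine Finset.expect_congr rfl fun x _ => ?_
  have key : ∀ y : B → Bool, ind ((∀ i ∈ B, Function.extend Subtype.val y x i = b i) ∧
      p (Function.extend Subtype.val y x)) =
      if y = (fun i : B => b i) then ind (p (B.piecewise b x)) else 0 := by
    intro y
    split_ifs with h
    · subst h
      have : Function.extend Subtype.val (fun i : B => b i) x = B.piecewise b x := by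
        funext i
        by_cases hi : i ∈ B
        · rw [Finset.piecewise_eq_of_mem _ _ _ hi]
          exact Subtype.val_injective.extend_apply (fun i : B => b i) x ⟨i, hi⟩
        · rw [Finset.piecewise_eq_of_notMem _ _ _ hi, Function.extend_apply']
          rintro ⟨k, rfl⟩
          exact hi k.2
      rw [this, ind_and, ind_true, one_mul]
      intro i hi
      rw [Finset.piecewise_eq_of_mem _ _ _ hi]
    · rw [ind_false]
      rintro ⟨h1, -⟩
      apply h
      funext i
      rw [← h1 i i.2, Subtype.val_injective.extend_apply]
  simp_rw [key]
  rw [Fintype.expect_eq_sum_div_card, Finset.sum_ite_eq' Finset.univ (fun i : B => b i)]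
  simp [mul_div_cancel₀]

/-- Events depending on complementary sets of bits are independent. -/
lemma expect_mul_of_disjoint (K : Finset ι) (f g : (ι → Bool) → ℝ)
    (hf : ∀ x y, (∀ i ∈ K, x i = y i) → f x = f y)
    (hg : ∀ x y, (∀ i, i ∉ K → x i = y i) → g x = g y) :
    𝔼 x, f x * g x = (𝔼 x, f x) * 𝔼 x, g x := by
  have hinv : Function.Involutive (fun q : (ι → Bool) × (ι → Bool) =>
      (K.piecewise q.1 q.2, K.piecewise q.2 q.1)) := by
    rintro ⟨x, y⟩
    refine Prod.ext ?_ ?_ <;> funext i <;> by_cases hi : i ∈ K <;> simp [hi]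
  have h1 := Fintype.expect_equiv hinv.toPerm
    (fun q : (ι → Bool) × (ι → Bool) => f q.1 * g q.2) (fun q => f q.1 * g q.1)
    (fun q => by
      change f q.1 * g q.2 = f (K.piecewise q.1 q.2) * g (K.piecewise q.1 q.2)
      congr 1
      · exact hf _ _ fun i hi => by simp [hi]
      · exact hg _ _ fun i hi => by simp [hi])
  rw [← Finset.univ_product_univ, Finset.expect_product, Finset.expect_product] at h1
  rw [Finset.expect_mul_expect, h1]
  refine Finset.expect_congr rfl fun x _ => ?_
  exact (Fintype.expect_const _).symm

/-- Harris' inequality for finitely many increasing functions. -/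
lemma harris_prod {α : Type*} (s : Finset α) (f : α → (ι → Bool) → ℝ)
    (h0 : ∀ a x, 0 ≤ f a x) (hf : ∀ a, Monotone (f a)) :
    ∏ a ∈ s, (𝔼 x, f a x) ≤ 𝔼 x, ∏ a ∈ s, f a x := by
  classical
  induction s using Finset.induction_on with
  | empty => simp
  | insert a s ha ih =>
    rw [Finset.prod_insert ha]
    simp_rw [Finset.prod_insert ha]
    refine (mul_le_mul_of_nonneg_left ih (Finset.expect_nonneg fun x _ => h0 a x)).trans ?_
    have := fkg (α := ι → Bool) (β := ℝ) (μ := fun _ => 1) (f := f a)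
      (g := fun x => ∏ a ∈ s, f a x) (fun _ => zero_le_one) (h0 a)
      (fun x => Finset.prod_nonneg fun b _ => h0 b x) (hf a)
      (fun x y hxy => Finset.prod_le_prod (fun b _ => h0 b x) fun b _ => hf b hxy)
      (fun _ _ => le_rfl)
    simp only [one_mul, Finset.sum_const, nsmul_eq_mul, mul_one] at this
    rw [Fintype.expect_eq_sum_div_card, Fintype.expect_eq_sum_div_card,
      Fintype.expect_eq_sum_div_card, div_mul_div_comm, Finset.card_univ] at *
    have hc : (0 : ℝ) < Fintype.card (ι → Bool) := by
      exact_mod_cast Fintype.card_pos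
    rw [div_le_div_iff₀ (by positivity) hc]
    nlinarith

end Cube

/-! ### Linear forms in centred bits -/

/-- The centred value `±1/2` of a bit. -/
noncomputable def cbit (b : Bool) : ℝ := if b then 1 / 2 else -(1 / 2)

/-- A linear form in centred bits. -/
noncomputable def lin {ι : Type*} [Fintype ι] (a : ι → ℝ) (x : ι → Bool) : ℝ :=
  ∑ i, a i * cbit (x i)

section Lin

variable {ι : Type*} [Fintype ι] [DecidableEq ι]

lemma mul_lin (l : ℝ) (a : ι → ℝ) (x : ι → Bool) : l * lin a x = lin (fun i => l * a i) x := by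
  unfold lin
  rw [Finset.mul_sum]
  exact Finset.sum_congr rfl fun i _ => by ring

lemma expect_exp_lin (a : ι → ℝ) :
    𝔼 x, Real.exp (lin a x) = ∏ i, Real.cosh (a i / 2) := by
  have h : ∀ i, Real.cosh (a i / 2) = (∑ b : Bool, Real.exp (a i * cbit b)) / 2 := by
    intro i
    rw [Real.cosh_eq]
    simp only [Fintype.sum_bool, cbit, if_true, Bool.false_eq_true, if_false]
    congr 3 <;> ring
  simp_rw [h]
  rw [Finset.prod_div_distrib, Finset.prod_univ_sum, Fintype.expect_eq_sum_div_card]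
  congr 1
  · rw [Fintype.piFinset_univ]
    refine Finset.sum_congr rfl fun x _ => ?_
    rw [lin, Real.exp_sum]
  · simp

lemma chernoff (a : ι → ℝ) {A : ℝ} (hA : ∑ i, a i ^ 2 ≤ A) {l : ℝ} (hl : 0 ≤ l) (s : ℝ) :
    pr (fun x => s ≤ lin a x) ≤ Real.exp (l ^ 2 * A / 8 - l * s) := by
  have h1 : pr (fun x => s ≤ lin a x) ≤
      𝔼 x, Real.exp (lin (fun i => l * a i) x) * Real.exp (-(l * s)) := by
    refine Finset.expect_le_expect fun x _ => ?_
    rw [← Real.exp_add, ← mul_lin]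
    by_cases h : s ≤ lin a x
    · rw [ind_true h]
      apply Real.one_le_exp
      nlinarith
    · rw [ind_false h]
      positivity
  refine h1.trans ?_
  rw [← Finset.expect_mul, expect_exp_lin, sub_eq_add_neg, Real.exp_add]
  refine mul_le_mul_of_nonneg_right ?_ (Real.exp_nonneg _)
  calc ∏ i, Real.cosh (l * a i / 2) ≤ ∏ i, Real.exp (l ^ 2 / 8 * a i ^ 2) := by
        refine Finset.prod_le_prod (fun i _ => (Real.cosh_pos _).le) fun i _ => ?_
        refine (Real.cosh_le_exp_half_sq _).trans (Real.exp_le_exp.2 (le_of_eq ?_))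
        ring
    _ = Real.exp (l ^ 2 / 8 * ∑ i, a i ^ 2) := by rw [← Real.exp_sum, Finset.mul_sum]
    _ ≤ Real.exp (l ^ 2 * A / 8) := by
        rw [Real.exp_le_exp]
        nlinarith [sq_nonneg l]

lemma chernoff_abs (a : ι → ℝ) {A : ℝ} (hA : ∑ i, a i ^ 2 ≤ A) (hA0 : 0 < A) {s : ℝ}
    (hs : 0 ≤ s) : pr (fun x => s ≤ |lin a x|) ≤ 2 * Real.exp (-(2 * s ^ 2 / A)) := by
  have hl : 0 ≤ 4 * s / A := by positivity
  have h1 := chernoff a hA hl s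
  have h2 := chernoff (fun i => -a i) (by simpa using hA) hl s
  have h3 : pr (fun x => s ≤ |lin a x|) ≤
      pr (fun x => s ≤ lin a x ∨ s ≤ lin (fun i => -a i) x) := by
    refine pr_mono fun x hx => ?_
    have : lin (fun i => -a i) x = -lin a x := by simp [lin]
    rw [this]
    exact le_abs.1 hx
  have h4 := h3.trans (pr_or_le _ _)
  have h5 : (4 * s / A) ^ 2 * A / 8 - 4 * s / A * s = -(2 * s ^ 2 / A) := by
    field_simp
    ring
  rw [h5] at h1 h2
  linarith

lemma exp_sq_div_four_le_cosh {z : ℝ} (h0 : 0 ≤ z) (h1 : z ≤ 1) :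
    Real.exp (z ^ 2 / 4) ≤ Real.cosh z := by
  have h2 : 1 + z ^ 2 / 2 ≤ Real.cosh z := by
    have h3 : z / 2 ≤ Real.sinh (z / 2) := Real.self_le_sinh_iff.2 (by linarith)
    have h4 : Real.cosh z = 1 + 2 * Real.sinh (z / 2) ^ 2 := by
      have := Real.cosh_two_mul (z / 2)
      rw [mul_div_cancel₀ z two_ne_zero] at this
      rw [this, Real.cosh_sq]
      ring
    rw [h4]
    nlinarith
  refine le_trans ?_ h2
  have h5 : 1 - z ^ 2 / 4 ≤ Real.exp (-(z ^ 2 / 4)) := Real.one_sub_le_exp_neg _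
  rw [Real.exp_neg] at h5
  have h6 : 0 < Real.exp (z ^ 2 / 4) := Real.exp_pos _
  have h7 : (1 - z ^ 2 / 4) * Real.exp (z ^ 2 / 4) ≤ 1 := by
    calc _ ≤ (Real.exp (z ^ 2 / 4))⁻¹ * Real.exp (z ^ 2 / 4) :=
          mul_le_mul_of_nonneg_right h5 h6.le
      _ = 1 := inv_mul_cancel₀ h6.ne'
  have h8 : z ^ 2 ≤ 1 := by nlinarith
  have h9 : 0 ≤ z ^ 2 := sq_nonneg z
  have h10 : 1 ≤ (1 - z ^ 2 / 4) * (1 + z ^ 2 / 2) := by nlinarith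
  have h11 : (1 - z ^ 2 / 4) * Real.exp (z ^ 2 / 4) ≤ (1 - z ^ 2 / 4) * (1 + z ^ 2 / 2) :=
    h7.trans h10
  exact le_of_mul_le_mul_left h11 (by linarith)

/-- A lower bound for the moderate deviations of a sum of bits. -/
lemma anticoncentration (R : Finset ι) {s r : ℝ} (hr : (R.card : ℝ) = r) (hr0 : 0 < r)
    (hs : 0 ≤ s) (h1 : r ≤ s ^ 2) (h2 : 16 * s ≤ r) :
    1 / 4 * Real.exp (-(512 * s ^ 2 / r)) ≤
      pr (fun x : ι → Bool => s ≤ lin (fun i => if i ∈ R then 1 else 0) x) := by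
  set a : ι → ℝ := fun i => if i ∈ R then 1 else 0 with ha
  set l : ℝ := 32 * s / r with hl
  set q := s ^ 2 / r with hq
  have hq1 : 1 ≤ q := by rw [hq, le_div_iff₀ hr0]; linarith
  have hl0 : 0 ≤ l := by positivity
  have hl2 : l / 2 ≤ 1 := by
    rw [hl, div_div, div_le_one (by positivity)]
    linarith
  have hM : ∀ t : ℝ, 𝔼 x, Real.exp (t * lin a x) = Real.cosh (t / 2) ^ R.card := by
    intro t
    simp_rw [mul_lin]
    rw [expect_exp_lin, ← Finset.prod_const]
    rw [← Finset.prod_subset (Finset.subset_univ R)]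
    · refine Finset.prod_congr rfl fun i hi => by simp [ha, hi]
    · intro i _ hi
      simp [ha, hi]
  have hM1 : Real.exp (64 * q) ≤ 𝔼 x, Real.exp (l * lin a x) := by
    rw [hM]
    calc Real.exp (64 * q) = Real.exp ((l / 2) ^ 2 / 4) ^ R.card := by
          rw [← Real.exp_nat_mul, hr, hl, hq]
          congr 1
          field_simp
          ring
      _ ≤ _ := pow_le_pow_left₀ (Real.exp_nonneg _)
          (exp_sq_div_four_le_cosh (by positivity) hl2) _
  have hM2 : 𝔼 x, Real.exp (2 * l * lin a x) ≤ Real.exp (512 * q) := by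
    rw [hM]
    calc Real.cosh (2 * l / 2) ^ R.card ≤ Real.exp ((2 * l / 2) ^ 2 / 2) ^ R.card :=
          pow_le_pow_left₀ (Real.cosh_pos _).le (Real.cosh_le_exp_half_sq _) _
      _ = _ := by
          rw [← Real.exp_nat_mul, hr, hl, hq]
          congr 1
          field_simp
          ring
  set T := 𝔼 x, Real.exp (l * lin a x) * ind (s ≤ lin a x) with hT
  have hsplit : 𝔼 x, Real.exp (l * lin a x) ≤ Real.exp (32 * q) + T := by
    have h3 : 𝔼 x : ι → Bool, Real.exp (32 * q) = Real.exp (32 * q) := Fintype.expect_const _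
    rw [← h3, hT, ← Finset.expect_add_distrib]
    refine Finset.expect_le_expect fun x _ => ?_
    by_cases hx : s ≤ lin a x
    · rw [ind_true hx, mul_one]
      linarith [Real.exp_nonneg (32 * q)]
    · rw [ind_false hx, mul_zero, add_zero, Real.exp_le_exp]
      have : 32 * q = l * s := by rw [hl, hq]; ring
      rw [this]
      exact mul_le_mul_of_nonneg_left (not_le.1 hx).le hl0
  have hhalf : 2 * Real.exp (32 * q) ≤ Real.exp (64 * q) := by
    have h4 : Real.exp (64 * q) = Real.exp (32 * q) * Real.exp (32 * q) := by
      rw [← Real.exp_add]; ring_nf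
    rw [h4]
    refine mul_le_mul_of_nonneg_right ?_ (Real.exp_nonneg _)
    linarith [Real.add_one_le_exp (32 * q)]
  have hT1 : 1 / 2 ≤ T := by
    have : 1 ≤ Real.exp (32 * q) := Real.one_le_exp (by positivity)
    linarith
  have hCS : T ^ 2 ≤ (𝔼 x, Real.exp (2 * l * lin a x)) * pr (fun x => s ≤ lin a x) := by
    have hcs := Finset.sum_mul_sq_le_sq_mul_sq Finset.univ
      (fun x : ι → Bool => Real.exp (l * lin a x)) (fun x => ind (s ≤ lin a x))
    have h5 : ∀ x : ι → Bool, Real.exp (l * lin a x) ^ 2 = Real.exp (2 * l * lin a x) := by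
      intro x; rw [← Real.exp_nat_mul]; congr 1; push_cast; ring
    have h6 : ∀ x : ι → Bool, ind (s ≤ lin a x) ^ 2 = ind (s ≤ lin a x) := by
      intro x; by_cases hx : s ≤ lin a x <;> simp [ind, hx]
    simp_rw [h5, h6] at hcs
    rw [hT, pr, Fintype.expect_eq_sum_div_card, Fintype.expect_eq_sum_div_card,
      Fintype.expect_eq_sum_div_card, div_pow, div_mul_div_comm, ← sq]
    gcongr
  have hp := pr_nonneg (fun x : ι → Bool => s ≤ lin a x)
  have h7 : 1 / 4 ≤ Real.exp (512 * q) * pr (fun x => s ≤ lin a x) := by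
    have := mul_le_mul_of_nonneg_right hM2 hp
    nlinarith
  have h8 : 512 * s ^ 2 / r = 512 * q := by rw [hq]; ring
  rw [h8, Real.exp_neg, mul_comm, inv_mul_le_iff₀ (Real.exp_pos _)]
  exact h7

/-- Linear forms are Lipschitz in the Hamming distance. -/
lemma abs_lin_sub_le (a : ι → ℝ) (x y : ι → Bool) :
    |lin a x - lin a y| ≤ ∑ i, |a i| * ind (x i ≠ y i) := by
  unfold lin
  rw [← Finset.sum_sub_distrib]
  refine (Finset.abs_sum_le_sum_abs _ _).trans (Finset.sum_le_sum fun i _ => ?_)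
  rw [← mul_sub, abs_mul]
  refine mul_le_mul_of_nonneg_left ?_ (abs_nonneg _)
  cases x i <;> cases y i <;> norm_num [cbit, ind]

end Lin

/-! ### Layers of the cube and increasing functions -/

section Layers

variable {κ : Type*} [Fintype κ] [DecidableEq κ]

/-- The number of ones of a Boolean vector. -/
def ones (x : κ → Bool) : ℕ := (Finset.univ.filter fun i => x i = true).card

lemma ones_add_zeros (x : κ → Bool) :
    ones x + (Finset.univ.filter fun i => x i = false).card = Fintype.card κ := by
  have := Finset.card_filter_add_card_filter_not (s := (Finset.univ : Finset κ))
    (fun i => x i = true)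
  simpa [ones] using this

lemma ones_update {x : κ → Bool} {i : κ} (h : x i = false) :
    ones (Function.update x i true) = ones x + 1 := by
  unfold ones
  have : (Finset.univ.filter fun j => Function.update x i true j = true) =
      insert i (Finset.univ.filter fun j => x j = true) := by
    ext j
    by_cases hj : j = i
    · subst hj; simp
    · simp [hj]
  rw [this, Finset.card_insert_of_notMem (by simp [h])]

/-- The total weight of the vectors with `j` ones. -/
noncomputable def layer (g : (κ → Bool) → ℝ) (j : ℕ) : ℝ := ∑ x, g x * ind (ones x = j)

lemma layer_nonneg {g : (κ → Bool) → ℝ} (h0 : ∀ x, 0 ≤ g x) (j : ℕ) : 0 ≤ layer g j :=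
  Finset.sum_nonneg fun x _ => mul_nonneg (h0 x) (ind_nonneg _)

lemma layer_succ {g : (κ → Bool) → ℝ} (hg : Monotone g) (j : ℕ) :
    ((Fintype.card κ : ℝ) - j) * layer g j ≤ ((j : ℝ) + 1) * layer g (j + 1) := by
  have hL : ((Fintype.card κ : ℝ) - j) * layer g j =
      ∑ i : κ, ∑ x : κ → Bool, g x * ind (ones x = j ∧ x i = false) := by
    rw [Finset.sum_comm, layer, Finset.mul_sum]
    refine Finset.sum_congr rfl fun x _ => ?_
    simp_rw [ind_and]
    rw [← Finset.mul_sum, ← Finset.mul_sum]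
    by_cases hx : ones x = j
    · have h1 := ones_add_zeros x
      have h2 : ∑ i, ind (x i = false) =
          ((Finset.univ.filter fun i => x i = false).card : ℝ) := by
        exact sum_ind _ _
      rw [h2, ← h1, hx]
      push_cast
      ring
    · rw [ind_false hx]
      ring
  have hR : ((j : ℝ) + 1) * layer g (j + 1) =
      ∑ i : κ, ∑ x : κ → Bool, g x * ind (ones x = j + 1 ∧ x i = true) := by
    rw [Finset.sum_comm, layer, Finset.mul_sum]
    refine Finset.sum_congr rfl fun x _ => ?_
    simp_rw [ind_and]
    rw [← Finset.mul_sum, ← Finset.mul_sum]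
    by_cases hx : ones x = j + 1
    · have h2 : ∑ i, ind (x i = true) = ((ones x : ℕ) : ℝ) := by
        exact sum_ind _ _
      rw [h2, hx]
      push_cast
      ring
    · rw [ind_false hx]
      ring
  rw [hL, hR]
  refine Finset.sum_le_sum fun i _ => ?_
  have hinv : Function.Involutive (fun x : κ → Bool => Function.update x i (!x i)) := by
    intro x
    simp
  rw [← Equiv.sum_comp hinv.toPerm (fun x => g x * ind (ones x = j + 1 ∧ x i = true))]
  refine Finset.sum_le_sum fun x _ => ?_
  simp only [Function.Involutive.coe_toPerm, Function.update_self]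
  by_cases h : ones x = j ∧ x i = false
  · obtain ⟨h1, h2⟩ := h
    have h3 : ones (Function.update x i (!x i)) = j + 1 ∧ (!x i) = true := by
      rw [h2]
      exact ⟨by rw [Bool.not_false, ones_update h2, h1], rfl⟩
    rw [ind_true ⟨h1, h2⟩, ind_true h3]
    refine mul_le_mul_of_nonneg_right (hg ?_) zero_le_one
    rw [h2, Bool.not_false]
    intro k
    by_cases hk : k = i
    · subst hk; simp
    · simp [hk]
  · rw [ind_false h]
    by_cases h3 : ones (Function.update x i (!x i)) = j + 1 ∧ (!x i) = true
    · exfalso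
      have h4 : x i = false := by simpa using h3.2
      rw [h4, Bool.not_false, ones_update h4] at h3
      exact h ⟨by omega, h4⟩
    · rw [ind_false h3]; simp

lemma sum_layer_le {g : (κ → Bool) → ℝ} (h0 : ∀ x, 0 ≤ g x) (j L : ℕ) :
    ∑ i ∈ Finset.range L, layer g (j + i) ≤ ∑ x, g x * ind (j ≤ ones x) := by
  unfold layer
  rw [Finset.sum_comm]
  refine Finset.sum_le_sum fun x _ => ?_
  rw [← Finset.mul_sum]
  refine mul_le_mul_of_nonneg_left ?_ (h0 x)
  by_cases h : ∃ i ∈ Finset.range L, ones x = j + i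
  · obtain ⟨i, hi, hxi⟩ := h
    rw [Finset.sum_eq_single_of_mem i hi, ind_true hxi, ind_true (by omega)]
    intro b _ hb
    exact ind_false (by omega)
  · push Not at h
    rw [Finset.sum_eq_zero fun i hi => ind_false (h i hi)]
    exact ind_nonneg _

lemma layer_mul_le {g : (κ → Bool) → ℝ} (hg : Monotone g) (h0 : ∀ x, 0 ≤ g x) {j L : ℕ}
    (hL : 0 < L)
    (h : ∀ i < L, ((j : ℝ) + i + 1) ≤ (1 + 1 / L) * ((Fintype.card κ : ℝ) - j - i)) :
    L * layer g j ≤ 3 * ∑ x, g x * ind (j ≤ ones x) := by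
  have hL' : (0 : ℝ) < L := by exact_mod_cast hL
  have hstep : ∀ i ≤ L, layer g j ≤ (1 + 1 / L : ℝ) ^ i * layer g (j + i) := by
    intro i
    induction i with
    | zero => intro _; simp
    | succ i ih =>
      intro hi
      refine (ih (by omega)).trans ?_
      rw [pow_succ, mul_assoc]
      refine mul_le_mul_of_nonneg_left ?_ (by positivity)
      have h1 := layer_succ hg (j + i)
      have h2 := h i (by omega)
      have h3 := layer_nonneg h0 (j + i + 1)
      push_cast at h1
      have hpos : (0 : ℝ) < (Fintype.card κ : ℝ) - j - i := by
        by_contra hcon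
        have : (1 + 1 / L : ℝ) * ((Fintype.card κ : ℝ) - j - i) ≤ 0 :=
          mul_nonpos_of_nonneg_of_nonpos (by positivity) (not_lt.1 hcon)
        have : (0 : ℝ) ≤ j + i := by positivity
        linarith
      have h4 : ((Fintype.card κ : ℝ) - j - i) * layer g (j + i) ≤
          ((Fintype.card κ : ℝ) - j - i) * ((1 + 1 / L) * layer g (j + i + 1)) := by
        calc _ = ((Fintype.card κ : ℝ) - (j + i)) * layer g (j + i) := by ring
          _ ≤ _ := h1
          _ ≤ ((1 + 1 / L) * ((Fintype.card κ : ℝ) - j - i)) * layer g (j + i + 1) :=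
            mul_le_mul_of_nonneg_right h2 h3
          _ = _ := by ring
      exact le_of_mul_le_mul_left h4 hpos
  have hpow : ∀ i ≤ L, (1 + 1 / L : ℝ) ^ i ≤ 3 := by
    intro i hi
    calc (1 + 1 / L : ℝ) ^ i ≤ (1 + 1 / L : ℝ) ^ L :=
          pow_le_pow_right₀ (by linarith [one_div_pos.2 hL']) hi
      _ ≤ Real.exp (1 / L) ^ L := by
          refine pow_le_pow_left₀ (by positivity) ?_ _
          linarith [Real.add_one_le_exp (1 / L : ℝ)]
      _ = Real.exp 1 := by
          rw [← Real.exp_nat_mul]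
          congr 1
          field_simp
      _ ≤ 3 := by linarith [Real.exp_one_lt_d9]
  calc (L : ℝ) * layer g j = ∑ i ∈ Finset.range L, layer g j := by simp
    _ ≤ ∑ i ∈ Finset.range L, 3 * layer g (j + i) := by
        refine Finset.sum_le_sum fun i hi => ?_
        have hi' := (Finset.mem_range.1 hi).le
        exact (hstep i hi').trans
          (mul_le_mul_of_nonneg_right (hpow i hi') (layer_nonneg h0 _))
    _ = 3 * ∑ i ∈ Finset.range L, layer g (j + i) := by rw [Finset.mul_sum]
    _ ≤ _ := mul_le_mul_of_nonneg_left (sum_layer_le h0 j L) (by norm_num)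

/-- Under an increasing weight, the number of ones conditioned to exceed a threshold that is not
far above its mean is unlikely to be at the threshold. -/
lemma expect_tight_le {g : (κ → Bool) → ℝ} (hg : Monotone g) (h0 : ∀ x, 0 ≤ g x) {k d τ : ℝ}
    (hk : (Fintype.card κ : ℝ) = k) (hk0 : 0 < k) (hd1 : 1 ≤ d) (hd : k ≤ d ^ 2)
    (hτ : τ ≤ k / 2 + d) :
    𝔼 x, g x * ind (τ ≤ ones x) * (1 + ind ((ones x : ℝ) < τ + 1)) ≤
      Real.exp (200 * d / k) * 𝔼 x, g x * ind (τ ≤ ones x) := by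
  rw [Finset.mul_expect]
  by_cases hbig : 1 ≤ 200 * d / k
  · refine Finset.expect_le_expect fun x _ => ?_
    rw [mul_comm]
    refine mul_le_mul_of_nonneg_right ?_ (mul_nonneg (h0 x) (ind_nonneg _))
    have := ind_le_one ((ones x : ℝ) < τ + 1)
    have := Real.add_one_le_exp (200 * d / k)
    linarith
  · rw [not_le, div_lt_one hk0] at hbig
    set j : ℕ := ⌈τ⌉₊ with hj
    set L : ℕ := ⌊k / (32 * d)⌋₊ with hLdef
    have hLle : (L : ℝ) ≤ k / (32 * d) := Nat.floor_le (by positivity)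
    have hLgt : k / (32 * d) < L + 1 := Nat.lt_floor_add_one _
    have h6 : 6 ≤ k / (32 * d) := by
      rw [le_div_iff₀ (by positivity)]; linarith
    have hL0 : (0 : ℝ) < L := by linarith
    have hjle : (j : ℝ) ≤ k / 2 + d + 1 := by
      by_cases hτ0 : 0 ≤ τ
      · have := Nat.ceil_lt_add_one hτ0
        linarith
      · rw [hj, Nat.ceil_eq_zero.2 (by linarith)]
        push_cast
        linarith
    have hLd : (L : ℝ) ≤ d := by
      refine hLle.trans ?_
      rw [div_le_iff₀ (by positivity)]
      nlinarith
    have hchain : (L : ℝ) * layer g j ≤ 3 * ∑ x, g x * ind (j ≤ ones x) := by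
      refine layer_mul_le hg h0 (by exact_mod_cast hL0) fun i hi => ?_
      rw [hk]
      have hi' : (i : ℝ) + 1 ≤ L := by exact_mod_cast hi
      have h1 : 32 * d / k ≤ 1 / L := by
        rw [div_le_div_iff₀ hk0 hL0]
        rw [le_div_iff₀ (by positivity)] at hLle
        linarith
      have h2 : k / 2 - 4 * d ≤ k - j - i := by linarith
      have h3 : (0 : ℝ) ≤ k / 2 - 4 * d := by linarith
      have h4 : (1 + 32 * d / k) * (k / 2 - 4 * d) ≤ (1 + 1 / L) * (k - j - i) :=
        mul_le_mul (by linarith) h2 h3 (by positivity)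
      refine le_trans ?_ h4
      have h5 : 32 * d / k * (k / 2 - 4 * d) = 16 * d - 128 * d * (d / k) := by
        field_simp
        ring
      have h7 : d / k ≤ 1 / 200 := by
        rw [div_le_div_iff₀ hk0 (by norm_num)]; linarith
      have h8 : (1 + 32 * d / k) * (k / 2 - 4 * d) =
          k / 2 - 4 * d + (16 * d - 128 * d * (d / k)) := by
        rw [← h5]; ring
      rw [h8]
      nlinarith
    have hexp : 1 + 3 / L ≤ Real.exp (200 * d / k) := by
      refine le_trans ?_ (Real.add_one_le_exp _)
      have : 3 / (L : ℝ) ≤ 200 * d / k := by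
        rw [div_le_div_iff₀ hL0 hk0]
        have h9 : k = 32 * d * (k / (32 * d)) := by field_simp
        rw [h9]
        nlinarith
      linarith
    have htail : ∀ x : κ → Bool, ind (τ ≤ ones x) = ind (j ≤ ones x) := by
      intro x
      have : τ ≤ ones x ↔ j ≤ ones x := by rw [hj, Nat.ceil_le]
      by_cases h : τ ≤ ones x
      · rw [ind_true h, ind_true (this.1 h)]
      · rw [ind_false h, ind_false (mt this.2 h)]
    have htight : ∀ x : κ → Bool, ind (τ ≤ ones x) * ind ((ones x : ℝ) < τ + 1) ≤
        ind (ones x = j) := by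
      intro x
      rw [← ind_and]
      refine ind_mono fun ⟨h1, h2⟩ => ?_
      have h3 : j ≤ ones x := by rw [hj, Nat.ceil_le]; exact h1
      have h4 : τ ≤ j := Nat.le_ceil _
      have h5 : (ones x : ℝ) < j + 1 := by linarith
      have h6 : ones x < j + 1 := by exact_mod_cast h5
      omega
    rw [← Finset.mul_expect, Fintype.expect_eq_sum_div_card, Fintype.expect_eq_sum_div_card,
      ← mul_div_assoc]
    refine div_le_div_of_nonneg_right ?_ (by positivity)
    have hS : 0 ≤ ∑ x, g x * ind (j ≤ ones x) :=
      Finset.sum_nonneg fun x _ => mul_nonneg (h0 x) (ind_nonneg _)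
    calc ∑ x, g x * ind (τ ≤ ones x) * (1 + ind ((ones x : ℝ) < τ + 1))
        ≤ ∑ x, (g x * ind (j ≤ ones x) + g x * ind (ones x = j)) := by
          refine Finset.sum_le_sum fun x _ => ?_
          have := mul_le_mul_of_nonneg_left (htight x) (h0 x)
          rw [← htail]
          linarith
      _ = ∑ x, g x * ind (j ≤ ones x) + layer g j := by rw [Finset.sum_add_distrib, layer]
      _ ≤ (1 + 3 / L) * ∑ x, g x * ind (j ≤ ones x) := by
          have : layer g j ≤ 3 / L * ∑ x, g x * ind (j ≤ ones x) := by
            rw [div_mul_eq_mul_div, le_div_iff₀ hL0]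
            linarith
          linarith
      _ ≤ Real.exp (200 * d / k) * ∑ x, g x * ind (j ≤ ones x) :=
          mul_le_mul_of_nonneg_right hexp hS
      _ = _ := by simp_rw [htail]

end Layers

/-! ### Slacks of vertices

Graphs are encoded by the bits `ω : Sym2 V → Bool`. The vertices carry labels in `Bool × Bool`. An
edge between vertices agreeing in the first label helps both endpoints; the other edges enter the
slack of a vertex through the absolute value of their signed sum. -/

section Slack

variable {V : Type*} [Fintype V] [DecidableEq V]

/-- The bits of the pairs containing `v`. -/
def row (v : V) (ω : Sym2 V → Bool) : V → Bool := fun w => ω s(v, w)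

/-- Coefficients of the pairs helping `v`. -/
def helpCoef (c : V → Bool × Bool) (v w : V) : ℝ := if w ≠ v ∧ (c w).1 = (c v).1 then 1 else 0

/-- Coefficients of the pairs helping `v` inside its own class. -/
def ownCoef (c : V → Bool × Bool) (v w : V) : ℝ := if w ≠ v ∧ c w = c v then 1 else 0

/-- Signed coefficients of the mixed pairs at `v`. -/
def mixCoef (c : V → Bool × Bool) (v w : V) : ℝ :=
  if (c w).1 ≠ (c v).1 then (if (c w).2 then 1 else -1) else 0

/-- The amount by which `v` satisfies its two degree conditions. -/
noncomputable def slack (c : V → Bool × Bool) (θ : ℝ) (v : V) (x : V → Bool) : ℝ :=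
  lin (helpCoef c v) x - |lin (mixCoef c v) x| - θ

/-- Every vertex has nonnegative slack. -/
def Friendly (c : V → Bool × Bool) (θ : ℝ) (ω : Sym2 V → Bool) : Prop :=
  ∀ v, 0 ≤ slack c θ v (row v ω)

/-- The slack of `v` is less than one. -/
def Tight (c : V → Bool × Bool) (θ : ℝ) (v : V) (ω : Sym2 V → Bool) : Prop :=
  slack c θ v (row v ω) < 1

lemma helpCoef_nonneg (c : V → Bool × Bool) (v w : V) : 0 ≤ helpCoef c v w := by
  unfold helpCoef; split_ifs <;> norm_num

lemma abs_helpCoef_add_abs_mixCoef_le (c : V → Bool × Bool) (v w : V) :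
    |helpCoef c v w| + |mixCoef c v w| ≤ 1 := by
  unfold helpCoef mixCoef
  by_cases h : (c w).1 = (c v).1
  · by_cases h' : w = v <;> simp [h, h']
  · by_cases h' : (c w).2 = true <;> simp [h, h']

lemma abs_mixCoef_le (c : V → Bool × Bool) (v w : V) : |mixCoef c v w| ≤ 1 := by
  linarith [abs_helpCoef_add_abs_mixCoef_le c v w, abs_nonneg (helpCoef c v w)]

lemma abs_ownCoef_le (c : V → Bool × Bool) (v w : V) : |ownCoef c v w| ≤ 1 := by
  unfold ownCoef; split_ifs <;> norm_num

lemma cbit_mono {a b : Bool} (h : a ≤ b) : cbit a ≤ cbit b := by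
  cases a <;> cases b
  · exact le_rfl
  · norm_num [cbit]
  · exact absurd h (by decide)
  · exact le_rfl

lemma lin_congr {ι : Type*} [Fintype ι] {a : ι → ℝ} {x y : ι → Bool}
    (h : ∀ i, a i ≠ 0 → x i = y i) : lin a x = lin a y := by
  refine Finset.sum_congr rfl fun i _ => ?_
  by_cases hi : a i = 0
  · simp [hi]
  · rw [h i hi]

lemma mixCoef_eq_zero {c : V → Bool × Bool} {v w : V} (h : (c w).1 = (c v).1) :
    mixCoef c v w = 0 := by simp [mixCoef, h]

lemma slack_mono (c : V → Bool × Bool) (θ : ℝ) (v : V) {x y : V → Bool} (h : x ≤ y)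
    (hmix : ∀ w, (c w).1 ≠ (c v).1 → x w = y w) : slack c θ v x ≤ slack c θ v y := by
  unfold slack
  have h1 : lin (mixCoef c v) x = lin (mixCoef c v) y :=
    lin_congr fun w hw => hmix w fun h' => hw (mixCoef_eq_zero h')
  have h2 : lin (helpCoef c v) x ≤ lin (helpCoef c v) y :=
    Finset.sum_le_sum fun w _ => mul_le_mul_of_nonneg_left (cbit_mono (h w)) (helpCoef_nonneg c v w)
  rw [h1]
  linarith

lemma slack_le_add (c : V → Bool × Bool) (θ : ℝ) (v : V) (x y : V → Bool) :
    slack c θ v x ≤ slack c θ v y + ∑ w, ind (x w ≠ y w) := by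
  have h1 := abs_lin_sub_le (helpCoef c v) x y
  have h2 := abs_lin_sub_le (mixCoef c v) x y
  have h3 : ∑ w, |helpCoef c v w| * ind (x w ≠ y w) + ∑ w, |mixCoef c v w| * ind (x w ≠ y w) ≤
      ∑ w, ind (x w ≠ y w) := by
    rw [← Finset.sum_add_distrib]
    refine Finset.sum_le_sum fun w _ => ?_
    have := abs_helpCoef_add_abs_mixCoef_le c v w
    have := ind_nonneg (x w ≠ y w)
    nlinarith
  have h4 := abs_abs_sub_abs_le_abs_sub (lin (mixCoef c v) x) (lin (mixCoef c v) y)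
  have h5 := abs_le.1 (h4.trans h2)
  have h6 := abs_le.1 h1
  unfold slack
  linarith [h5.1, h6.2]

lemma pair_injective (v : V) : Function.Injective fun w : V => s(v, w) := by
  intro a b h
  rcases Sym2.eq_iff.1 h with ⟨-, h⟩ | ⟨h₁, h₂⟩
  · exact h
  · exact h₂.trans h₁

lemma row_extend_self (v : V) (y : V → Bool) (ω : Sym2 V → Bool) :
    row v (Function.extend (fun w => s(v, w)) y ω) = y := by
  funext w
  exact (pair_injective v).extend_apply y ω w

lemma row_extend_of_ne {u v : V} (h : u ≠ v) (y : V → Bool) (ω : Sym2 V → Bool) :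
    row u (Function.extend (fun w => s(v, w)) y ω) = Function.update (row u ω) v (y u) := by
  funext w
  unfold row
  by_cases hw : w = v
  · subst hw
    rw [Function.update_self, Sym2.eq_swap]
    exact (pair_injective w).extend_apply y ω u
  · rw [Function.update_of_ne hw, Function.extend_apply']
    rintro ⟨a, ha⟩
    simp only [Sym2.eq_iff] at ha
    rcases ha with ⟨h1, -⟩ | ⟨h1, -⟩
    · exact h h1.symm
    · exact hw h1.symm

/-! ### The total irregularity -/

lemma sum_lin_row (b : V → V → ℝ) (ω : Sym2 V → Bool) :
    ∑ u, lin (b u) (row u ω) =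
      lin (fun z => ∑ p : V × V with s(p.1, p.2) = z, b p.1 p.2) ω := by
  unfold lin row
  rw [← Fintype.sum_prod_type' (f := fun u w => b u w * cbit (ω s(u, w)))]
  rw [← Finset.sum_fiberwise (s := Finset.univ) (g := fun p : V × V => s(p.1, p.2))]
  refine Finset.sum_congr rfl fun z _ => ?_
  rw [Finset.sum_mul]
  refine Finset.sum_congr rfl fun p hp => ?_
  rw [(Finset.mem_filter.1 hp).2]

lemma abs_sum_fiber_le (b : V → V → ℝ) (hb : ∀ u w, |b u w| ≤ 1) (z : Sym2 V) :
    |∑ p : V × V with s(p.1, p.2) = z, b p.1 p.2| ≤ 2 := by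
  induction z using Sym2.ind with
  | _ u w =>
    have hsub : (Finset.univ.filter fun p : V × V => s(p.1, p.2) = s(u, w)) ⊆
        {(u, w), (w, u)} := by
      rintro ⟨p, q⟩ hp
      simpa [Sym2.eq_iff] using hp
    calc _ ≤ ∑ p : V × V with s(p.1, p.2) = s(u, w), |b p.1 p.2| :=
          Finset.abs_sum_le_sum_abs _ _
      _ ≤ ∑ p : V × V with s(p.1, p.2) = s(u, w), (1 : ℝ) :=
          Finset.sum_le_sum fun p _ => hb _ _
      _ = ((Finset.univ.filter fun p : V × V => s(p.1, p.2) = s(u, w)).card : ℝ) := by simp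
      _ ≤ (({(u, w), (w, u)} : Finset (V × V)).card : ℝ) := by
          exact_mod_cast Finset.card_le_card hsub
      _ ≤ 2 := by exact_mod_cast Finset.card_le_two

lemma pr_total_irregularity_le (b : V → V → ℝ) (hb : ∀ u w, |b u w| ≤ 1) {l : ℝ} (hl : 0 ≤ l)
    (G : ℝ) :
    pr (fun ω : Sym2 V → Bool => G ≤ ∑ u, |lin (b u) (row u ω)|) ≤
      2 ^ Fintype.card V * Real.exp (l ^ 2 * (Fintype.card V : ℝ) ^ 2 / 2 - l * G) := by
  set sg : Bool → ℝ := fun e => if e then 1 else -1 with hsg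
  have hsg1 : ∀ e, |sg e| = 1 := by intro e; cases e <;> simp [hsg]
  set b' : (V → Bool) → V → V → ℝ := fun ε u w => sg (ε u) * b u w with hb'
  have hstep : ∀ ω : Sym2 V → Bool, G ≤ ∑ u, |lin (b u) (row u ω)| →
      ∃ ε : V → Bool, G ≤ ∑ u, lin (b' ε u) (row u ω) := by
    intro ω hω
    refine ⟨fun u => decide (0 ≤ lin (b u) (row u ω)), hω.trans (le_of_eq ?_)⟩
    refine Finset.sum_congr rfl fun u _ => ?_
    rw [hb', ← mul_lin]
    by_cases h : 0 ≤ lin (b u) (row u ω)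
    · simp [hsg, h, abs_of_nonneg h]
    · simp [hsg, h, abs_of_neg (not_le.1 h)]
  refine (pr_mono hstep).trans ((pr_exists_le _).trans ?_)
  have hone : ∀ ε : V → Bool, pr (fun ω : Sym2 V → Bool => G ≤ ∑ u, lin (b' ε u) (row u ω)) ≤
      Real.exp (l ^ 2 * (Fintype.card V : ℝ) ^ 2 / 2 - l * G) := by
    intro ε
    simp_rw [sum_lin_row]
    have hA : ∑ z : Sym2 V, (∑ p : V × V with s(p.1, p.2) = z, b' ε p.1 p.2) ^ 2 ≤
        4 * (Fintype.card V : ℝ) ^ 2 := by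
      have hcard : Fintype.card (Sym2 V) ≤ Fintype.card V ^ 2 := by
        have := Fintype.card_le_of_surjective (fun p : V × V => s(p.1, p.2))
          (fun z => by induction z using Sym2.ind with | _ u w => exact ⟨(u, w), rfl⟩)
        rwa [Fintype.card_prod, ← sq] at this
      calc _ ≤ ∑ z : Sym2 V, (4 : ℝ) := by
            refine Finset.sum_le_sum fun z _ => ?_
            have := abs_sum_fiber_le (b' ε) (fun u w => by
              rw [hb', abs_mul, hsg1, one_mul]; exact hb u w) z
            rw [← sq_abs]
            nlinarith [abs_nonneg (∑ p : V × V with s(p.1, p.2) = z, b' ε p.1 p.2)]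
        _ = 4 * (Fintype.card (Sym2 V) : ℝ) := by
            rw [Finset.sum_const, nsmul_eq_mul, Finset.card_univ, mul_comm]
        _ ≤ _ := by
            have : (Fintype.card (Sym2 V) : ℝ) ≤ (Fintype.card V : ℝ) ^ 2 := by
              exact_mod_cast hcard
            linarith
    refine (chernoff _ hA hl G).trans (le_of_eq ?_)
    congr 1
    ring
  calc _ ≤ ∑ _ε : V → Bool, Real.exp (l ^ 2 * (Fintype.card V : ℝ) ^ 2 / 2 - l * G) :=
        Finset.sum_le_sum fun ε _ => hone ε
    _ = _ := by simp

end Slack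

/-! ### Resampling the pairs at one vertex -/

section Resample

variable {V : Type*} [Fintype V] [DecidableEq V]

lemma pr_and_of_disjoint {ι : Type*} [Fintype ι] [DecidableEq ι] (K : Finset ι)
    (p q : (ι → Bool) → Prop) (hp : ∀ x y, (∀ i ∈ K, x i = y i) → p x → p y)
    (hq : ∀ x y, (∀ i, i ∉ K → x i = y i) → q x → q y) :
    pr (fun x => p x ∧ q x) = pr p * pr q := by
  unfold pr
  simp_rw [ind_and]
  refine expect_mul_of_disjoint K _ _ (fun x y h => ?_) (fun x y h => ?_)
  · exact le_antisymm (ind_mono (hp x y h)) (ind_mono (hp y x fun i hi => (h i hi).symm))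
  · exact le_antisymm (ind_mono (hq x y h)) (ind_mono (hq y x fun i hi => (h i hi).symm))

open Classical in
lemma pr_friendly_and_row_le (c : V → Bool × Bool) (θ : ℝ) (v : V) (p : (V → Bool) → Prop)
    {t ε : ℝ} (hε0 : 0 ≤ ε)
    (h : ∀ (B : Finset V) (b : V → Bool), (B.card : ℝ) ≤ t →
      pr (fun x => p (B.piecewise b x)) ≤ ε * pr (fun x => 0 ≤ slack c θ v (B.piecewise b x))) :
    pr (fun ω => Friendly c θ ω ∧ ((univ.filter fun u => Tight c θ u ω).card : ℝ) ≤ t ∧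
      p (row v ω)) ≤ ε * pr (Friendly c θ) := by
  have hε : ε * pr (Friendly c θ) = 𝔼 ω, ε * ind (Friendly c θ ω) := by
    unfold pr; rw [Finset.mul_expect]
  rw [hε]
  unfold pr
  refine expect_le_of_extend (pair_injective v) _ _ fun ω => ?_
  set E : (V → Bool) → Sym2 V → Bool := fun y => Function.extend (fun w => s(v, w)) y ω with hE
  change 𝔼 y, ind (Friendly c θ (E y) ∧ ((univ.filter fun u => Tight c θ u (E y)).card : ℝ) ≤ t ∧
    p (row v (E y))) ≤ 𝔼 y, ε * ind (Friendly c θ (E y))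
  have hrow : ∀ y, row v (E y) = y := fun y => row_extend_self v y ω
  have hrow' : ∀ y u, u ≠ v → row u (E y) = Function.update (row u ω) v (y u) :=
    fun y u hu => row_extend_of_ne hu y ω
  set ok : V → Bool → Prop := fun u b => 0 ≤ slack c θ u (Function.update (row u ω) v b) with hok
  have hF : ∀ y, Friendly c θ (E y) ↔ 0 ≤ slack c θ v y ∧ ∀ u, u ≠ v → ok u (y u) := by
    intro y
    constructor
    · intro hf
      refine ⟨by simpa [hrow] using hf v, fun u hu => ?_⟩
      have := hf u
      rwa [hrow' y u hu] at this
    · rintro ⟨h1, h2⟩ u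
      by_cases hu : u = v
      · subst hu; rwa [hrow]
      · rw [hrow' y u hu]; exact h2 u hu
  by_cases hex : ∃ y₀, Friendly c θ (E y₀) ∧
      ((univ.filter fun u => Tight c θ u (E y₀)).card : ℝ) ≤ t ∧ p (row v (E y₀))
  · obtain ⟨b, hb1, hb2, -⟩ := hex
    set B : Finset V := univ.filter fun u => u ≠ v ∧ ¬(ok u true ∧ ok u false) with hB
    have hbok := (hF b).1 hb1
    have hagree : ∀ y : V → Bool, (∀ u, u ≠ v → ok u (y u)) ↔ ∀ u ∈ B, y u = b u := by
      intro y
      constructor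
      · intro hy u hu
        obtain ⟨hu1, hu2⟩ := (mem_filter.1 hu).2
        have h1 := hy u hu1
        have h2 := hbok.2 u hu1
        by_contra hne
        apply hu2
        cases hyu : y u <;> cases hbu : b u <;> simp_all
      · intro hy u hu
        by_cases hu2 : u ∈ B
        · rw [hy u hu2]; exact hbok.2 u hu
        · have : ok u true ∧ ok u false := by
            by_contra hcon
            exact hu2 (mem_filter.2 ⟨mem_univ _, hu, hcon⟩)
          cases y u
          · exact this.2
          · exact this.1
    have hBt : (B.card : ℝ) ≤ t := by
      refine le_trans ?_ hb2
      have : B ⊆ univ.filter fun u => Tight c θ u (E b) := by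
        intro u hu
        obtain ⟨hu1, hu2⟩ := (mem_filter.1 hu).2
        refine mem_filter.2 ⟨mem_univ _, ?_⟩
        have hnot : ¬ok u (!b u) := by
          intro h'
          have h2 := hbok.2 u hu1
          apply hu2
          cases hbu : b u <;> simp_all
        unfold Tight
        rw [hrow' b u hu1]
        have h3 := slack_le_add c θ u (Function.update (row u ω) v (b u))
          (Function.update (row u ω) v (!b u))
        have h4 : ∑ w, ind (Function.update (row u ω) v (b u) w ≠
            Function.update (row u ω) v (!b u) w) ≤ 1 := by
          rw [Finset.sum_eq_single v]
          · exact ind_le_one _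
          · intro w _ hw
            exact ind_false (by simp [Function.update_of_ne hw])
          · simp
        have h5 : slack c θ u (Function.update (row u ω) v (!b u)) < 0 := not_le.1 hnot
        linarith
      exact_mod_cast card_le_card this
    have hmain := h B b hBt
    rw [← pr_fixed B b p, ← pr_fixed B b fun x => 0 ≤ slack c θ v x, mul_left_comm] at hmain
    have hmain := le_of_mul_le_mul_left hmain (by positivity)
    rw [← Finset.mul_expect]
    calc _ ≤ pr (fun y => (∀ u ∈ B, y u = b u) ∧ p y) := by
          refine Finset.expect_le_expect fun y _ => ind_mono ?_
          rintro ⟨h1, -, h2⟩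
          rw [hrow] at h2
          exact ⟨(hagree y).1 ((hF y).1 h1).2, h2⟩
      _ ≤ _ := hmain
      _ = _ := by
          unfold pr
          congr 1
          refine Finset.expect_congr rfl fun y _ => ?_
          rw [propext (hF y), propext (hagree y), and_comm]
  · have h0 : ∀ y, ind (Friendly c θ (E y) ∧
        ((univ.filter fun u => Tight c θ u (E y)).card : ℝ) ≤ t ∧ p (row v (E y))) = 0 :=
      fun y => ind_false fun hy => hex ⟨y, hy⟩
    simp_rw [h0]
    rw [Finset.expect_const_zero]
    exact Finset.expect_nonneg fun y _ => mul_nonneg hε0 (ind_nonneg _)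

lemma pr_le_slack (c : V → Bool × Bool) (θ : ℝ) (v : V) (s τ : ℝ) :
    pr (fun x => s + θ + τ ≤ lin (helpCoef c v) x) * pr (fun x => |lin (mixCoef c v) x| ≤ s) ≤
      pr (fun x => τ ≤ slack c θ v x) := by
  rw [← pr_and_of_disjoint (univ.filter fun w => (c w).1 = (c v).1)]
  · refine pr_mono fun x hx => ?_
    unfold slack
    linarith [hx.1, hx.2]
  · intro x y h hx
    rwa [← lin_congr (x := x) fun w hw => h w (mem_filter.2 ⟨mem_univ _, ?_⟩)]
    by_contra h'
    exact hw (by simp [helpCoef, h'])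
  · intro x y h hx
    rwa [← lin_congr (x := x) fun w hw => h w fun h' => hw (mixCoef_eq_zero (mem_filter.1 h').2)]

lemma pr_slack_le_piecewise (c : V → Bool × Bool) (θ : ℝ) (v : V) (B : Finset V) (b : V → Bool)
    {t : ℝ} (ht : (B.card : ℝ) ≤ t) :
    pr (fun x => t ≤ slack c θ v x) ≤ pr (fun x => 0 ≤ slack c θ v (B.piecewise b x)) := by
  refine pr_mono fun x hx => ?_
  have h1 := slack_le_add c θ v x (B.piecewise b x)
  have h2 : ∑ w, ind (x w ≠ B.piecewise b x w) ≤ B.card := by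
    calc _ ≤ ∑ w, ind (w ∈ B) := Finset.sum_le_sum fun w _ => ind_mono fun h => by
          by_contra hw
          exact h (Finset.piecewise_eq_of_notMem _ _ _ hw).symm
      _ = _ := by rw [sum_ind]; simp
  linarith

lemma prod_le_pr_friendly (c : V → Bool × Bool) (θ s : ℝ) :
    (∏ u, pr (fun x => s + θ ≤ lin (helpCoef c u) x)) *
      pr (fun ω : Sym2 V → Bool => ∀ u, |lin (mixCoef c u) (row u ω)| ≤ s) ≤
      pr (Friendly c θ) := by
  set f : V → (Sym2 V → Bool) → ℝ := fun u ω => ind (s + θ ≤ lin (helpCoef c u) (row u ω)) with hf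
  have hprod : ∀ ω, ∏ u, f u ω = ind (∀ u, s + θ ≤ lin (helpCoef c u) (row u ω)) := by
    intro ω
    by_cases h : ∀ u, s + θ ≤ lin (helpCoef c u) (row u ω)
    · rw [ind_true h]
      exact Finset.prod_eq_one fun u _ => ind_true (h u)
    · rw [ind_false h]
      push Not at h
      obtain ⟨u, hu⟩ := h
      exact Finset.prod_eq_zero (mem_univ u) (ind_false (not_le.2 hu))
  have hharris : ∏ u, pr (fun x => s + θ ≤ lin (helpCoef c u) x) ≤
      pr (fun ω : Sym2 V → Bool => ∀ u, s + θ ≤ lin (helpCoef c u) (row u ω)) := by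
    have := harris_prod univ f (fun _ _ => ind_nonneg _) fun u ω ω' h => ind_mono fun h' =>
      h'.trans (Finset.sum_le_sum fun w _ =>
        mul_le_mul_of_nonneg_left (cbit_mono (h _)) (helpCoef_nonneg c u w))
    simp_rw [hprod] at this
    refine le_trans (le_of_eq (Finset.prod_congr rfl fun u _ => ?_)) this
    exact (pr_comp (pair_injective u) _).symm
  refine (mul_le_mul_of_nonneg_right hharris (pr_nonneg _)).trans ?_
  classical
  rw [← pr_and_of_disjoint (univ.filter fun z : Sym2 V => ∃ u w, z = s(u, w) ∧ (c w).1 = (c u).1)]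
  · refine pr_mono fun ω hω u => ?_
    unfold slack
    linarith [hω.1 u, hω.2 u]
  · intro ω ω' h hx u
    have hlin : lin (helpCoef c u) (row u ω) = lin (helpCoef c u) (row u ω') :=
      lin_congr fun w hw => h _ (mem_filter.2 ⟨mem_univ _, u, w, rfl, ?_⟩)
    · exact hlin ▸ hx u
    by_contra h'
    exact hw (by simp [helpCoef, h'])
  · intro ω ω' h hx u
    have hlin : lin (mixCoef c u) (row u ω) = lin (mixCoef c u) (row u ω') :=
      lin_congr fun w hw => h _ fun h' => hw (mixCoef_eq_zero ?_)
    · exact hlin ▸ hx u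
    obtain ⟨-, u', w', hz, hc⟩ := mem_filter.1 h'
    rcases Sym2.eq_iff.1 hz with ⟨rfl, rfl⟩ | ⟨rfl, rfl⟩
    · exact hc
    · exact hc.symm

lemma one_sub_le_pr_abs_lin_le {ι : Type*} [Fintype ι] [DecidableEq ι] (a : ι → ℝ) {A : ℝ}
    (hA : ∑ i, a i ^ 2 ≤ A) (hA0 : 0 < A) {s : ℝ} (hs : 0 ≤ s) :
    1 - 2 * Real.exp (-(2 * s ^ 2 / A)) ≤ pr (fun x => |lin a x| ≤ s) := by
  have h1 := chernoff_abs a hA hA0 hs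
  have h2 := pr_not fun x => s ≤ |lin a x|
  have h3 : pr (fun x => ¬s ≤ |lin a x|) ≤ pr (fun x => |lin a x| ≤ s) :=
    pr_mono fun x hx => (not_le.1 hx).le
  linarith

lemma one_sub_le_pr_forall_abs_lin_row_le (b : V → V → ℝ) {A : ℝ}
    (hA : ∀ u, ∑ w, b u w ^ 2 ≤ A) (hA0 : 0 < A) {s : ℝ} (hs : 0 ≤ s) :
    1 - Fintype.card V * (2 * Real.exp (-(2 * s ^ 2 / A))) ≤
      pr (fun ω : Sym2 V → Bool => ∀ u, |lin (b u) (row u ω)| ≤ s) := by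
  have h1 := pr_not fun ω : Sym2 V → Bool => ∃ u, s ≤ |lin (b u) (row u ω)|
  have h2 := pr_exists_le fun u (ω : Sym2 V → Bool) => s ≤ |lin (b u) (row u ω)|
  have h3 : ∑ u, pr (fun ω : Sym2 V → Bool => s ≤ |lin (b u) (row u ω)|) ≤
      ∑ _u : V, 2 * Real.exp (-(2 * s ^ 2 / A)) :=
    Finset.sum_le_sum fun u _ =>
      (pr_comp (pair_injective u) fun x => s ≤ |lin (b u) x|).trans_le
        (chernoff_abs (b u) (hA u) hA0 hs)
  have h4 : pr (fun ω : Sym2 V → Bool => ¬∃ u, s ≤ |lin (b u) (row u ω)|) ≤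
      pr (fun ω : Sym2 V → Bool => ∀ u, |lin (b u) (row u ω)| ≤ s) :=
    pr_mono fun ω hω u => (not_le.1 fun h => hω ⟨u, h⟩).le
  rw [Finset.sum_const, nsmul_eq_mul, Finset.card_univ] at h3
  linarith

end Resample

/-! ### Tight vertices -/

section Tight

variable {V : Type*} [Fintype V] [DecidableEq V]

lemma sum_cbit {κ : Type*} [Fintype κ] [DecidableEq κ] (y : κ → Bool) :
    ∑ i, cbit (y i) = ones y - (Fintype.card κ : ℝ) / 2 := by
  have h : ∀ i, cbit (y i) = ind (y i = true) - 1 / 2 := by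
    intro i
    cases y i
    · rw [ind_false (by decide)]; norm_num [cbit]
    · rw [ind_true rfl]; norm_num [cbit]
  simp_rw [h]
  rw [Finset.sum_sub_distrib, sum_ind, Finset.sum_const, nsmul_eq_mul, Finset.card_univ]
  unfold ones
  ring

lemma lin_helpCoef (c : V → Bool × Bool) (u : V) (x : V → Bool) :
    lin (helpCoef c u) x = lin (ownCoef c u) x +
      (ones (fun w : {w // c w = ((c u).1, !(c u).2)} => x w) -
        (Fintype.card {w // c w = ((c u).1, !(c u).2)} : ℝ) / 2) := by
  have h : ∑ w : {w // c w = ((c u).1, !(c u).2)}, cbit (x w) =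
      ∑ w, if c w = ((c u).1, !(c u).2) then cbit (x w) else 0 := by
    rw [← Finset.sum_filter]
    exact (Finset.sum_subtype _ (by simp) fun w => cbit (x w)).symm
  rw [← sum_cbit, h]
  unfold lin
  rw [← Finset.sum_add_distrib]
  refine Finset.sum_congr rfl fun w _ => ?_
  unfold helpCoef ownCoef
  rcases eq_or_ne w u with rfl | hw
  · simp [Prod.ext_iff]
  · rcases hw2 : c w with ⟨a, b⟩
    rcases hu2 : c u with ⟨a', b'⟩
    cases a <;> cases b <;> cases a' <;> cases b' <;> simp [hw]

/-- The total deviation of the mixed degree and of the degree into the own class, offset by `D`. -/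
noncomputable def dev (c : V → Bool × Bool) (D : ℝ) (u : V) (x : V → Bool) : ℝ :=
  |lin (mixCoef c u) x| + |lin (ownCoef c u) x| + D

/-- The weight of a vertex: doubled when the vertex is tight. -/
noncomputable def weight (c : V → Bool × Bool) (θ D k : ℝ) (u : V) (x : V → Bool) : ℝ :=
  (1 + ind (slack c θ u x < 1)) * Real.exp (-(200 * dev c D u x / k))

lemma weight_nonneg (c : V → Bool × Bool) (θ D k : ℝ) (u : V) (x : V → Bool) :
    0 ≤ weight c θ D k u x :=
  mul_nonneg (by linarith [ind_nonneg (slack c θ u x < 1)]) (Real.exp_pos _).le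

lemma expect_prod_weight_le (c : V → Bool × Bool) (i : Bool × Bool) {θ D k : ℝ}
    (hk : (Fintype.card {w // c w = (i.1, !i.2)} : ℝ) = k) (hk0 : 0 < k) (hD1 : 1 ≤ D)
    (hDθ : θ ≤ D) (hD : k ≤ D ^ 2) (U : Finset V) (hU : ∀ u ∈ U, c u = i) :
    𝔼 ω, ind (Friendly c θ ω) * ∏ u ∈ U, weight c θ D k u (row u ω) ≤ pr (Friendly c θ) := by
  induction U using Finset.induction_on with
  | empty => simp [pr]
  | insert u U hu ih =>
    refine le_trans ?_ (ih fun u' hu' => hU u' (mem_insert_of_mem hu'))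
    obtain rfl : c u = i := hU u (mem_insert_self _ _)
    have hUc : ∀ u' ∈ U, c u' = c u := fun u' hu' => hU u' (mem_insert_of_mem hu')
    have hφ : Function.Injective fun w : {w // c w = ((c u).1, !(c u).2)} => s(u, (w : V)) :=
      (pair_injective u).comp Subtype.val_injective
    refine expect_le_of_extend hφ _ _ fun ω => ?_
    set E : ({w // c w = ((c u).1, !(c u).2)} → Bool) → Sym2 V → Bool := fun y =>
      Function.extend (fun w : {w // c w = ((c u).1, !(c u).2)} => s(u, (w : V))) y ω with hE
    change 𝔼 y, ind (Friendly c θ (E y)) * ∏ u' ∈ insert u U, weight c θ D k u' (row u' (E y)) ≤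
      𝔼 y, ind (Friendly c θ (E y)) * ∏ u' ∈ U, weight c θ D k u' (row u' (E y))
    have hin : ∀ y (w : {w // c w = ((c u).1, !(c u).2)}), E y s(u, (w : V)) = y w :=
      fun y w => hφ.extend_apply y ω w
    have hout : ∀ y z, (∀ w, c w = ((c u).1, !(c u).2) → s(u, w) ≠ z) → E y z = ω z :=
      fun y z hz => Function.extend_apply' _ _ _ fun ⟨w, hw⟩ => hz w w.2 hw
    have hother : ∀ y, ∀ u' ∈ U, row u' (E y) = row u' ω := by
      intro y u' hu'
      funext z
      refine hout y _ fun w hw h => ?_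
      rcases Sym2.eq_iff.1 h with ⟨h1, -⟩ | ⟨-, h2⟩
      · exact hu (h1 ▸ hu')
      · have := hUc u' hu'
        rw [← h2, hw] at this
        exact absurd (congrArg Prod.snd this) (by simp)
    have hmono : ∀ y y', y ≤ y' → E y ≤ E y' := by
      intro y y' h z
      by_cases hz : ∃ w : {w // c w = ((c u).1, !(c u).2)}, s(u, (w : V)) = z
      · obtain ⟨w, rfl⟩ := hz
        rw [hin, hin]; exact h w
      · rw [hout y z fun w hw h => hz ⟨⟨w, hw⟩, h⟩, hout y' z fun w hw h => hz ⟨⟨w, hw⟩, h⟩]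
    have hfixed : ∀ y a b, (c b).1 ≠ (c a).1 → E y s(a, b) = ω s(a, b) := by
      intro y a b hab
      refine hout y _ fun w hw h => ?_
      have hw1 : (c w).1 = (c u).1 := by rw [hw]
      rcases Sym2.eq_iff.1 h with ⟨rfl, rfl⟩ | ⟨rfl, rfl⟩
      · exact hab hw1
      · exact hab hw1.symm
    set M := lin (mixCoef c u) (row u ω) with hM
    set O := lin (ownCoef c u) (row u ω) with hO
    have hmix : ∀ y, lin (mixCoef c u) (row u (E y)) = M := fun y =>
      lin_congr fun w hw => hfixed y u w fun h => hw (mixCoef_eq_zero h)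
    have hown : ∀ y, lin (ownCoef c u) (row u (E y)) = O := fun y =>
      lin_congr fun w hw => hout y _ fun w' hw' h => by
        have : w' = w := by
          rcases Sym2.eq_iff.1 h with ⟨-, h⟩ | ⟨h1, h2⟩
          · exact h
          · exact h2.trans h1
        subst this
        refine hw ?_
        have : c w' ≠ c u := fun h' => absurd (congrArg Prod.snd (hw'.symm.trans h')) (by simp)
        simp [ownCoef, this]
    set τ : ℝ := k / 2 + θ + |M| - O with hτ
    have hslack : ∀ y, slack c θ u (row u (E y)) = ones y - τ := by
      intro y
      have h1 : (fun w : {w // c w = ((c u).1, !(c u).2)} => row u (E y) w) = y :=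
        funext fun w => hin y w
      unfold slack
      rw [lin_helpCoef, hmix, hown, h1, hk]
      ring
    set g : ({w // c w = ((c u).1, !(c u).2)} → Bool) → ℝ := fun y =>
      ind (∀ w, w ≠ u → 0 ≤ slack c θ w (row w (E y))) *
        ∏ u' ∈ U, weight c θ D k u' (row u' ω) with hg
    have hprod : ∀ y, ∏ u' ∈ U, weight c θ D k u' (row u' (E y)) =
        ∏ u' ∈ U, weight c θ D k u' (row u' ω) := fun y =>
      Finset.prod_congr rfl fun u' hu' => by rw [hother y u' hu']
    have hprod0 : 0 ≤ ∏ u' ∈ U, weight c θ D k u' (row u' ω) :=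
      Finset.prod_nonneg fun u' _ => weight_nonneg ..
    have hF : ∀ y, ind (Friendly c θ (E y)) * ∏ u' ∈ U, weight c θ D k u' (row u' (E y)) =
        g y * ind (τ ≤ ones y) := by
      intro y
      have : Friendly c θ (E y) ↔
          (∀ w, w ≠ u → 0 ≤ slack c θ w (row w (E y))) ∧ τ ≤ ones y := by
        constructor
        · intro h
          refine ⟨fun w _ => h w, ?_⟩
          have := h u
          rw [hslack] at this
          linarith
        · rintro ⟨h1, h2⟩ w
          by_cases hw : w = u
          · subst hw
            rw [hslack]
            linarith
          · exact h1 w hw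
      rw [hprod, propext this, ind_and, hg]
      ring
    have hgm : Monotone g := fun y y' h =>
      mul_le_mul_of_nonneg_right (ind_mono fun h' w hw => (h' w hw).trans
        (slack_mono c θ w (fun z => hmono y y' h _) fun z hz => by
          rw [row, row, hfixed y w z hz, hfixed y' w z hz])) hprod0
    have hd : dev c D u (row u ω) = |M| + |O| + D := rfl
    have hmain := expect_tight_le hgm (fun y => mul_nonneg (ind_nonneg _) hprod0) hk hk0
      (d := dev c D u (row u ω)) (τ := τ) (by rw [hd]; linarith [abs_nonneg M, abs_nonneg O])
      (by
        have : D ≤ dev c D u (row u ω) := by rw [hd]; linarith [abs_nonneg M, abs_nonneg O]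
        nlinarith)
      (by rw [hd, hτ]; linarith [neg_abs_le O])
    have hw : ∀ y, weight c θ D k u (row u (E y)) =
        (1 + ind ((ones y : ℝ) < τ + 1)) * Real.exp (-(200 * dev c D u (row u ω) / k)) := by
      intro y
      have : (slack c θ u (row u (E y)) < 1) = ((ones y : ℝ) < τ + 1) := by
        rw [hslack]; exact propext ⟨fun h => by linarith, fun h => by linarith⟩
      unfold weight dev
      rw [this, hmix, hown]
    calc _ = Real.exp (-(200 * dev c D u (row u ω) / k)) *
          𝔼 y, g y * ind (τ ≤ ones y) * (1 + ind ((ones y : ℝ) < τ + 1)) := by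
          rw [Finset.mul_expect]
          refine Finset.expect_congr rfl fun y _ => ?_
          rw [Finset.prod_insert hu, mul_left_comm, hF, hw]
          ring
      _ ≤ Real.exp (-(200 * dev c D u (row u ω) / k)) *
          (Real.exp (200 * dev c D u (row u ω) / k) * 𝔼 y, g y * ind (τ ≤ ones y)) :=
          mul_le_mul_of_nonneg_left hmain (Real.exp_pos _).le
      _ = _ := by
          rw [← mul_assoc, ← Real.exp_add, neg_add_cancel, Real.exp_zero, one_mul]
          exact Finset.expect_congr rfl fun y _ => (hF y).symm

open Classical in
lemma pr_many_tight_le (c : V → Bool × Bool) (i : Bool × Bool) {θ D k : ℝ}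
    (hk : (Fintype.card {w // c w = (i.1, !i.2)} : ℝ) = k) (hk0 : 0 < k) (hD1 : 1 ≤ D)
    (hDθ : θ ≤ D) (hD : k ≤ D ^ 2) (H t : ℝ) :
    pr (fun ω => Friendly c θ ω ∧ ∑ u, dev c D u (row u ω) ≤ H ∧
      t ≤ ((univ.filter fun u => c u = i ∧ Tight c θ u ω).card : ℝ)) ≤
      Real.exp (200 * H / k - t / 2) * pr (Friendly c θ) := by
  set U := univ.filter fun u => c u = i with hU
  have h := expect_prod_weight_le c i hk hk0 hD1 hDθ hD U fun u hu => (mem_filter.1 hu).2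
  have hpt : ∀ ω, Real.exp (t / 2 - 200 * H / k) * ind (Friendly c θ ω ∧
      ∑ u, dev c D u (row u ω) ≤ H ∧
      t ≤ ((univ.filter fun u => c u = i ∧ Tight c θ u ω).card : ℝ)) ≤
      ind (Friendly c θ ω) * ∏ u ∈ U, weight c θ D k u (row u ω) := by
    intro ω
    by_cases hω : Friendly c θ ω ∧ ∑ u, dev c D u (row u ω) ≤ H ∧
      t ≤ ((univ.filter fun u => c u = i ∧ Tight c θ u ω).card : ℝ)
    · rw [ind_true hω, ind_true hω.1, mul_one, one_mul]
      obtain ⟨-, h1, h2⟩ := hω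
      have hw : ∀ u, Real.exp (ind (Tight c θ u ω) / 2 - 200 * dev c D u (row u ω) / k) ≤
          weight c θ D k u (row u ω) := by
        intro u
        rw [sub_eq_add_neg, Real.exp_add]
        refine mul_le_mul_of_nonneg_right ?_ (Real.exp_pos _).le
        change _ ≤ 1 + ind (Tight c θ u ω)
        by_cases ht : Tight c θ u ω
        · rw [ind_true ht]
          have := Real.exp_one_lt_d9
          have h3 : Real.exp (1 / 2) ^ 2 = Real.exp 1 := by
            rw [← Real.exp_nat_mul]; norm_num
          nlinarith [Real.exp_pos (1 / 2)]
        · rw [ind_false ht]; norm_num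
      refine le_trans ?_ (Finset.prod_le_prod (fun u _ => (Real.exp_pos _).le) fun u _ => hw u)
      rw [← Real.exp_sum, Real.exp_le_exp, Finset.sum_sub_distrib, ← Finset.sum_div,
        ← Finset.sum_div, ← Finset.mul_sum]
      have h4 : ∑ u ∈ U, ind (Tight c θ u ω) =
          ((univ.filter fun u => c u = i ∧ Tight c θ u ω).card : ℝ) := by
        rw [sum_ind, hU, Finset.filter_filter]
      have h5 : ∑ u ∈ U, dev c D u (row u ω) ≤ H := by
        refine le_trans (Finset.sum_le_sum_of_subset_of_nonneg (Finset.subset_univ _) ?_) h1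
        intro u _ _
        unfold dev
        positivity
      rw [h4]
      have h6 : 200 * ∑ u ∈ U, dev c D u (row u ω) ≤ 200 * H := by linarith
      have h7 := div_le_div_of_nonneg_right h6 hk0.le
      linarith
    · rw [ind_false hω, mul_zero]
      exact mul_nonneg (ind_nonneg _) (Finset.prod_nonneg fun u _ => weight_nonneg ..)
  have h2 := (Finset.expect_le_expect fun ω (_ : ω ∈ univ) => hpt ω).trans h
  rw [← Finset.mul_expect] at h2
  have h3 := mul_le_mul_of_nonneg_left h2 (Real.exp_pos (200 * H / k - t / 2)).le
  rw [← mul_assoc, ← Real.exp_add] at h3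
  have h4 : 200 * H / k - t / 2 + (t / 2 - 200 * H / k) = 0 := by ring
  rw [h4, Real.exp_zero, one_mul] at h3
  exact h3

end Tight

/-! ### Irregular vertices are rare -/

section Main

variable {V : Type*} [Fintype V] [DecidableEq V]

/-- Coefficients of the pairs joining `v` to the vertices with label `i`. -/
def classCoef (c : V → Bool × Bool) (i : Bool × Bool) (v w : V) : ℝ :=
  if w ≠ v ∧ c w = i then 1 else 0

lemma abs_classCoef_le (c : V → Bool × Bool) (i : Bool × Bool) (v w : V) :
    |classCoef c i v w| ≤ 1 := by
  unfold classCoef; split_ifs <;> norm_num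

lemma sum_sq_le {ι : Type*} [Fintype ι] {a : ι → ℝ} (ha : ∀ i, |a i| ≤ 1) :
    ∑ i, a i ^ 2 ≤ Fintype.card ι := by
  calc _ ≤ ∑ _i : ι, (1 : ℝ) := Finset.sum_le_sum fun i _ => (sq_le_one_iff_abs_le_one _).2 (ha i)
    _ = _ := by simp

lemma abs_lin_piecewise_sub_le {ι : Type*} [Fintype ι] [DecidableEq ι] {a : ι → ℝ}
    (ha : ∀ i, |a i| ≤ 1) (B : Finset ι) (b x : ι → Bool) :
    |lin a (B.piecewise b x) - lin a x| ≤ B.card := by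
  refine (abs_lin_sub_le a _ _).trans ?_
  calc _ ≤ ∑ i, ind (i ∈ B) := Finset.sum_le_sum fun i _ => by
        by_cases hi : i ∈ B
        · rw [ind_true hi]
          exact mul_le_one₀ (ha i) (ind_nonneg _) (ind_le_one _)
        · rw [ind_false hi, Finset.piecewise_eq_of_notMem _ _ _ hi, ind_false (by simp), mul_zero]
    _ = _ := by rw [sum_ind]; simp

lemma le_pr_helpCoef (c : V → Bool × Bool) {m s : ℝ} (v : V) (hm : 0 < m) (hs : 0 ≤ s)
    (hc : ∀ i, m ≤ (Fintype.card {w // c w = i} : ℝ)) (h1 : (Fintype.card V : ℝ) ≤ s ^ 2)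
    (h2 : 16 * s ≤ m) :
    1 / 4 * Real.exp (-(512 * s ^ 2 / m)) ≤ pr (fun x => s ≤ lin (helpCoef c v) x) := by
  set R := univ.filter fun w => w ≠ v ∧ (c w).1 = (c v).1 with hR
  have hRm : m ≤ (R.card : ℝ) := by
    refine (hc ((c v).1, !(c v).2)).trans ?_
    rw [Fintype.card_subtype]
    refine Nat.cast_le.2 (card_le_card fun w hw => ?_)
    have hw' := (mem_filter.1 hw).2
    refine mem_filter.2 ⟨mem_univ _, ?_, by rw [hw']⟩
    rintro rfl
    exact absurd (congrArg Prod.snd hw') (by simp)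
  have hRV : (R.card : ℝ) ≤ Fintype.card V := Nat.cast_le.2 (card_le_univ R)
  have h := anticoncentration R rfl (hm.trans_le hRm) hs (hRV.trans h1) (h2.trans hRm)
  have hcoef : (fun i => if i ∈ R then (1 : ℝ) else 0) = helpCoef c v := by
    funext w
    simp [helpCoef, hR]
  rw [hcoef] at h
  refine le_trans ?_ h
  have : 512 * s ^ 2 / R.card ≤ 512 * s ^ 2 / m :=
    div_le_div_of_nonneg_left (by positivity) hm hRm
  have := Real.exp_le_exp.2 (neg_le_neg this)
  linarith

lemma exp_neg_two_le : Real.exp (-2) ≤ 1 / 4 := by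
  have h : (2 : ℝ) ≤ Real.exp 1 := by linarith [Real.exp_one_gt_d9]
  have h1 : Real.exp 2 = Real.exp 1 ^ 2 := by rw [← Real.exp_nat_mul]; norm_num
  rw [Real.exp_neg, ← one_div, h1]
  exact one_div_le_one_div_of_le (by norm_num) (by nlinarith)

lemma le_pr_friendly (c : V → Bool × Bool) {q L a θ : ℝ} (hV : (Fintype.card V : ℝ) = 2 * q ^ 2)
    (hq : 1 ≤ q) (hL : 2 ≤ L) (ha : 0 < a) (hθ : |θ| ≤ 2 * q)
    (hc : ∀ i, a * q ^ 2 ≤ (Fintype.card {w // c w = i} : ℝ)) (hLq : 48 * L ≤ a * q)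
    (hexp : 8 * q ^ 2 * Real.exp (-L ^ 2) ≤ 1) :
    1 / 2 * Real.exp (-(2 * q ^ 2 * (2 + 4608 * L ^ 2 / a))) ≤ pr (Friendly c θ) := by
  have hq0 : 0 < q := by linarith
  have hqL : 0 ≤ q * (L - 2) := mul_nonneg hq0.le (by linarith)
  refine le_trans ?_ (prod_le_pr_friendly c θ (q * L))
  rw [mul_comm (1 / 2 : ℝ)]
  refine mul_le_mul ?_ ?_ (by norm_num) (Finset.prod_nonneg fun _ _ => pr_nonneg _)
  · have h1 : ∀ u, Real.exp (-(2 + 4608 * L ^ 2 / a)) ≤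
        pr (fun x => q * L + θ ≤ lin (helpCoef c u) x) := by
      intro u
      have h2 := le_pr_helpCoef c (m := a * q ^ 2) (s := 3 * (q * L)) u (by positivity)
        (by positivity) hc (by rw [hV]; nlinarith [mul_nonneg hq0.le hqL])
        (by nlinarith [mul_le_mul_of_nonneg_left hLq hq0.le])
      have h3 : pr (fun x => 3 * (q * L) ≤ lin (helpCoef c u) x) ≤
          pr (fun x => q * L + θ ≤ lin (helpCoef c u) x) :=
        pr_mono fun x hx => by nlinarith [(abs_le.1 hθ).2]
      refine le_trans ?_ (h2.trans h3)
      have h4 : 512 * (3 * (q * L)) ^ 2 / (a * q ^ 2) = 4608 * L ^ 2 / a := by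
        field_simp
        ring
      rw [h4, neg_add, Real.exp_add]
      exact mul_le_mul_of_nonneg_right exp_neg_two_le (Real.exp_pos _).le
    refine le_trans (le_of_eq ?_) (Finset.prod_le_prod (fun u _ => (Real.exp_pos _).le)
      fun u _ => h1 u)
    rw [Finset.prod_const, Finset.card_univ, ← Real.exp_nat_mul, hV]
    congr 1
    ring
  · have h1 := one_sub_le_pr_forall_abs_lin_row_le (mixCoef c) (A := 2 * q ^ 2)
      (fun u => (sum_sq_le (abs_mixCoef_le c u)).trans_eq hV) (by positivity)
      (s := q * L) (by positivity)
    have h2 : 2 * (q * L) ^ 2 / (2 * q ^ 2) = L ^ 2 := by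
      field_simp
    rw [h2, hV, neg_eq_neg_one_mul (L ^ 2), ← neg_eq_neg_one_mul] at h1
    linarith

lemma pr_not_sum_dev_le (c : V → Bool × Bool) {q L : ℝ}
    (hV : (Fintype.card V : ℝ) = 2 * q ^ 2) (hq : 1 ≤ q) :
    pr (fun ω : Sym2 V → Bool => ¬∑ u, dev c (2 * q) u (row u ω) ≤ q ^ 3 * (2 * L ^ 3 + 4)) ≤
      2 * Real.exp (4 * q ^ 2 - q ^ 2 * L ^ 3) := by
  have hq0 : 0 < q := by linarith
  have hone : ∀ b : V → V → ℝ, (∀ u w, |b u w| ≤ 1) →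
      pr (fun ω : Sym2 V → Bool => q ^ 3 * L ^ 3 ≤ ∑ u, |lin (b u) (row u ω)|) ≤
        Real.exp (4 * q ^ 2 - q ^ 2 * L ^ 3) := by
    intro b hb
    refine (pr_total_irregularity_le b hb (l := 1 / q) (by positivity) _).trans ?_
    have h2 : (2 : ℝ) ^ Fintype.card V ≤ Real.exp (2 * q ^ 2) := by
      calc (2 : ℝ) ^ Fintype.card V ≤ Real.exp 1 ^ Fintype.card V :=
            pow_le_pow_left₀ (by norm_num) (by linarith [Real.exp_one_gt_d9]) _
        _ = _ := by rw [← Real.exp_nat_mul, hV, mul_one]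
    refine (mul_le_mul_of_nonneg_right h2 (Real.exp_pos _).le).trans_eq ?_
    rw [← Real.exp_add, hV]
    congr 1
    field_simp
    ring
  have hmix := hone (mixCoef c) (abs_mixCoef_le c)
  have hown := hone (ownCoef c) (abs_ownCoef_le c)
  refine le_trans (pr_mono fun ω hω => ?_) ((pr_or_le _ _).trans
    ((add_le_add hmix hown).trans_eq (two_mul _).symm))
  by_contra h
  push Not at h
  refine hω ?_
  unfold dev
  rw [Finset.sum_add_distrib, Finset.sum_add_distrib, Finset.sum_const, nsmul_eq_mul,
    Finset.card_univ, hV]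
  nlinarith [h.1, h.2]

open Classical in
lemma pr_friendly_and_irregular_at_le (c : V → Bool × Bool) {q L a θ R : ℝ}
    (hV : (Fintype.card V : ℝ) = 2 * q ^ 2) (hq : 1 ≤ q) (hL : 2 ≤ L) (ha : 0 < a)
    (hθ : |θ| ≤ 2 * q) (hc : ∀ i, a * q ^ 2 ≤ (Fintype.card {w // c w = i} : ℝ))
    (hLq : 112 * L ^ 4 ≤ a * q) (hexp : 8 * q ^ 2 * Real.exp (-L ^ 2) ≤ 1)
    (hR : q * L ^ 9 + 4 * (q * L ^ 4) ≤ R) (hfin : L + 25088 * L ^ 8 / a + 5 ≤ L ^ 18) (v : V) :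
    pr (fun ω => Friendly c θ ω ∧
      ((univ.filter fun u => Tight c θ u ω).card : ℝ) ≤ 4 * (q * L ^ 4) ∧
      ∃ i, R ≤ |lin (classCoef c i v) (row v ω)|) ≤ Real.exp (-L) * pr (Friendly c θ) := by
  have hq0 : 0 < q := by linarith
  refine pr_friendly_and_row_le c θ v (fun x => ∃ i, R ≤ |lin (classCoef c i v) x|)
    (Real.exp_pos _).le fun B b hB => ?_
  have hirr : pr (fun x => ∃ i, R ≤ |lin (classCoef c i v) (B.piecewise b x)|) ≤
      8 * Real.exp (-L ^ 18) := by
    have h1 : ∀ i, pr (fun x => R ≤ |lin (classCoef c i v) (B.piecewise b x)|) ≤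
        2 * Real.exp (-L ^ 18) := by
      intro i
      have h2 := chernoff_abs (classCoef c i v) (A := 2 * q ^ 2)
        ((sum_sq_le (abs_classCoef_le c i v)).trans_eq hV) (by positivity) (s := q * L ^ 9)
        (by positivity)
      have h3 : 2 * (q * L ^ 9) ^ 2 / (2 * q ^ 2) = L ^ 18 := by
        field_simp
      rw [h3] at h2
      refine le_trans (pr_mono fun x hx => ?_) h2
      have h4 := abs_lin_piecewise_sub_le (abs_classCoef_le c i v) B b x
      have h5 := abs_sub_abs_le_abs_sub (lin (classCoef c i v) (B.piecewise b x))
        (lin (classCoef c i v) x)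
      linarith
    refine (pr_exists_le _).trans ((Finset.sum_le_sum fun i _ => h1 i).trans_eq ?_)
    rw [Finset.sum_const, nsmul_eq_mul]
    norm_num
    ring
  have hslack : 1 / 8 * Real.exp (-(25088 * L ^ 8 / a)) ≤
      pr (fun x => 0 ≤ slack c θ v (B.piecewise b x)) := by
    refine le_trans ?_ ((pr_le_slack c θ v (q * L) (4 * (q * L ^ 4))).trans
      (pr_slack_le_piecewise c θ v B b hB))
    have hL4 : L ≤ L ^ 4 := le_self_pow₀ (by linarith) (by norm_num)
    have hqL4 : q * L ≤ q * L ^ 4 := mul_le_mul_of_nonneg_left hL4 hq0.le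
    have hqL : q * 2 ≤ q * L := mul_le_mul_of_nonneg_left hL hq0.le
    have h1 := le_pr_helpCoef c (m := a * q ^ 2) (s := 7 * (q * L ^ 4)) v (by positivity)
      (by positivity) hc (by rw [hV]; nlinarith) (by nlinarith)
    have h2 : pr (fun x => 7 * (q * L ^ 4) ≤ lin (helpCoef c v) x) ≤
        pr (fun x => q * L + θ + 4 * (q * L ^ 4) ≤ lin (helpCoef c v) x) :=
      pr_mono fun x hx => by linarith [(abs_le.1 hθ).2]
    have h3 : 512 * (7 * (q * L ^ 4)) ^ 2 / (a * q ^ 2) = 25088 * L ^ 8 / a := by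
      field_simp
      ring
    rw [h3] at h1
    have h4 := one_sub_le_pr_abs_lin_le (mixCoef c v) (A := 2 * q ^ 2)
      ((sum_sq_le (abs_mixCoef_le c v)).trans_eq hV) (by positivity) (s := q * L) (by positivity)
    have h5 : 2 * (q * L) ^ 2 / (2 * q ^ 2) = L ^ 2 := by
      field_simp
    rw [h5] at h4
    have h6 : Real.exp (-L ^ 2) ≤ q ^ 2 * Real.exp (-L ^ 2) :=
      le_mul_of_one_le_left (Real.exp_pos _).le (by nlinarith)
    have h7 : (1 : ℝ) / 2 ≤ pr (fun x => |lin (mixCoef c v) x| ≤ q * L) := by linarith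
    have h8 := mul_le_mul (h1.trans h2) h7 (by norm_num) (pr_nonneg _)
    linarith
  refine hirr.trans (le_trans ?_ (mul_le_mul_of_nonneg_left hslack (Real.exp_pos _).le))
  have h64 : (64 : ℝ) ≤ Real.exp 5 := by
    have h1 : Real.exp 5 = Real.exp 1 ^ 5 := by rw [← Real.exp_nat_mul]; norm_num
    rw [h1]
    refine le_trans ?_ (pow_le_pow_left₀ (by norm_num)
      (show (2.5 : ℝ) ≤ Real.exp 1 by linarith [Real.exp_one_gt_d9]) 5)
    norm_num
  have h9 : Real.exp 5 * Real.exp (-L ^ 18) ≤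
      Real.exp (-L) * Real.exp (-(25088 * L ^ 8 / a)) := by
    rw [← Real.exp_add, ← Real.exp_add, Real.exp_le_exp]
    linarith
  have := Real.exp_pos (-L ^ 18)
  nlinarith

open Classical in
theorem pr_friendly_and_irregular_le (c : V → Bool × Bool) {q L a θ R : ℝ}
    (hV : (Fintype.card V : ℝ) = 2 * q ^ 2) (hq : 1 ≤ q) (hL : 2 ≤ L) (ha : 0 < a)
    (hθ : |θ| ≤ 2 * q) (hc : ∀ i, a * q ^ 2 ≤ (Fintype.card {w // c w = i} : ℝ))
    (hLq : 112 * L ^ 4 ≤ a * q) (hexp : 8 * q ^ 2 * Real.exp (-L ^ 2) ≤ 1)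
    (hR : q * L ^ 9 + 4 * (q * L ^ 4) ≤ R) (hfin : L + 25088 * L ^ 8 / a + 5 ≤ L ^ 18)
    (htight : L + 200 * (2 * L ^ 3 + 4) / a ≤ L ^ 4 / 2)
    (hgood : L + 2 + 8 + 9216 * L ^ 2 / a ≤ L ^ 3) :
    pr (fun ω => Friendly c θ ω ∧ ∃ v i, R ≤ |lin (classCoef c i v) (row v ω)|) ≤
      (2 * q ^ 2 + 5) * Real.exp (-L) * pr (Friendly c θ) := by
  have hq0 : 0 < q := by linarith
  have hL4 : L ≤ L ^ 4 := le_self_pow₀ (by linarith) (by norm_num)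
  set H : ℝ := q ^ 3 * (2 * L ^ 3 + 4) with hH
  have hA : pr (fun ω : Sym2 V → Bool => ¬∑ u, dev c (2 * q) u (row u ω) ≤ H) ≤
      Real.exp (-L) * pr (Friendly c θ) := by
    refine (pr_not_sum_dev_le c hV hq).trans (le_trans ?_ (mul_le_mul_of_nonneg_left
      (le_pr_friendly c hV hq hL ha hθ hc (by linarith) hexp) (Real.exp_pos _).le))
    have h4 : Real.exp 2 * Real.exp (4 * q ^ 2 - q ^ 2 * L ^ 3) ≤
        Real.exp (-L) * Real.exp (-(2 * q ^ 2 * (2 + 4608 * L ^ 2 / a))) := by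
      rw [← Real.exp_add, ← Real.exp_add, Real.exp_le_exp]
      have hq2 : 1 ≤ q ^ 2 := one_le_pow₀ hq
      have h5 := mul_le_mul_of_nonneg_left hgood (sq_nonneg q)
      have h6 : q ^ 2 * (L + 2 + 8 + 9216 * L ^ 2 / a) =
          q ^ 2 * (L + 2) + 8 * q ^ 2 + 2 * q ^ 2 * (4608 * L ^ 2 / a) := by ring
      nlinarith
    have h5 : (4 : ℝ) ≤ Real.exp 2 := by
      have h1 : Real.exp 2 = Real.exp 1 ^ 2 := by rw [← Real.exp_nat_mul]; norm_num
      rw [h1]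
      nlinarith [Real.exp_one_gt_d9]
    have := Real.exp_pos (4 * q ^ 2 - q ^ 2 * L ^ 3)
    nlinarith
  have hD : ∀ i, pr (fun ω => Friendly c θ ω ∧ ∑ u, dev c (2 * q) u (row u ω) ≤ H ∧
      q * L ^ 4 ≤ ((univ.filter fun u => c u = i ∧ Tight c θ u ω).card : ℝ)) ≤
      Real.exp (-L) * pr (Friendly c θ) := by
    intro i
    have hk := hc (i.1, !i.2)
    have hk0 : 0 < a * q ^ 2 := by positivity
    have hkV : (Fintype.card {w // c w = (i.1, !i.2)} : ℝ) ≤ 2 * q ^ 2 :=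
      hV ▸ Nat.cast_le.2 (Fintype.card_subtype_le _)
    refine (pr_many_tight_le c i (D := 2 * q) rfl (hk0.trans_le hk) (by linarith)
      (by linarith [(abs_le.1 hθ).2]) (by nlinarith) H (q * L ^ 4)).trans
      (mul_le_mul_of_nonneg_right (Real.exp_le_exp.2 ?_) (pr_nonneg _))
    have h1 : 200 * H / Fintype.card {w // c w = (i.1, !i.2)} ≤ 200 * H / (a * q ^ 2) :=
      div_le_div_of_nonneg_left (by positivity) hk0 hk
    have h2 : 200 * H / (a * q ^ 2) = q * (200 * (2 * L ^ 3 + 4) / a) := by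
      rw [hH]
      field_simp
    have h3 := mul_le_mul_of_nonneg_left htight hq0.le
    nlinarith
  have hC := pr_friendly_and_irregular_at_le c hV hq hL ha hθ hc hLq hexp hR hfin
  refine le_trans (pr_mono (q := fun ω =>
    (¬∑ u, dev c (2 * q) u (row u ω) ≤ H) ∨
    (∃ i, Friendly c θ ω ∧ ∑ u, dev c (2 * q) u (row u ω) ≤ H ∧
      q * L ^ 4 ≤ ((univ.filter fun u => c u = i ∧ Tight c θ u ω).card : ℝ)) ∨
    ∃ v, Friendly c θ ω ∧
      ((univ.filter fun u => Tight c θ u ω).card : ℝ) ≤ 4 * (q * L ^ 4) ∧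
      ∃ i, R ≤ |lin (classCoef c i v) (row v ω)|) ?_) ?_
  · rintro ω ⟨hF, v, hv⟩
    by_cases h1 : ∑ u, dev c (2 * q) u (row u ω) ≤ H
    · by_cases h2 : ∃ i,
        q * L ^ 4 ≤ ((univ.filter fun u => c u = i ∧ Tight c θ u ω).card : ℝ)
      · obtain ⟨i, hi⟩ := h2
        exact Or.inr (Or.inl ⟨i, hF, h1, hi⟩)
      · push Not at h2
        refine Or.inr (Or.inr ⟨v, hF, ?_, hv⟩)
        have h3 : (univ.filter fun u => Tight c θ u ω).card =
            ∑ i, (univ.filter fun u => c u = i ∧ Tight c θ u ω).card := by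
          rw [Finset.card_eq_sum_card_fiberwise (f := c) (t := univ) (by simp)]
          refine Finset.sum_congr rfl fun i _ => ?_
          rw [Finset.filter_filter]
          simp_rw [and_comm]
        rw [h3, Nat.cast_sum]
        refine (Finset.sum_le_sum fun i _ => (h2 i).le).trans_eq ?_
        rw [Finset.sum_const, nsmul_eq_mul]
        norm_num
    · exact Or.inl h1
  · refine (pr_or_le _ _).trans ((add_le_add hA ((pr_or_le _ _).trans (add_le_add
      ((pr_exists_le _).trans (Finset.sum_le_sum fun i _ => hD i))
      ((pr_exists_le _).trans (Finset.sum_le_sum fun v _ => hC v))))).trans_eq ?_)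
    rw [Finset.sum_const, Finset.sum_const, nsmul_eq_mul, nsmul_eq_mul, Finset.card_univ,
      Finset.card_univ, hV]
    norm_num
    ring

end Main

/-! ### Choice of the parameters -/

lemma exists_parameters {a η k : ℝ} (ha : 0 < a) (hη : 0 < η) (hk : 0 < k) :
    ∃ n₀ : ℕ, ∀ n : ℕ, n₀ ≤ n → ∃ L : ℝ, 1 ≤ √(n : ℝ) ∧ 2 ≤ L ∧
      112 * L ^ 4 ≤ a * √(n : ℝ) ∧ 8 * √(n : ℝ) ^ 2 * Real.exp (-L ^ 2) ≤ 1 ∧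
      √(n : ℝ) * L ^ 9 + 4 * (√(n : ℝ) * L ^ 4) ≤ (n : ℝ) ^ (1 / 2 + η) - 1 ∧
      L + 25088 * L ^ 8 / a + 5 ≤ L ^ 18 ∧
      L + 200 * (2 * L ^ 3 + 4) / a ≤ L ^ 4 / 2 ∧
      L + 2 + 8 + 9216 * L ^ 2 / a ≤ L ^ 3 ∧
      (2 * √(n : ℝ) ^ 2 + 5) * Real.exp (-L) ≤ (n : ℝ) ^ (-k) := by
  set δ : ℝ := min η 1 / 10 with hδ
  have hδ0 : 0 < δ := by positivity
  have hδη : 10 * δ ≤ η := by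
    have := min_le_left η 1
    linarith
  have hδ1 : 5 * δ ≤ 1 / 2 := by
    have := min_le_right η 1
    linarith
  have hLt : Filter.Tendsto (fun n : ℕ => (n : ℝ) ^ δ) Filter.atTop Filter.atTop :=
    (tendsto_rpow_atTop hδ0).comp tendsto_natCast_atTop_atTop
  have hexp := ((tendsto_rpow_mul_exp_neg_mul_atTop_nhds_zero ((k + 2) / δ) 1 one_pos).comp
    hLt).eventually (gt_mem_nhds (show (0 : ℝ) < 1 by norm_num))
  have hlarge := hLt.eventually_ge_atTop (6 + 30000 / a)
  obtain ⟨n₀, hn₀⟩ := Filter.eventually_atTop.1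
    ((hexp.and hlarge).and (Filter.eventually_ge_atTop 8))
  refine ⟨n₀, fun n hn => ?_⟩
  obtain ⟨⟨h1, h2⟩, h8⟩ := hn₀ n hn
  have hn8 : (8 : ℝ) ≤ n := by exact_mod_cast h8
  have hn0 : (0 : ℝ) < n := by linarith
  set L : ℝ := (n : ℝ) ^ δ with hL
  set b : ℝ := 1 / a with hb
  have hb0 : 0 < b := by positivity
  have hdiv : ∀ z : ℝ, z / a = z * b := fun z => by rw [hb]; ring
  rw [hdiv] at h2
  have hL6 : 6 ≤ L := by linarith
  have hq1 : 1 ≤ √(n : ℝ) := Real.one_le_sqrt.2 (by linarith)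
  have hqsq : √(n : ℝ) ^ 2 = n := Real.sq_sqrt hn0.le
  have hexp' : (n : ℝ) ^ k * (n : ℝ) ^ 2 * Real.exp (-L) ≤ 1 := by
    have h3 : L ^ ((k + 2) / δ) = (n : ℝ) ^ k * (n : ℝ) ^ 2 := by
      rw [hL, ← Real.rpow_mul hn0.le, mul_div_cancel₀ _ hδ0.ne', Real.rpow_add hn0]
      norm_num
    simp only [Function.comp_apply, neg_mul, one_mul] at h1
    rw [← hL, h3] at h1
    exact h1.le
  have hpow : ∀ j : ℕ, 1 ≤ L ^ j := fun j => one_le_pow₀ (by linarith)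
  refine ⟨L, hq1, by linarith, ?_, ?_, ?_, ?_, ?_, ?_, ?_⟩
  · have h3 : L ^ 5 ≤ √(n : ℝ) := by
      rw [hL, ← Real.rpow_natCast, ← Real.rpow_mul hn0.le, Real.sqrt_eq_rpow]
      exact Real.rpow_le_rpow_of_exponent_le (by linarith) (by push_cast; linarith)
    have h4 : 112 ≤ a * L := by
      have : a * b = 1 := by rw [hb]; field_simp
      nlinarith
    have h5 := mul_le_mul_of_nonneg_right h4 (zero_le_one.trans (hpow 4))
    have h6 := mul_le_mul_of_nonneg_left h3 ha.le
    linarith [show a * L * L ^ 4 = a * L ^ 5 by ring]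
  · have h3 : Real.exp (-L ^ 2) ≤ Real.exp (-L) := Real.exp_le_exp.2 (by nlinarith)
    have h4 : (1 : ℝ) ≤ (n : ℝ) ^ k := Real.one_le_rpow (by linarith) hk.le
    rw [hqsq]
    have h5 : 8 * (n : ℝ) ≤ (n : ℝ) ^ k * (n : ℝ) ^ 2 := by nlinarith [sq_nonneg (n : ℝ)]
    exact (mul_le_mul h5 h3 (Real.exp_pos _).le (by positivity)).trans hexp'
  · have h3 : √(n : ℝ) * L ^ 10 ≤ (n : ℝ) ^ (1 / 2 + η) := by
      rw [hL, ← Real.rpow_natCast, ← Real.rpow_mul hn0.le, Real.sqrt_eq_rpow,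
        ← Real.rpow_add hn0]
      exact Real.rpow_le_rpow_of_exponent_le (by linarith) (by push_cast; linarith)
    have h4 : L ^ 9 + 4 * L ^ 4 + 1 ≤ L ^ 10 := by
      have h5 : L ^ 4 ≤ L ^ 9 := pow_le_pow_right₀ (by linarith) (by norm_num)
      have h6 : L ^ 10 = L * L ^ 9 := by ring
      nlinarith [hpow 9]
    have h5 := mul_le_mul_of_nonneg_left h4 (zero_le_one.trans hq1)
    linarith
  · rw [hdiv]
    have h3 : L ≤ L ^ 9 := le_self_pow₀ (by linarith) (by norm_num)
    have h4 : 25088 * L ^ 8 * b ≤ L ^ 9 := by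
      have h5 : L ^ 9 = L * L ^ 8 := by ring
      rw [h5]
      nlinarith [hpow 8]
    have h5 : L ^ 18 = L ^ 9 * L ^ 9 := by ring
    nlinarith
  · rw [hdiv]
    have h3 : 600 * L ^ 3 * b ≤ L ^ 4 / 4 := by
      have h5 : L ^ 4 = L * L ^ 3 := by ring
      rw [h5]
      nlinarith [hpow 3]
    have h6 : 216 ≤ L ^ 3 := by
      calc (216 : ℝ) = 6 ^ 3 := by norm_num
        _ ≤ _ := pow_le_pow_left₀ (by norm_num) hL6 3
    have h4 : L ≤ L ^ 4 / 4 := by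
      have h5 : L ^ 4 = L * L ^ 3 := by ring
      nlinarith
    nlinarith
  · rw [hdiv]
    have h5 : L ^ 3 = L * L ^ 2 := by ring
    have h3 : 9216 * L ^ 2 * b ≤ L ^ 3 / 2 := by
      rw [h5]
      nlinarith [hpow 2]
    have h4 : 36 ≤ L ^ 2 := by nlinarith
    nlinarith
  · rw [hqsq, Real.rpow_neg hn0.le]
    have h4 : 0 < (n : ℝ) ^ k := Real.rpow_pos_of_pos hn0 k
    rw [← one_div, le_div_iff₀ h4]
    refine le_trans ?_ hexp'
    have h5 : 2 * (n : ℝ) + 5 ≤ (n : ℝ) ^ 2 := by nlinarith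
    have h6 := mul_le_mul_of_nonneg_right h5 (mul_pos (Real.exp_pos (-L)) h4).le
    linarith

/-! ### Graphs encoded by bits -/

section Graph

variable {N : ℕ}

/-- Whether two labels have the same first and different second coordinates. -/
def opposite (i j : Bool × Bool) : Bool := (i.1 == j.1) && (i.2 != j.2)

lemma opposite_comm (i j : Bool × Bool) : opposite i j = opposite j i := by
  rcases i with ⟨_ | _, _ | _⟩ <;> rcases j with ⟨_ | _, _ | _⟩ <;> rfl

/-- The graph in which the bit of a pair is flipped when its vertices have opposite labels. -/
def graph (c : Fin N → Bool × Bool) (ω : Sym2 (Fin N) → Bool) : SimpleGraph (Fin N) where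
  Adj u w := u ≠ w ∧ ω s(u, w) ≠ opposite (c u) (c w)
  symm := ⟨fun u w h => ⟨h.1.symm, by rw [Sym2.eq_swap, opposite_comm]; exact h.2⟩⟩
  loopless := ⟨fun u h => h.1 rfl⟩

lemma bijective_graph_diag (c : Fin N → Bool × Bool) :
    Function.Bijective fun ω : Sym2 (Fin N) → Bool => (graph c ω, fun v => ω s(v, v)) := by
  constructor
  · intro ω ω' h
    obtain ⟨h1, h2⟩ := Prod.ext_iff.1 h
    funext z
    induction z using Sym2.ind with
    | _ u w =>
      by_cases huw : u = w
      · subst huw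
        exact congrFun h2 u
      · have h3 := congrArg (fun G => SimpleGraph.Adj G u w) h1
        simp only [graph, ne_eq, huw, not_false_eq_true, true_and, eq_iff_iff] at h3
        cases hx : ω s(u, w) <;> cases hy : ω' s(u, w) <;>
          cases ho : opposite (c u) (c w) <;> simp_all
  · classical
    rintro ⟨G, d⟩
    refine ⟨Sym2.lift ⟨fun u w => if u = w then d u else
      xor (decide (G.Adj u w)) (opposite (c u) (c w)), fun u w => ?_⟩, ?_⟩
    · by_cases h : u = w
      · simp [h]
      · simp [h, Ne.symm h, G.adj_comm, opposite_comm]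
    · refine Prod.ext ?_ ?_
      · ext u w
        by_cases h : u = w
        · simp [h]
        · by_cases ha : G.Adj u w <;> cases ho : opposite (c u) (c w) <;> simp [graph, h, ha, ho]
      · funext v
        simp

lemma graphProb_eq_pr (c : Fin N → Bool × Bool) (P : SimpleGraph (Fin N) → Prop) :
    graphProb N P = pr fun ω => P (graph c ω) := by
  classical
  have hcard : Fintype.card (Sym2 (Fin N)) = N.choose 2 + N := by
    rw [Sym2.card, Fintype.card_fin, Nat.choose_succ_succ' N 1, Nat.choose_one_right, add_comm]
  have hcount : Nat.card {ω // P (graph c ω)} = Nat.card {G // P G} * 2 ^ N := by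
    rw [← Nat.card_congr ((Equiv.ofBijective _ (bijective_graph_diag c)).subtypeEquiv
      (p := fun ω => P (graph c ω)) (q := fun G => P G.1) fun ω => Iff.rfl).symm,
      Nat.card_congr (Equiv.prodSubtypeFstEquivSubtypeProd (p := P)), Nat.card_prod]
    simp
  have hpr : pr (fun ω => P (graph c ω)) =
      (Nat.card {ω // P (graph c ω)} : ℝ) / 2 ^ Fintype.card (Sym2 (Fin N)) := by
    unfold pr
    rw [Fintype.expect_eq_sum_div_card, sum_ind, Nat.card_eq_fintype_card, Fintype.card_subtype]
    simp
  unfold graphProb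
  rw [hpr, hcount, hcard, pow_add]
  push_cast
  field_simp

end Graph

section Partition

variable {N : ℕ}

/-- The sign of a bit in the graph: negative for pairs with opposite labels. -/
def sgn (i j : Bool × Bool) : ℝ := if opposite i j then -1 else 1

lemma degIn_graph (c : Fin N → Bool × Bool) (ω : Sym2 (Fin N) → Bool) (v : Fin N)
    (S : Finset (Fin N)) :
    (degIn (graph c ω) v S : ℝ) =
      (S.card : ℝ) / 2 - (if v ∈ S then 1 / 2 else 0) +
        ∑ w ∈ S, if w = v then 0 else sgn (c v) (c w) * cbit (row v ω w) := by
  classical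
  have h : degIn (graph c ω) v S = (S.filter fun w => (graph c ω).Adj v w).card := by
    unfold degIn
    rw [Nat.card_eq_fintype_card, Fintype.card_subtype]
    congr 1
    ext w
    simp
  have hadj : ∀ w, ind ((graph c ω).Adj v w) = 1 / 2 - (if v = w then 1 / 2 else 0) +
      if w = v then 0 else sgn (c v) (c w) * cbit (row v ω w) := by
    intro w
    by_cases hw : w = v
    · rw [if_pos hw, if_pos hw.symm, ind_false fun h => h.1 hw.symm]
      norm_num
    rw [if_neg hw, if_neg (Ne.symm hw)]
    unfold row sgn cbit
    cases hx : ω s(v, w) <;> cases ho : opposite (c v) (c w) <;>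
      simp [graph, ind, Ne.symm hw, hx, ho] <;> norm_num
  rw [h, ← sum_ind, Finset.sum_congr rfl fun w _ => hadj w, Finset.sum_add_distrib,
    Finset.sum_sub_distrib, Finset.sum_ite_eq, Finset.sum_const, nsmul_eq_mul, mul_one_div]

lemma friendlyPair_graph_iff {n : ℕ} (hN : N = 2 * n) (c : Fin N → Bool × Bool)
    (ω : Sym2 (Fin N) → Bool) (S : Finset (Fin N)) (hS : S.card = n) (t : ℝ) :
    FriendlyPair (graph c ω) S t ↔ ∀ v, t + 1 / 2 ≤ lin (fun w => if w = v then 0 else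
      (if (w ∈ S ↔ v ∈ S) then 1 else -1) * sgn (c v) (c w)) (row v ω) := by
  have hcompl : (Sᶜ.card : ℝ) = n := by
    rw [card_compl, hS, Fintype.card_fin, hN]
    congr 1
    omega
  have hS' : (S.card : ℝ) = n := by rw [hS]
  set f : Fin N → Fin N → ℝ := fun v w => if w = v then 0 else sgn (c v) (c w) * cbit (row v ω w)
    with hf
  have hdeg : ∀ v T, (degIn (graph c ω) v T : ℝ) =
      (T.card : ℝ) / 2 - (if v ∈ T then 1 / 2 else 0) + ∑ w ∈ T, f v w := degIn_graph c ω
  have hlin : ∀ v, lin (fun w => if w = v then 0 else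
      (if (w ∈ S ↔ v ∈ S) then 1 else -1) * sgn (c v) (c w)) (row v ω) =
      (if v ∈ S then 1 else -1) * (∑ w ∈ S, f v w - ∑ w ∈ Sᶜ, f v w) := by
    intro v
    unfold lin
    rw [← Finset.sum_add_sum_compl S, mul_sub, Finset.mul_sum, Finset.mul_sum, sub_eq_add_neg,
      ← Finset.sum_neg_distrib]
    congr 1
    · refine Finset.sum_congr rfl fun w hw => ?_
      by_cases hv : v ∈ S <;> by_cases hwv : w = v <;> simp [hf, hw, hv, hwv]
    · refine Finset.sum_congr rfl fun w hw => ?_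
      have hw' := Finset.mem_compl.1 hw
      by_cases hv : v ∈ S <;> by_cases hwv : w = v <;> simp [hf, hw', hv, hwv]
  have hv : ∀ v, (t + 1 / 2 ≤ lin (fun w => if w = v then 0 else
      (if (w ∈ S ↔ v ∈ S) then 1 else -1) * sgn (c v) (c w)) (row v ω)) ↔
      if v ∈ S then (degIn (graph c ω) v Sᶜ : ℝ) + t ≤ degIn (graph c ω) v S
      else (degIn (graph c ω) v S : ℝ) + t ≤ degIn (graph c ω) v Sᶜ := by
    intro v
    rw [hlin, hdeg, hdeg, hcompl, hS']
    by_cases hv : v ∈ S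
    · simp only [hv, if_true, Finset.mem_compl, not_true, if_false]
      constructor <;> intro h <;> linarith
    · simp only [hv, if_true, Finset.mem_compl, not_false_eq_true, if_false]
      constructor <;> intro h <;> linarith
  simp_rw [hv]
  constructor
  · rintro ⟨h1, h2⟩ v
    by_cases hv : v ∈ S
    · rw [if_pos hv]; exact h1 v hv
    · rw [if_neg hv]; exact h2 v (Finset.mem_compl.2 hv)
  · intro h
    refine ⟨fun v hv => ?_, fun v hv => ?_⟩
    · have := h v
      rwa [if_pos hv] at this
    · have := h v
      rwa [if_neg (Finset.mem_compl.1 hv)] at this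

/-- The label of a vertex: whether it lies on the same side of both partitions, and whether it
lies in `A`. -/
def label (A B : Finset (Fin N)) (v : Fin N) : Bool × Bool :=
  (decide (v ∈ A) == decide (v ∈ B), decide (v ∈ A))

lemma friendlyPair_and_iff {n : ℕ} (hN : N = 2 * n) (A B : Finset (Fin N)) (hA : A.card = n)
    (hB : B.card = n) (t : ℝ) (ω : Sym2 (Fin N) → Bool) :
    (FriendlyPair (graph (label A B) ω) A t ∧ FriendlyPair (graph (label A B) ω) B t) ↔
      Friendly (label A B) (t + 1 / 2) ω := by
  rw [friendlyPair_graph_iff hN _ _ A hA, friendlyPair_graph_iff hN _ _ B hB, ← forall_and]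
  refine forall_congr' fun v => ?_
  set c := label A B with hc
  set s : ℝ := if v ∈ A then 1 else -1 with hs
  have h1 : lin (fun w => if w = v then 0 else
      (if (w ∈ A ↔ v ∈ A) then 1 else -1) * sgn (c v) (c w)) (row v ω) =
      lin (helpCoef c v) (row v ω) + s * lin (mixCoef c v) (row v ω) := by
    rw [mul_lin]
    unfold lin
    rw [← Finset.sum_add_distrib]
    refine Finset.sum_congr rfl fun w _ => ?_
    rw [← add_mul]
    congr 1
    by_cases hw : w = v
    · subst hw; simp [helpCoef, mixCoef]
    · by_cases ha : w ∈ A <;> by_cases hb : w ∈ B <;> by_cases ha' : v ∈ A <;>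
        by_cases hb' : v ∈ B <;>
        simp [helpCoef, mixCoef, sgn, opposite, hc, hs, label, hw, ha, hb, ha', hb']
  have h2 : lin (fun w => if w = v then 0 else
      (if (w ∈ B ↔ v ∈ B) then 1 else -1) * sgn (c v) (c w)) (row v ω) =
      lin (helpCoef c v) (row v ω) - s * lin (mixCoef c v) (row v ω) := by
    rw [mul_lin]
    unfold lin
    rw [← Finset.sum_sub_distrib]
    refine Finset.sum_congr rfl fun w _ => ?_
    rw [← sub_mul]
    congr 1
    by_cases hw : w = v
    · subst hw; simp [helpCoef, mixCoef]
    · by_cases ha : w ∈ A <;> by_cases hb : w ∈ B <;> by_cases ha' : v ∈ A <;>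
        by_cases hb' : v ∈ B <;>
        simp [helpCoef, mixCoef, sgn, opposite, hc, hs, label, hw, ha, hb, ha', hb']
  have h3 : |lin (mixCoef c v) (row v ω)| = |s * lin (mixCoef c v) (row v ω)| := by
    rw [abs_mul]
    by_cases ha : v ∈ A <;> simp [hs, ha]
  rw [h1, h2]
  unfold slack
  rw [h3]
  constructor
  · rintro ⟨h4, h5⟩
    have : |s * lin (mixCoef c v) (row v ω)| ≤
        lin (helpCoef c v) (row v ω) - (t + 1 / 2) := abs_le.2 ⟨by linarith, by linarith⟩
    linarith
  · intro h
    have h4 := le_abs_self (s * lin (mixCoef c v) (row v ω))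
    have h5 := neg_abs_le (s * lin (mixCoef c v) (row v ω))
    exact ⟨by linarith, by linarith⟩

lemma abs_degIn_sub_le (c : Fin N → Bool × Bool) (ω : Sym2 (Fin N) → Bool) (v : Fin N)
    (i : Bool × Bool) {P : Finset (Fin N)} (hP : ∀ w, w ∈ P ↔ c w = i) :
    |(degIn (graph c ω) v P : ℝ) - (P.card : ℝ) / 2| ≤
      |lin (classCoef c i v) (row v ω)| + 1 / 2 := by
  have h1 : (degIn (graph c ω) v P : ℝ) = (P.card : ℝ) / 2 - (if v ∈ P then 1 / 2 else 0) +
      sgn (c v) i * lin (classCoef c i v) (row v ω) := by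
    have h2 : sgn (c v) i * lin (classCoef c i v) (row v ω) =
        ∑ w ∈ P, if w = v then 0 else sgn (c v) (c w) * cbit (row v ω w) := by
      unfold lin
      rw [Finset.mul_sum]
      symm
      refine Finset.sum_subset_zero_on_sdiff (Finset.subset_univ _) ?_ ?_
      · intro w hw
        have : c w ≠ i := fun h => (Finset.mem_sdiff.1 hw).2 ((hP w).2 h)
        simp [classCoef, this]
      · intro w hw
        have := (hP w).1 hw
        by_cases hwv : w = v
        · simp [classCoef, hwv]
        · simp [classCoef, hwv, this]
    rw [h2, degIn_graph]
  have hsgn : |sgn (c v) i| = 1 := by unfold sgn; split_ifs <;> simp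
  have h3 : |sgn (c v) i * lin (classCoef c i v) (row v ω)| =
      |lin (classCoef c i v) (row v ω)| := by rw [abs_mul, hsgn, one_mul]
  rw [h1, ← h3]
  have h4 := le_abs_self (sgn (c v) i * lin (classCoef c i v) (row v ω))
  have h5 := neg_abs_le (sgn (c v) i * lin (classCoef c i v) (row v ω))
  split_ifs <;> exact abs_le.2 ⟨by linarith, by linarith⟩

lemma exists_label_of_part {A B P : Finset (Fin N)}
    (hP : P ∈ ({A ∩ B, A ∩ Bᶜ, Aᶜ ∩ B, Aᶜ ∩ Bᶜ} : Set (Finset (Fin N)))) :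
    ∃ i, ∀ w, w ∈ P ↔ label A B w = i := by
  rcases hP with rfl | rfl | rfl | rfl
  · refine ⟨(true, true), fun w => ?_⟩
    by_cases ha : w ∈ A <;> by_cases hb : w ∈ B <;> simp [label, ha, hb]
  · refine ⟨(false, true), fun w => ?_⟩
    by_cases ha : w ∈ A <;> by_cases hb : w ∈ B <;> simp [label, ha, hb]
  · refine ⟨(false, false), fun w => ?_⟩
    by_cases ha : w ∈ A <;> by_cases hb : w ∈ B <;> simp [label, ha, hb]
  · refine ⟨(true, false), fun w => ?_⟩
    by_cases ha : w ∈ A <;> by_cases hb : w ∈ B <;> simp [label, ha, hb]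

lemma le_card_label {n : ℕ} (hN : N = 2 * n) {A B : Finset (Fin N)} (hA : A.card = n)
    (hB : B.card = n) {a : ℝ} (h1 : a * n ≤ ((A ∩ B).card : ℝ))
    (h2 : ((A ∩ B).card : ℝ) ≤ (1 - a) * n) (i : Bool × Bool) :
    a * n ≤ (Fintype.card {w // label A B w = i} : ℝ) := by
  have e1 := Finset.card_inter_add_card_sdiff A B
  have e2 := Finset.card_inter_add_card_sdiff B A
  rw [Finset.inter_comm] at e2
  have e3 := Finset.card_union_add_card_inter A B
  have e4 := Finset.card_add_card_compl (A ∪ B)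
  rw [Fintype.card_fin] at e4
  have f1 : ((A ∩ B).card : ℝ) + (A \ B).card = n := by exact_mod_cast e1.trans hA
  have f2 : ((A ∩ B).card : ℝ) + (B \ A).card = n := by exact_mod_cast e2.trans hB
  have f4 : ((A ∩ B).card : ℝ) = (A ∪ B)ᶜ.card := by
    rw [Nat.cast_inj]; omega
  rw [Fintype.card_subtype]
  have key : ∀ T : Finset (Fin N), (∀ w, w ∈ T ↔ label A B w = i) → a * n ≤ (T.card : ℝ) →
      a * n ≤ ((univ.filter fun w => label A B w = i).card : ℝ) := by
    intro T hT h
    have : (univ.filter fun w => label A B w = i) = T := by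
      ext w
      rw [hT]
      simp
    rwa [this]
  rcases i with ⟨_ | _, _ | _⟩
  · refine key (B \ A) (fun w => ?_) (by linarith)
    by_cases ha : w ∈ A <;> by_cases hb : w ∈ B <;> simp [label, ha, hb]
  · refine key (A \ B) (fun w => ?_) (by linarith)
    by_cases ha : w ∈ A <;> by_cases hb : w ∈ B <;> simp [label, ha, hb]
  · refine key (A ∪ B)ᶜ (fun w => ?_) (by linarith)
    by_cases ha : w ∈ A <;> by_cases hb : w ∈ B <;> simp [label, ha, hb]
  · refine key (A ∩ B) (fun w => ?_) (by linarith)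
    by_cases ha : w ∈ A <;> by_cases hb : w ∈ B <;> simp [label, ha, hb]

end Partition

end BisectionPair

/-- Fix `c, η > 0`. For every `k > 0` there is `n₀` such that for all
`n ≥ n₀`, `γ ∈ [−1,1]`, and every pair of bisections `A ∪ Aᶜ`, `B ∪ Bᶜ` of `[2n]` with
`cn ≤ |A ∩ B| ≤ (1−c)n`: for `G ∼ G(2n,1/2)`, `P[E_irreg,2 | E₂] ≤ n^{−k}`, stated as
`P[E_irreg,2 ∧ E₂] ≤ n^{−k} · P[E₂]`, where `E_irreg,2` is the event that some vertex `v`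
and some part `P ∈ {A∩B, A∩Bᶜ, Aᶜ∩B, Aᶜ∩Bᶜ}` satisfy `|deg(v,P) − |P|/2| ≥ n^{1/2+η}`. -/
theorem irregular_degree_conditional_two_partitions
    (c η : ℝ) (hc : 0 < c) (hη : 0 < η) :
    ∀ k : ℝ, 0 < k → ∃ n₀ : ℕ, ∀ n : ℕ, n₀ ≤ n →
      ∀ γ : ℝ, |γ| ≤ 1 →
      ∀ A B : Finset (Fin (2 * n)), A.card = n → B.card = n →
        c * n ≤ ((A ∩ B).card : ℝ) → ((A ∩ B).card : ℝ) ≤ (1 - c) * n →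
        graphProb (2 * n) (fun G =>
            (FriendlyPair G A (γ * Real.sqrt n) ∧ FriendlyPair G B (γ * Real.sqrt n)) ∧
            ∃ v : Fin (2 * n),
              ∃ P ∈ ({A ∩ B, A ∩ Bᶜ, Aᶜ ∩ B, Aᶜ ∩ Bᶜ} : Set (Finset (Fin (2 * n)))),
                (n : ℝ) ^ ((1 : ℝ) / 2 + η) ≤ |(degIn G v P : ℝ) - (P.card : ℝ) / 2|)
          ≤ (n : ℝ) ^ (-k) *
            graphProb (2 * n) (fun G =>
              FriendlyPair G A (γ * Real.sqrt n) ∧ FriendlyPair G B (γ * Real.sqrt n)) := by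
  intro k hk
  obtain ⟨n₀, hn₀⟩ := BisectionPair.exists_parameters hc hη hk
  refine ⟨n₀, fun n hn γ hγ A B hA hB h1 h2 => ?_⟩
  obtain ⟨L, hq, hL, hLq, hexp, hR, hfin, htight, hgood, hsmall⟩ := hn₀ n hn
  have hqsq : √(n : ℝ) ^ 2 = n := Real.sq_sqrt n.cast_nonneg
  have hθ : |γ * √(n : ℝ) + 1 / 2| ≤ 2 * √(n : ℝ) := by
    have h3 : |γ * √(n : ℝ)| ≤ √(n : ℝ) := by
      rw [abs_mul, abs_of_nonneg (Real.sqrt_nonneg _)]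
      exact mul_le_of_le_one_left (Real.sqrt_nonneg _) hγ
    have h4 := abs_le.1 h3
    exact abs_le.2 ⟨by linarith, by linarith⟩
  have hmain := BisectionPair.pr_friendly_and_irregular_le (BisectionPair.label A B)
    (by rw [Fintype.card_fin, hqsq]; push_cast; ring) hq hL hc hθ
    (fun i => by rw [hqsq]; exact BisectionPair.le_card_label rfl hA hB h1 h2 i)
    hLq hexp hR hfin htight hgood
  rw [BisectionPair.graphProb_eq_pr (BisectionPair.label A B),
    BisectionPair.graphProb_eq_pr (BisectionPair.label A B)]
  simp_rw [BisectionPair.friendlyPair_and_iff rfl A B hA hB]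
  refine le_trans (BisectionPair.pr_mono ?_) (hmain.trans
    (mul_le_mul_of_nonneg_right hsmall (BisectionPair.pr_nonneg _)))
  rintro ω ⟨hF, v, P, hP, hirr⟩
  obtain ⟨i, hi⟩ := BisectionPair.exists_label_of_part hP
  refine ⟨hF, v, i, ?_⟩
  have := BisectionPair.abs_degIn_sub_le (BisectionPair.label A B) ω v i hi
  linarith
end
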